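/- Let 1 < s < r be integers with r ≢ 2 (mod 4), both r and s odd, and with s ≥ 2^{t_1} + 1 and r ≥ 2^{t_2} (or r ≥ 2^{t_1} + 1 and s ≥ 2^{t_2}) for positive integers t_1, t_2, and let n ≥ 2 be an integer. Then, for the free ℤ/2-action on ℝH_{r,s} (which exists by these hypotheses), n(2^{t_1} + 2^{t_2}) − 1 ≤ TC_{ℤ/2,n}(ℝH_{r,s}) ≤ n(s+r−1) + 1. -/

import Mathlib

open scoped unitInterval

noncomputable section

/-- Topology on the projectivization, as a quotient of the nonzero vectors. -/
instance projTop (K V : Type*) [DivisionRing K] [AddCommGroup V] [Module K V]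
    [TopologicalSpace V] : TopologicalSpace (Projectivization K V) :=
  inferInstanceAs (TopologicalSpace (Quotient (projectivizationSetoid K V)))

/-- The real Milnor manifold `ℝH_{r,s}`, as the subspace of `ℝPʳ × ℝPˢ` of pairs
`([x], [y])` with `x₀y₀ + ⋯ + x_sy_s = 0` (for `s ≤ r`). -/
def RealMilnor (r s : ℕ) :
    Set (Projectivization ℝ (Fin (r + 1) → ℝ) × Projectivization ℝ (Fin (s + 1) → ℝ)) :=
  {p | ∑ i : Fin (min (s + 1) (r + 1)),
      p.1.rep (Fin.castLE (min_le_right _ _) i) * p.2.rep (Fin.castLE (min_le_left _ _) i) = 0}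

/-- The complex Milnor manifold `ℂH_{r,s}`, as the subspace of `ℂPʳ × ℂPˢ` of pairs
`([z], [w])` with `z₀w̄₀ + ⋯ + z_sw̄_s = 0` (for `s ≤ r`). -/
def ComplexMilnor (r s : ℕ) :
    Set (Projectivization ℂ (Fin (r + 1) → ℂ) × Projectivization ℂ (Fin (s + 1) → ℂ)) :=
  {p | ∑ i : Fin (min (s + 1) (r + 1)),
      p.1.rep (Fin.castLE (min_le_right _ _) i) *
        (starRingEnd ℂ) (p.2.rep (Fin.castLE (min_le_left _ _) i)) = 0}

/-- The Lusternik–Schnirelmann category of `X`: the least number of open sets covering `X`,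
each of whose inclusion into `X` is null-homotopic. -/
def lsCat (X : Type*) [TopologicalSpace X] : ℕ :=
  sInf {k | 0 < k ∧ ∃ U : Fin k → Set X,
    (∀ i, IsOpen (U i)) ∧ (⋃ i, U i) = Set.univ ∧
    ∀ i, ∃ x₀ : X, ∃ H : C(U i × I, X),
      (∀ u : U i, H (u, 0) = (u : X)) ∧ (∀ u : U i, H (u, 1) = x₀)}

/-- The fibration `π_n : X^I → X^n`, evaluating a path at the times `i/(n-1)`,
`i = 0, …, n-1`. -/
def tcPi (X : Type*) [TopologicalSpace X] (n : ℕ) (γ : C(I, X)) : Fin n → X :=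
  fun i => γ (Set.projIcc (0 : ℝ) 1 zero_le_one ((i : ℝ) / ((n : ℝ) - 1)))

/-- The `n`-th higher (sequential) topological complexity of `X`: the least number of open
sets covering `X^n`, each admitting a continuous local section of `π_n : X^I → X^n`. -/
def higherTC (X : Type*) [TopologicalSpace X] (n : ℕ) : ℕ :=
  sInf {k | 0 < k ∧ ∃ U : Fin k → Set (Fin n → X),
    (∀ i, IsOpen (U i)) ∧ (⋃ i, U i) = Set.univ ∧
    ∀ i, ∃ sec : C(U i, C(I, X)), ∀ u : U i, tcPi X n (sec u) = (u : Fin n → X)}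

/-- The `n`-th higher equivariant topological complexity of a `G`-space `X`:
the least number of `G`-invariant open sets covering `X^n` (with the diagonal action),
each admitting a `G`-equivariant map to `X^I` whose composite with `π_n` is
`G`-homotopic to the inclusion. -/
def eqHigherTC (G : Type*) [Group G] (X : Type*) [TopologicalSpace X] [MulAction G X]
    (n : ℕ) : ℕ :=
  sInf {k | 0 < k ∧ ∃ U : Fin k → Set (Fin n → X),
    (∀ i, IsOpen (U i)) ∧ (⋃ i, U i) = Set.univ ∧
    (∀ i (g : G), ∀ v ∈ U i, g • v ∈ U i) ∧
    ∀ i, ∃ sec : C(U i, C(I, X)),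
      (∀ (g : G) (v : U i) (hgv : g • (v : Fin n → X) ∈ U i) (t : I),
        (sec ⟨g • (v : Fin n → X), hgv⟩) t = g • (sec v) t) ∧
      ∃ H : C(U i × I, Fin n → X),
        (∀ v : U i, H (v, 0) = tcPi X n (sec v)) ∧
        (∀ v : U i, H (v, 1) = (v : Fin n → X)) ∧
        (∀ (g : G) (v : U i) (hgv : g • (v : Fin n → X) ∈ U i) (t : I),
          H (⟨g • (v : Fin n → X), hgv⟩, t) = g • H (v, t))}

/-- `X` has covering dimension at most `m`: every finite open cover admits an open
refinement which still covers `X` and in which every point lies in at most `m + 1` sets. -/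
def HasCovDimLE (X : Type*) [TopologicalSpace X] (m : ℕ) : Prop :=
  ∀ 𝒰 : Set (Set X), 𝒰.Finite → (∀ U ∈ 𝒰, IsOpen U) → ⋃₀ 𝒰 = Set.univ →
    ∃ 𝒱 : Set (Set X), (∀ V ∈ 𝒱, IsOpen V) ∧ ⋃₀ 𝒱 = Set.univ ∧
      (∀ V ∈ 𝒱, ∃ U ∈ 𝒰, V ⊆ U) ∧
      ∀ x : X, {V ∈ 𝒱 | x ∈ V}.encard ≤ (m + 1 : ℕ)

/-- The covering dimension of `X`. -/
def covDim (X : Type*) [TopologicalSpace X] : ℕ :=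
  sInf {m | HasCovDimLE X m}

end

set_option linter.unusedSectionVars false
set_option linter.unnecessarySeqFocus false

namespace BUP

/-! ### Cochains on lattice simplices -/

def skip {Y : Type*} (k : ℕ) (v : ℕ → Y) : ℕ → Y := fun a => if a < k then v a else v (a + 1)

def pre {Y : Type*} (sgm : ℕ → Y → ZMod 2) (j : ℕ) (v : ℕ → Y) : ZMod 2 :=
  ∏ i ∈ Finset.range j, (sgm i (v i) + sgm i (v (i + 1)))

lemma z2 (a : ZMod 2) : a + a = 0 := CharTwo.add_self_eq_zero a

lemma pre_congr {Y : Type*} (sgm : ℕ → Y → ZMod 2) (j : ℕ) (v v' : ℕ → Y)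
    (h : ∀ a ≤ j, v a = v' a) : pre sgm j v = pre sgm j v' := by
  unfold pre
  refine Finset.prod_congr rfl fun i hi => ?_
  rw [Finset.mem_range] at hi
  rw [h i (by omega), h (i + 1) (by omega)]

lemma pre_skip_sum {Y : Type*} (sgm : ℕ → Y → ZMod 2) (j : ℕ) (v : ℕ → Y) :
    ∑ k ∈ Finset.range (j + 1), pre sgm j (skip k v) = pre sgm j v := by
  induction j with
  | zero => simp [pre]
  | succ j ih =>
    rw [Finset.sum_range_succ]
    have h1 : ∀ k ∈ Finset.range (j + 1), pre sgm (j + 1) (skip k v)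
        = pre sgm j (skip k v) * (sgm j (v (j + 1)) + sgm j (v (j + 2))) := by
      intro k hk
      rw [Finset.mem_range] at hk
      rw [pre, Finset.prod_range_succ, ← pre]
      congr 2
      · rw [skip, if_neg (by omega)]
      · rw [skip, if_neg (by omega)]
    rw [Finset.sum_congr rfl h1, ← Finset.sum_mul, ih]
    have h2 : pre sgm (j + 1) (skip (j + 1) v) = pre sgm j v * (sgm j (v j) + sgm j (v (j + 2))) := by
      rw [pre, Finset.prod_range_succ, ← pre]
      congr 1
      · apply pre_congr
        intro a ha
        rw [skip, if_pos (by omega)]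
      · rw [skip, skip, if_pos (by omega), if_neg (by omega)]
    rw [h2]
    have h3 : pre sgm (j + 1) v = pre sgm j v * (sgm j (v j) + sgm j (v (j + 1))) := by
      rw [pre, Finset.prod_range_succ, ← pre]
    rw [h3, ← mul_add]
    congr 1
    have := z2 (sgm j (v (j + 2)))
    linear_combination this

lemma pre_skip_sum' {Y : Type*} (sgm : ℕ → Y → ZMod 2) (e : ℕ) (v : ℕ → Y) :
    ∑ k ∈ Finset.range (e + 1), pre sgm e (skip (k + 1) v) = pre sgm e (fun a => v (a + 1)) := by
  have h := pre_skip_sum sgm e v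
  rw [Finset.sum_range_succ'] at h
  rw [Finset.sum_range_succ]
  have h1 : pre sgm e (skip (e + 1) v) = pre sgm e v := by
    apply pre_congr
    intro a ha
    rw [skip, if_pos (by omega)]
  have h0 : pre sgm e (skip 0 v) = pre sgm e (fun a => v (a + 1)) := by
    apply pre_congr
    intro a ha
    rw [skip, if_neg (by omega)]
  rw [h1, ← h, h0]
  have := z2 (∑ k ∈ Finset.range e, pre sgm e (skip (k + 1) v))
  linear_combination this

/-- the cochain whose coboundary is the change of a cup product -/
def hh {Y : Type*} (sgm : ℕ → Y → ZMod 2) (ρ : Y → ZMod 2) (j e : ℕ) (u : ℕ → Y) : ZMod 2 :=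
  pre sgm j u * ρ (u j) * pre (fun i => sgm (i + j + 1)) e (fun a => u (a + j))

lemma hh_coboundary {Y : Type*} (sgm : ℕ → Y → ZMod 2) (ρ : Y → ZMod 2) (j e : ℕ) (v : ℕ → Y) :
    ∑ k ∈ Finset.range (j + 1 + e + 1), hh sgm ρ j e (skip k v) =
      pre sgm j v * (ρ (v j) + ρ (v (j + 1))) *
        pre (fun i => sgm (i + j + 1)) e (fun a => v (a + j + 1)) := by
  rw [show j + 1 + e + 1 = (j + 1) + (e + 1) by ring, Finset.sum_range_add]
  have h1 : ∀ k ∈ Finset.range (j + 1), hh sgm ρ j e (skip k v) = pre sgm j (skip k v) *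
      (ρ (v (j + 1)) * pre (fun i => sgm (i + j + 1)) e (fun a => v (a + j + 1))) := by
    intro k hk
    rw [Finset.mem_range] at hk
    rw [hh, mul_assoc]
    congr 2
    · rw [skip, if_neg (by omega)]
    · apply pre_congr
      intro a _
      rw [skip, if_neg (by omega)]
  have h2 : ∀ k ∈ Finset.range (e + 1), hh sgm ρ j e (skip (j + 1 + k) v) =
      (pre sgm j v * ρ (v j)) * pre (fun i => sgm (i + j + 1)) e (skip (k + 1) (fun a => v (a + j))) := by
    intro k hk
    rw [hh]
    congr 2
    · apply pre_congr
      intro a ha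
      rw [skip, if_pos (by omega)]
    · rw [skip, if_pos (by omega)]
    · funext a
      simp only [skip]
      by_cases h : a < k + 1
      · rw [if_pos h, if_pos (by omega)]
      · rw [if_neg h, if_neg (by omega)]
        congr 1
        ring
  rw [Finset.sum_congr rfl h1, Finset.sum_congr rfl h2, ← Finset.sum_mul, ← Finset.mul_sum,
    pre_skip_sum, pre_skip_sum']
  have : (fun a => v (a + 1 + j)) = (fun a => v (a + j + 1)) := by
    funext a
    congr 1
    ring
  rw [this]
  ring

/-! ### Lattice simplices -/

def Eo {m : ℕ} (e : Fin m × Bool) : ℕ := 2 * (e.1 : ℕ) + (if e.2 then 2 else 0)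
def Oo {m : ℕ} (e : Fin m × Bool) : ℕ := 2 * (e.1 : ℕ) + 1

def vert {Q : Type*} {m D : ℕ} (p : Q → Fin m × Bool) (π : Fin D ≃ Q) (k : ℕ) : Q → ℕ :=
  fun q => if (π.symm q : ℕ) < k then Oo (p q) else Eo (p q)

section faces
variable {Q : Type*} [Fintype Q] [DecidableEq Q] {m D : ℕ}

lemma face_mid (h : (ℕ → Q → ℕ) → ZMod 2) (k : ℕ) (hk0 : 0 < k) (hkD : k < D) :
    ∑ x : (Q → Fin m × Bool) × (Fin D ≃ Q), h (skip k (vert x.1 x.2)) = 0 := by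
  let s : Fin D ≃ Fin D := Equiv.swap ⟨k - 1, by omega⟩ ⟨k, hkD⟩
  have hs : ∀ y, s (s y) = y := fun y => Equiv.swap_apply_self _ _ _
  have hne : s ⟨k, hkD⟩ ≠ ⟨k, hkD⟩ := by
    simp only [s, Equiv.swap_apply_right, ne_eq, Fin.mk.injEq]
    omega
  have hsymm : s.symm = s := Equiv.symm_swap _ _
  refine Finset.sum_involution (fun x _ => (x.1, s.trans x.2)) ?_ ?_ ?_ ?_
  · rintro ⟨p, π⟩ -
    have : skip k (vert p (s.trans π)) = skip k (vert p π) := by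
      have key : ∀ a, a ≠ k → vert p (s.trans π) a = vert p π a := by
        intro a ha
        funext q
        unfold vert
        have : ((((s.trans π).symm q : Fin D) : ℕ) < a) ↔ ((π.symm q : Fin D) : ℕ) < a := by
          rw [Equiv.symm_trans_apply, hsymm]
          simp only [s]
          rw [Equiv.swap_apply_def]
          split_ifs with h1 h2
          · rw [h1]; simp only; omega
          · rw [h2]; simp only; omega
          · rfl
        simp only [this]
      funext a
      simp only [skip]
      split_ifs with h1
      · exact key a (by omega)
      · exact key (a + 1) (by omega)
    simp only [this]
    exact z2 _
  · rintro ⟨p, π⟩ - _ hx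
    simp only [Prod.mk.injEq, true_and] at hx
    have := congrArg (fun f => f ⟨k, hkD⟩) hx
    simp only [Equiv.trans_apply] at this
    exact hne (π.injective this)
  · intro x _; exact Finset.mem_univ _
  · rintro ⟨p, π⟩ -
    simp only [Prod.mk.injEq, true_and]
    ext y
    simp [hs]

lemma face_zero (h : (ℕ → Q → ℕ) → ZMod 2) (hD : 0 < D) :
    ∑ x : (Q → Fin m × Bool) × (Fin D ≃ Q), h (skip 0 (vert x.1 x.2)) = 0 := by
  let g : ∀ x : (Q → Fin m × Bool) × (Fin D ≃ Q), Q := fun x => x.2 ⟨0, hD⟩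
  refine Finset.sum_involution
    (fun x _ => (Function.update x.1 (g x) ((x.1 (g x)).1, !(x.1 (g x)).2), x.2)) ?_ ?_ ?_ ?_
  · rintro ⟨p, π⟩ -
    have : skip 0 (vert (Function.update p (g (p, π)) ((p (g (p, π))).1, !(p (g (p, π))).2)) π)
        = skip 0 (vert p π) := by
      funext a q
      simp only [skip, Nat.not_lt_zero, if_false, vert]
      by_cases hq : q = π ⟨0, hD⟩
      · subst hq
        simp [g, Oo]
      · simp only [g]
        rw [Function.update_of_ne hq]
    simp only [this]
    exact z2 _
  · rintro ⟨p, π⟩ - _ hx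
    simp only [Prod.mk.injEq, and_true] at hx
    have := congrArg (fun f => (f (g (p, π))).2) hx
    simp at this
  · intro x _; exact Finset.mem_univ _
  · rintro ⟨p, π⟩ -
    simp [g]

end faces

end BUP

namespace BUP

section core
variable {ι : Type*} [Fintype ι] [DecidableEq ι] {d : ι → ℕ} {m D : ℕ}

def refl (m : ℕ) (i : ι) (y : (Σ i, Fin (d i)) → ℕ) : (Σ i, Fin (d i)) → ℕ :=
  fun q => if q.1 = i then 2 * m - y q else y q

structure Good (m : ℕ) (ε : ι → ZMod 2) (sgm : ((Σ i, Fin (d i)) → ℕ) → ZMod 2) : Prop where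
  refl : ∀ (i : ι) (l : Fin (d i)) (y : (Σ i, Fin (d i)) → ℕ), (l : ℕ) + 1 = d i →
    (∀ q, y q ≤ 2 * m) → (y ⟨i, l⟩ = 0 ∨ y ⟨i, l⟩ = 2 * m) → sgm (refl m i y) = sgm y + ε i
  deg : ∀ (i : ι) (l l' : Fin (d i)) (y y' : (Σ i, Fin (d i)) → ℕ), (l' : ℕ) + 1 = d i → l ≠ l' →
    (∀ q, q ≠ ⟨i, l'⟩ → y q = y' q) → (y ⟨i, l⟩ = 0 ∨ y ⟨i, l⟩ = 2 * m) → sgm y = sgm y'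

def rf (e : Fin m × Bool) : Fin m × Bool := (Fin.rev e.1, !e.2)

lemma rf_rf (e : Fin m × Bool) : rf (rf e) = e := by simp [rf]

lemma Eo_rf (e : Fin m × Bool) : Eo (rf e) = 2 * m - Eo e := by
  obtain ⟨a, b⟩ := e
  have := a.2
  cases b <;> simp [rf, Eo, Fin.val_rev] <;> omega

lemma Oo_rf (e : Fin m × Bool) : Oo (rf e) = 2 * m - Oo e := by
  obtain ⟨a, b⟩ := e
  have := a.2
  simp [rf, Oo, Fin.val_rev]
  omega

lemma Eo_le (e : Fin m × Bool) : Eo e ≤ 2 * m := by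
  obtain ⟨a, b⟩ := e
  have := a.2
  cases b <;> simp [Eo] <;> omega

lemma Oo_le (e : Fin m × Bool) : Oo e ≤ 2 * m := by
  obtain ⟨a, b⟩ := e
  have := a.2
  simp only [Oo]; omega

def isB (e : Fin m × Bool) : Prop := Eo e = 0 ∨ Eo e = 2 * m

instance (e : Fin m × Bool) : Decidable (isB e) := by unfold isB; infer_instance

def nbr (e : Fin m × Bool) : Fin m × Bool :=
  if e.2 then (if h : (e.1 : ℕ) + 1 < m then (⟨e.1 + 1, h⟩, false) else e)
  else (if h : 0 < (e.1 : ℕ) then (⟨e.1 - 1, by omega⟩, true) else e)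

lemma nbr_spec (e : Fin m × Bool) (h : ¬ isB e) :
    Eo (nbr e) = Eo e ∧ nbr e ≠ e ∧ nbr (nbr e) = e := by
  obtain ⟨⟨a, ha⟩, b⟩ := e
  cases b
  · simp only [isB, Eo] at h
    have h0 : 0 < a := by
      simp at h; omega
    simp [nbr, Eo, h0]
    have : a - 1 + 1 < m := by omega
    simp [this]
    omega
  · simp only [isB, Eo] at h
    have h0 : a + 1 < m := by
      simp at h; omega
    simp [nbr, Eo, h0]
    omega

lemma vert_le (p : (Σ i, Fin (d i)) → Fin m × Bool) (π : Fin D ≃ (Σ i, Fin (d i))) (k : ℕ) (q) :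
    vert p π k q ≤ 2 * m := by
  unfold vert
  split_ifs
  · exact Oo_le _
  · exact Eo_le _

lemma face_last (hD : 0 < D) (h : (ℕ → (Σ i, Fin (d i)) → ℕ) → ZMod 2)
    (hloc : ∀ u u' : ℕ → (Σ i, Fin (d i)) → ℕ, (∀ a < D, u a = u' a) → h u = h u')
    (hinv : ∀ (i : ι) (l : Fin (d i)) (u u' : ℕ → (Σ i, Fin (d i)) → ℕ), (l : ℕ) + 1 = d i →
      (∀ a q, u a q ≤ 2 * m) → (∀ a < D, u a ⟨i, l⟩ = 0 ∨ u a ⟨i, l⟩ = 2 * m) →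
      (∀ a < D, u' a = refl m i (u a)) → h u' = h u)
    (hdeg : ∀ (i : ι) (l l' : Fin (d i)) (u : ℕ → (Σ i, Fin (d i)) → ℕ) (a : ℕ),
      (l' : ℕ) + 1 = d i → l ≠ l' → a + 1 < D →
      (∀ q, q ≠ ⟨i, l'⟩ → u a q = u (a + 1) q) → (u a ⟨i, l⟩ = 0 ∨ u a ⟨i, l⟩ = 2 * m) → h u = 0) :
    ∑ x : ((Σ i, Fin (d i)) → Fin m × Bool) × (Fin D ≃ (Σ i, Fin (d i))),
      h (skip D (vert x.1 x.2)) = 0 := by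
  have hsk : ∀ v : ℕ → (Σ i, Fin (d i)) → ℕ, h (skip D v) = h v := by
    intro v
    apply hloc
    intro a ha
    rw [skip, if_pos ha]
  simp only [hsk]
  let f : Fin D := ⟨D - 1, by omega⟩
  let pf : ((Σ i, Fin (d i)) → Fin m × Bool) → (Σ i, Fin (d i)) → (Σ i, Fin (d i)) → Fin m × Bool :=
    fun p q₀ => if isB (p q₀) then
        (if (q₀.2 : ℕ) + 1 = d q₀.1 then (fun q => if q.1 = q₀.1 then rf (p q) else p q) else p)
      else Function.update p q₀ (nbr (p q₀))
  have hlast : ∀ (p : (Σ i, Fin (d i)) → Fin m × Bool) (π : Fin D ≃ (Σ i, Fin (d i))),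
      ∀ a < D, vert p π a (π f) = Eo (p (π f)) := by
    intro p π a ha
    unfold vert
    rw [if_neg]
    simp [f]; omega
  have hzero : ∀ (p : (Σ i, Fin (d i)) → Fin m × Bool) (π : Fin D ≃ (Σ i, Fin (d i))),
      isB (p (π f)) → ¬ (((π f).2 : ℕ) + 1 = d (π f).1) → h (vert p π) = 0 := by
    intro p π h1 h2
    have hl := hlast p π
    rcases hpf : π f with ⟨i, l⟩
    rw [hpf] at h1 h2 hl
    simp only at h2
    have hd : 0 < d i := lt_of_le_of_lt (Nat.zero_le _) l.2
    let l' : Fin (d i) := ⟨d i - 1, by omega⟩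
    have hne : l ≠ l' := by
      intro hh
      apply h2
      rw [hh]
      simp only [l']
      omega
    have hne' : (⟨i, l'⟩ : Σ i, Fin (d i)) ≠ ⟨i, l⟩ := by
      intro hh
      apply hne
      simpa using hh.symm
    let k := π.symm ⟨i, l'⟩
    have hk : (k : ℕ) + 1 < D := by
      have h3 := k.2
      have : k ≠ f := by
        intro hh
        apply hne'
        rw [← hpf]
        exact (Equiv.symm_apply_eq π).mp hh
      have : (k : ℕ) ≠ D - 1 := fun hh => this (Fin.ext hh)
      omega
    refine hdeg i l l' _ k ?_ hne hk ?_ ?_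
    · simp only [l']; omega
    · intro q hq
      have : π.symm q ≠ k := fun hh => hq (π.symm.injective hh)
      have : (π.symm q : ℕ) ≠ k := fun hh => this (Fin.ext hh)
      unfold vert
      have : ((π.symm q : ℕ) < (k : ℕ)) ↔ ((π.symm q : ℕ) < (k : ℕ) + 1) := by omega
      simp only [this]
    · have := hl k (by omega)
      rw [this]
      exact h1
  refine Finset.sum_involution (fun x _ => (pf x.1 (x.2 f), x.2)) ?_ ?_ ?_ ?_
  · rintro ⟨p, π⟩ -
    simp only [pf]
    split_ifs with h1 h2
    · have : h (vert (fun q => if q.1 = (π f).1 then rf (p q) else p q) π) = h (vert p π) := by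
        refine hinv (π f).1 (π f).2 _ _ h2 (fun a q => vert_le _ _ _ _) ?_ ?_
        · intro a ha
          have := hlast p π a ha
          rw [show (⟨(π f).1, (π f).2⟩ : Σ i, Fin (d i)) = π f from rfl, this]
          exact h1
        · intro a ha
          funext q
          simp only [refl, vert]
          by_cases hq : q.1 = (π f).1
          · simp only [if_pos hq, Eo_rf, Oo_rf]
            split_ifs <;> rfl
          · simp only [if_neg hq]
      rw [this]; exact z2 _
    · exact z2 _
    · have : h (vert (Function.update p (π f) (nbr (p (π f)))) π) = h (vert p π) := by
        apply hloc
        intro a ha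
        funext q
        by_cases hq : q = π f
        · rw [hq, hlast _ π a ha, hlast _ π a ha]
          simp [(nbr_spec _ h1).1]
        · unfold vert
          rw [Function.update_of_ne hq]
      rw [this]; exact z2 _
  · rintro ⟨p, π⟩ - hx
    simp only [pf]
    split_ifs with h1 h2
    · intro hh
      simp only [Prod.mk.injEq, and_true] at hh
      have := congrArg (fun g => (g (π f)).2) hh
      simp [rf] at this
    · exact absurd (hzero p π h1 h2) hx
    · intro hh
      simp only [Prod.mk.injEq, and_true] at hh
      have := congrArg (fun g => (g (π f))) hh
      simp [(nbr_spec _ h1).2.1] at this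
  · intro x _; exact Finset.mem_univ _
  · rintro ⟨p, π⟩ -
    have : pf (pf p (π f)) (π f) = p := by
      generalize π f = q₀
      by_cases h1 : isB (p q₀)
      · by_cases h2 : (q₀.2 : ℕ) + 1 = d q₀.1
        · have h3 : isB (rf (p q₀)) := by
            unfold isB at h1 ⊢
            rw [Eo_rf]
            omega
          have e1 : pf p q₀ = fun q => if q.1 = q₀.1 then rf (p q) else p q := by
            simp only [pf]
            rw [if_pos h1, if_pos h2]
          rw [e1]
          simp only [pf]
          rw [if_pos (by simpa using h3), if_pos h2]
          funext q
          split_ifs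
          · exact rf_rf _
          · rfl
        · have e1 : pf p q₀ = p := by
            simp only [pf]
            rw [if_pos h1, if_neg h2]
          rw [e1, e1]
      · have h3 : ¬ isB (nbr (p q₀)) := by
          unfold isB at h1 ⊢
          rw [(nbr_spec _ h1).1]
          exact h1
        have e1 : pf p q₀ = Function.update p q₀ (nbr (p q₀)) := by
          simp only [pf]
          rw [if_neg h1]
        rw [e1]
        simp only [pf]
        rw [if_neg (by simpa using h3)]
        simp [(nbr_spec _ h1).2.2]
    exact Prod.ext this rfl

/-- the total cup product on the fundamental chain -/
def total (m D : ℕ) (sgm : ℕ → ((Σ i, Fin (d i)) → ℕ) → ZMod 2) : ZMod 2 :=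
  ∑ x : ((Σ i, Fin (d i)) → Fin m × Bool) × (Fin D ≃ (Σ i, Fin (d i))), pre sgm D (vert x.1 x.2)

lemma pre_split {Y : Type*} (sgm : ℕ → Y → ZMod 2) (j e : ℕ) (v : ℕ → Y) :
    pre sgm (j + 1 + e) v = pre sgm j v * (sgm j (v j) + sgm j (v (j + 1))) *
      pre (fun i => sgm (i + j + 1)) e (fun a => v (a + j + 1)) := by
  unfold pre
  rw [Finset.prod_range_add, Finset.prod_range_succ]
  congr 1
  refine Finset.prod_congr rfl fun i _ => ?_
  rw [show j + 1 + i = i + j + 1 by ring, show i + j + 1 + 1 = i + 1 + j + 1 by ring]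

lemma total_step (ε : ℕ → ι → ZMod 2) (sgm : ℕ → ((Σ i, Fin (d i)) → ℕ) → ZMod 2)
    (hsgm : ∀ j, Good m (ε j) (sgm j)) (j e : ℕ) (ρ : ((Σ i, Fin (d i)) → ℕ) → ZMod 2)
    (hρ : Good m 0 ρ) :
    ∑ x : ((Σ i, Fin (d i)) → Fin m × Bool) × (Fin (j + 1 + e) ≃ (Σ i, Fin (d i))),
      pre sgm j (vert x.1 x.2) * (ρ (vert x.1 x.2 j) + ρ (vert x.1 x.2 (j + 1))) *
        pre (fun i => sgm (i + j + 1)) e (fun a => vert x.1 x.2 (a + j + 1)) = 0 := by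
  simp only [← hh_coboundary]
  rw [Finset.sum_comm]
  apply Finset.sum_eq_zero
  intro k hk
  rw [Finset.mem_range] at hk
  rcases Nat.eq_zero_or_pos k with rfl | hk0
  · exact face_zero _ (by omega)
  rcases lt_or_eq_of_le (Nat.lt_succ_iff.mp hk) with hk' | hk'
  · exact face_mid _ k hk0 hk'
  subst hk'
  apply face_last (by omega)
  · intro u u' hu
    unfold hh
    rw [pre_congr sgm j u u' (fun a ha => hu a (by omega)), hu j (by omega),
      pre_congr _ e _ (fun a => u' (a + j)) (fun a ha => hu _ (by omega))]
  · intro i l u u' hl hle hb hu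
    unfold hh
    have hs : ∀ k a, a < j + 1 + e → sgm k (u' a) = sgm k (u a) + ε k i := by
      intro k a ha
      rw [hu a ha]
      exact (hsgm k).refl i l _ hl (hle a) (hb a ha)
    have hr : ρ (u' j) = ρ (u j) := by
      rw [hu j (by omega), hρ.refl i l _ hl (hle j) (hb j (by omega))]
      simp
    have hc : ∀ k a, a + 1 < j + 1 + e → sgm k (u' a) + sgm k (u' (a + 1)) = sgm k (u a) + sgm k (u (a + 1)) := by
      intro k a ha
      rw [hs k a (by omega), hs k (a + 1) ha]
      linear_combination z2 (ε k i)
    congr 1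
    · congr 1
      · refine Finset.prod_congr rfl fun k hk => ?_
        rw [Finset.mem_range] at hk
        exact hc k k (by omega)
    · refine Finset.prod_congr rfl fun k hk => ?_
      rw [Finset.mem_range] at hk
      have := hc (k + j + 1) (k + j) (by omega)
      simp only [show k + 1 + j = k + j + 1 by ring]
      exact this
  · intro i l l' u a hl hne ha hq hb
    unfold hh
    by_cases haj : a < j
    · have : pre sgm j u = 0 := by
        apply Finset.prod_eq_zero (i := a) (by simpa using haj)
        rw [(hsgm a).deg i l l' _ _ hl hne hq hb]
        exact z2 _
      rw [this]; simp
    · have : pre (fun i => sgm (i + j + 1)) e (fun a => u (a + j)) = 0 := by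
        apply Finset.prod_eq_zero (i := a - j) (by rw [Finset.mem_range]; omega)
        simp only [show a - j + j = a by omega, show a - j + 1 + j = a + 1 by omega]
        rw [(hsgm (a + 1)).deg i l l' _ _ hl hne hq hb]
        exact z2 _
      rw [this]; simp

lemma Good.add {ε : ι → ZMod 2} {sgm sgm' : ((Σ i, Fin (d i)) → ℕ) → ZMod 2}
    (h : Good m ε sgm) (h' : Good m ε sgm') : Good m 0 (fun y => sgm y + sgm' y) where
  refl i l y hl hle hb := by
    rw [h.refl i l y hl hle hb, h'.refl i l y hl hle hb]
    simp only [Pi.zero_apply]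
    linear_combination z2 (ε i)
  deg i l l' y y' hl hne hq hb := by
    simp only [h.deg i l l' y y' hl hne hq hb, h'.deg i l l' y y' hl hne hq hb]

theorem total_eq (ε : ℕ → ι → ZMod 2) (sgm sgm' : ℕ → ((Σ i, Fin (d i)) → ℕ) → ZMod 2)
    (hsgm : ∀ j, Good m (ε j) (sgm j)) (hsgm' : ∀ j, Good m (ε j) (sgm' j)) :
    total m D sgm = total m D sgm' := by
  let τ : ℕ → ℕ → ((Σ i, Fin (d i)) → ℕ) → ZMod 2 := fun k i => if i < k then sgm' i else sgm i
  have hτ : ∀ k i, Good m (ε i) (τ k i) := by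
    intro k i
    simp only [τ]
    split_ifs
    · exact hsgm' i
    · exact hsgm i
  have key : ∀ k ≤ D, total m D (τ k) = total m D sgm := by
    intro k
    induction k with
    | zero =>
      intro _
      congr 1
    | succ k ih =>
      intro hk
      rw [← ih (by omega)]
      obtain ⟨e, rfl⟩ : ∃ e, D = k + 1 + e := ⟨D - (k + 1), by omega⟩
      have h0 := total_step (d := d) (m := m) ε (τ k) (hτ k) k e _ ((hsgm k).add (hsgm' k))
      unfold total
      rw [← sub_eq_zero, ← Finset.sum_sub_distrib, ← h0]
      refine Finset.sum_congr rfl fun x _ => ?_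
      rw [pre_split, pre_split]
      have h1 : pre (τ (k + 1)) k (vert x.1 x.2) = pre (τ k) k (vert x.1 x.2) := by
        refine Finset.prod_congr rfl fun i hi => ?_
        rw [Finset.mem_range] at hi
        simp only [τ, if_pos hi, if_pos (Nat.lt_succ_of_lt hi)]
      have h2 : (fun i => τ (k + 1) (i + k + 1)) = (fun i => τ k (i + k + 1)) := by
        funext i
        simp only [τ]
        rw [if_neg (by omega), if_neg (by omega)]
      have h3 : τ (k + 1) k = sgm' k := by simp [τ]
      have h4 : τ k k = sgm k := by simp [τ]
      rw [h1, h2, h3, h4]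
      have := z2 (sgm k (vert x.1 x.2 k))
      have := z2 (sgm k (vert x.1 x.2 (k+1)))
      rw [← sub_mul, ← mul_sub]
      congr 2
      rw [CharTwo.sub_eq_add]
      ring
  have h1 := key D le_rfl
  rw [← h1]
  unfold total
  refine Finset.sum_congr rfl fun x _ => ?_
  refine Finset.prod_congr rfl fun i hi => ?_
  rw [Finset.mem_range] at hi
  simp only [τ, if_pos hi]

end core

end BUP

namespace BUP

section eval
variable {ι : Type*} [Fintype ι] [DecidableEq ι] {d : ι → ℕ} {m D : ℕ}

def bd (m : ℕ) (a : ℕ) : Prop := a = 0 ∨ a = 2 * m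

open Classical in
noncomputable def tau (m : ℕ) (i : ι) (y : (Σ i, Fin (d i)) → ℕ) : ZMod 2 :=
  if ∃ l : Fin (d i), y ⟨i, l⟩ = 2 * m ∧ ∀ l' < l, ¬ bd m (y ⟨i, l'⟩) then 1 else 0

lemma tau_first (i : ι) (y : (Σ i, Fin (d i)) → ℕ) (l : Fin (d i)) (hl : bd m (y ⟨i, l⟩))
    (hl' : ∀ l' < l, ¬ bd m (y ⟨i, l'⟩)) : tau m i y = if y ⟨i, l⟩ = 2 * m then 1 else 0 := by
  unfold tau
  congr 1
  simp only [eq_iff_iff]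
  constructor
  · rintro ⟨l0, h0, h1⟩
    rcases lt_trichotomy l l0 with h | h | h
    · exact absurd hl (h1 _ h)
    · rw [h]; exact h0
    · exact absurd (Or.inr h0) (hl' _ h)
  · intro h
    exact ⟨l, h, hl'⟩

lemma tau_none (i : ι) (y : (Σ i, Fin (d i)) → ℕ) 
    (hl' : ∀ l, ¬ bd m (y ⟨i, l⟩)) : tau m i y = 0 := by
  unfold tau
  rw [if_neg]
  rintro ⟨l, h, -⟩
  exact hl' l (Or.inr h)

lemma tau_congr (i : ι) (y y' : (Σ i, Fin (d i)) → ℕ)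
    (h : ∀ l : Fin (d i), y ⟨i, l⟩ = y' ⟨i, l⟩ ∨ (¬ bd m (y ⟨i, l⟩) ∧ ¬ bd m (y' ⟨i, l⟩))) :
    tau m i y = tau m i y' := by
  have hb : ∀ l : Fin (d i), bd m (y ⟨i, l⟩) ↔ bd m (y' ⟨i, l⟩) := by
    intro l
    rcases h l with h | h
    · rw [h]
    · exact iff_of_false h.1 h.2
  have hb' : ∀ l : Fin (d i), (y ⟨i, l⟩) = 2 * m ↔ (y' ⟨i, l⟩) = 2 * m := by
    intro l
    rcases h l with h | h
    · rw [h]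
    · exact iff_of_false (fun h' => h.1 (Or.inr h')) (fun h' => h.2 (Or.inr h'))
  have : (∃ l : Fin (d i), y ⟨i, l⟩ = 2 * m ∧ ∀ l' < l, ¬ bd m (y ⟨i, l'⟩)) ↔
      (∃ l : Fin (d i), y' ⟨i, l⟩ = 2 * m ∧ ∀ l' < l, ¬ bd m (y' ⟨i, l'⟩)) :=
    exists_congr fun l => and_congr (hb' l) (forall_congr' fun l' => imp_congr_right fun _ =>
      not_congr (hb l'))
  unfold tau
  by_cases h1 : ∃ l : Fin (d i), y ⟨i, l⟩ = 2 * m ∧ ∀ l' < l, ¬ bd m (y ⟨i, l'⟩)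
  · rw [if_pos h1, if_pos (this.mp h1)]
  · rw [if_neg h1, if_neg (fun h => h1 (this.mpr h))]

lemma exists_first {k : ℕ} (P : Fin k → Prop) (l : Fin k) (hl : P l) :
    ∃ l0 ≤ l, P l0 ∧ ∀ l' < l0, ¬ P l' := by
  obtain ⟨a, ha, hb⟩ := (wellFounded_lt (α := Fin k)).has_min {x | P x} ⟨l, hl⟩
  exact ⟨a, not_lt.mp (hb l hl), ha, fun l' h1 h2 => hb l' h2 h1⟩

lemma tau_good (hm : 0 < m) (i : ι) : Good (d := d) m (Pi.single i 1) (tau m i) where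
  refl i0 l y hl hle hb := by
    by_cases hi : i0 = i
    · subst hi
      obtain ⟨l0, -, h0, h1⟩ := exists_first (fun l => bd m (y ⟨i0, l⟩)) l hb
      have key : ∀ l, (refl m i0 y) ⟨i0, l⟩ = 2 * m - y ⟨i0, l⟩ := by
        intro l; simp [refl]
      have hbb : ∀ l, bd m ((refl m i0 y) ⟨i0, l⟩) ↔ bd m (y ⟨i0, l⟩) := by
        intro l
        rw [key]
        have := hle ⟨i0, l⟩
        unfold bd
        omega
      rw [tau_first i0 y l0 h0 h1, tau_first i0 (refl m i0 y) l0 ((hbb _).mpr h0)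
        (fun l' hl' hh => h1 l' hl' ((hbb _).mp hh)), key]
      simp only [Pi.single_eq_same]
      rcases h0 with h0 | h0
      · rw [h0, if_pos (by omega), if_neg (by omega)]; simp
      · rw [h0, if_neg (by omega), if_pos rfl]; exact (z2 1).symm
    · rw [Pi.single_eq_of_ne hi, add_zero]
      apply tau_congr
      intro l
      left
      simp [refl, Ne.symm hi]
  deg i0 l l' y y' hl hne hq hb := by
    by_cases hi : i0 = i
    · subst hi
      have hlt : l < l' := by
        have := l.2
        have h2 : (l : ℕ) ≠ l' := fun h => hne (Fin.ext h)
        rw [Fin.lt_def]; omega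
      have hqq : ∀ a ≤ l, y ⟨i0, a⟩ = y' ⟨i0, a⟩ := by
        intro a ha
        apply hq
        intro h
        have : a = l' := by simpa using h
        exact absurd (this ▸ ha) (not_le.mpr hlt)
      obtain ⟨l0, h00, h0, h1⟩ := exists_first (fun l => bd m (y ⟨i0, l⟩)) l hb
      rw [tau_first i0 y l0 h0 h1, tau_first i0 y' l0 (by rw [← hqq _ h00]; exact h0)
        (fun a ha => by rw [← hqq _ (ha.le.trans h00)]; exact h1 a ha), hqq _ h00]
    · apply tau_congr
      intro a
      left
      apply hq
      intro h
      exact hi (congrArg Sigma.fst h).symm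

lemma Good.sum {κ : Type*} (s : Finset κ) (ε : κ → ι → ZMod 2) (sgm : κ → ((Σ i, Fin (d i)) → ℕ) → ZMod 2)
    (h : ∀ k, Good m (ε k) (sgm k)) : Good m (∑ k ∈ s, ε k) (fun y => ∑ k ∈ s, sgm k y) where
  refl i l y hl hle hb := by
    simp only [(h _).refl i l y hl hle hb, Finset.sum_add_distrib, Finset.sum_apply]
  deg i l l' y y' hl hne hq hb := by
    simp only [(h _).deg i l l' y y' hl hne hq hb]

lemma Good.mul {ε : ι → ZMod 2} {sgm : ((Σ i, Fin (d i)) → ℕ) → ZMod 2}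
    (h : Good m ε sgm) (c : ZMod 2) : Good m (c • ε) (fun y => c * sgm y) where
  refl i l y hl hle hb := by
    simp only [h.refl i l y hl hle hb, mul_add, Pi.smul_apply, smul_eq_mul]
  deg i l l' y y' hl hne hq hb := by
    simp only [h.deg i l l' y y' hl hne hq hb]

lemma ref_good (hm : 0 < m) (ε : ι → ZMod 2) :
    Good (d := d) m ε (fun y => ∑ i, ε i * tau m i y) := by
  have := Good.sum Finset.univ (fun i => ε i • (Pi.single i 1 : ι → ZMod 2))
    (fun i (y : (Σ i, Fin (d i)) → ℕ) => ε i * tau m i y) (fun i => (tau_good hm i).mul (ε i))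
  convert this using 1
  funext j
  simp [Finset.sum_apply, Pi.single_apply]

/-! evaluation -/

lemma Oo_bd (e : Fin m × Bool) : ¬ bd m (Oo e) := by
  obtain ⟨a, b⟩ := e
  have := a.2
  unfold bd
  simp only [Oo]; omega

def Mono (π : Fin D ≃ (Σ i, Fin (d i))) : Prop :=
  ∀ (i : ι) (l l' : Fin (d i)), l < l' → π.symm ⟨i, l⟩ < π.symm ⟨i, l'⟩

lemma vert_step (p : (Σ i, Fin (d i)) → Fin m × Bool) (π : Fin D ≃ (Σ i, Fin (d i))) (j : Fin D)
    (q) (hq : q ≠ π j) : vert p π ((j : ℕ) + 1) q = vert p π j q := by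
  have h1 : π.symm q ≠ j := fun h => hq ((Equiv.symm_apply_eq π).mp h)
  have h2 : (π.symm q : ℕ) ≠ j := fun h => h1 (Fin.ext h)
  unfold vert
  congr 1
  simp only [eq_iff_iff]; omega

lemma step_needed (p : (Σ i, Fin (d i)) → Fin m × Bool) (π : Fin D ≃ (Σ i, Fin (d i)))
    (w : Fin D → ι)
    (hne : ∀ j : Fin D, tau m (w j) (vert p π j) + tau m (w j) (vert p π ((j : ℕ) + 1)) ≠ 0) :
    (∀ j, (π j).1 = w j) ∧ Mono π ∧ ∀ q, isB (p q) := by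
  have hne' : ∀ j : Fin D, tau m (w j) (vert p π j) ≠ tau m (w j) (vert p π ((j : ℕ) + 1)) := by
    intro j h
    apply hne j
    rw [h]; exact z2 _
  have h1 : ∀ j, (π j).1 = w j := by
    intro j
    by_contra hj
    apply hne' j
    apply tau_congr
    intro l
    left
    rw [vert_step]
    intro h
    exact hj (by rw [← h])
  have h2 : ∀ (i : ι) (l : Fin (d i)), tau m i (vert p π (π.symm ⟨i, l⟩)) ≠
      tau m i (vert p π ((π.symm ⟨i, l⟩ : ℕ) + 1)) := by
    intro i l
    have := hne' (π.symm ⟨i, l⟩)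
    rw [← h1] at this
    simpa using this
  have hcur : ∀ q, vert p π (π.symm q) q = Eo (p q) := by
    intro q
    unfold vert
    simp
  have hcur' : ∀ q, vert p π ((π.symm q : ℕ) + 1) q = Oo (p q) := by
    intro q
    unfold vert
    simp
  have h3 : ∀ q, isB (p q) := by
    rintro ⟨i, l⟩
    by_contra hb
    apply h2 i l
    apply tau_congr
    intro l'
    by_cases hl : l' = l
    · right
      subst hl
      rw [hcur, hcur']
      exact ⟨hb, Oo_bd _⟩
    · left
      rw [vert_step]
      simpa using hl
  refine ⟨h1, ?_, h3⟩
  intro i l l' hll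
  by_contra hlt
  have hvb : bd m (vert p π (π.symm ⟨i, l'⟩) ⟨i, l⟩) := by
    unfold vert
    rw [if_neg (fun hh => hlt (Fin.lt_def.mpr hh))]
    exact h3 _
  apply h2 i l'
  obtain ⟨l0, h00, h0, h01⟩ := exists_first (fun l => bd m (vert p π (π.symm ⟨i, l'⟩) ⟨i, l⟩)) l hvb
  have hs : ∀ a ≤ l, vert p π ((π.symm ⟨i, l'⟩ : ℕ) + 1) ⟨i, a⟩ = vert p π (π.symm ⟨i, l'⟩) ⟨i, a⟩ := by
    intro a ha
    apply vert_step
    have : a ≠ l' := fun h => absurd (h ▸ ha) (not_le.mpr hll)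
    simpa using this
  rw [tau_first i _ l0 h0 h01, tau_first i _ l0 (by rw [hs _ h00]; exact h0)
        (fun a ha => by rw [hs _ (ha.le.trans h00)]; exact h01 a ha), hs _ h00]

lemma step_eval (p : (Σ i, Fin (d i)) → Fin m × Bool) (π : Fin D ≃ (Σ i, Fin (d i)))
    (hmono : Mono π) (hB : ∀ q, isB (p q)) (i : ι) (l : Fin (d i)) :
    tau m i (vert p π (π.symm ⟨i, l⟩)) = (if Eo (p ⟨i, l⟩) = 2 * m then 1 else 0) ∧
    tau m i (vert p π ((π.symm ⟨i, l⟩ : ℕ) + 1)) = (if h : (l : ℕ) + 1 < d i then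
      (if Eo (p ⟨i, ⟨l + 1, h⟩⟩) = 2 * m then 1 else 0) else 0) := by
  have hlow : ∀ l' ≤ l, ∀ k, (π.symm ⟨i, l⟩ : ℕ) < k → ¬ bd m (vert p π k ⟨i, l'⟩) := by
    intro l' hl' k hk
    unfold vert
    rw [if_pos]
    · exact Oo_bd _
    · rcases hl'.lt_or_eq with h | h
      · have := hmono i l' l h
        rw [Fin.lt_def] at this
        omega
      · rw [h]; exact hk
  constructor
  · rw [tau_first i _ l]
    · simp [vert]
    · simp only [vert, lt_self_iff_false, if_false]
      exact hB _
    · intro l' hl'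
      unfold vert
      rw [if_pos (Fin.lt_def.mp (hmono i l' l hl'))]
      exact Oo_bd _
  · split_ifs with h1 h2
    · rw [tau_first i _ ⟨l + 1, h1⟩]
      · have := hmono i l ⟨l + 1, h1⟩ (by simp [Fin.lt_def])
        rw [Fin.lt_def] at this
        unfold vert
        rw [if_neg (c := (π.symm ⟨i, ⟨l + 1, h1⟩⟩ : ℕ) < _) (by omega), if_pos h2]
      · have := hmono i l ⟨l + 1, h1⟩ (by simp [Fin.lt_def])
        rw [Fin.lt_def] at this
        unfold vert
        rw [if_neg (by omega)]
        exact hB _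
      · intro l' hl'
        apply hlow _ _ _ (by omega)
        rw [Fin.lt_def] at hl'
        rw [Fin.le_def]
        simp at hl'; omega
    · rw [tau_first i _ ⟨l + 1, h1⟩]
      · have := hmono i l ⟨l + 1, h1⟩ (by simp [Fin.lt_def])
        rw [Fin.lt_def] at this
        unfold vert
        rw [if_neg (c := (π.symm ⟨i, ⟨l + 1, h1⟩⟩ : ℕ) < _) (by omega), if_neg h2]
      · have := hmono i l ⟨l + 1, h1⟩ (by simp [Fin.lt_def])
        rw [Fin.lt_def] at this
        unfold vert
        rw [if_neg (by omega)]
        exact hB _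
      · intro l' hl'
        apply hlow _ _ _ (by omega)
        rw [Fin.lt_def] at hl'
        rw [Fin.le_def]
        simp at hl'; omega
    · apply tau_none
      intro l'
      apply hlow _ _ _ (by omega)
      rw [Fin.le_def]; omega

def p0 (hm : 0 < m) : (Σ i, Fin (d i)) → Fin m × Bool := fun q =>
  if Even (d q.1 - 1 - q.2) then (⟨m - 1, by omega⟩, true) else (⟨0, hm⟩, false)

lemma p0_isB (hm : 0 < m) (q) : isB (p0 (d := d) hm q) := by
  unfold isB p0
  by_cases h : Even (d q.1 - 1 - q.2)
  · rw [if_pos h]; right; simp only [Eo, if_true]; omega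
  · rw [if_neg h]; left; simp [Eo]

lemma Eo_p0 (hm : 0 < m) (q) : Eo (p0 (d := d) hm q) = 2 * m ↔ Even (d q.1 - 1 - q.2) := by
  unfold p0
  by_cases h : Even (d q.1 - 1 - q.2)
  · rw [if_pos h]; simp only [Eo, if_true, h, iff_true]; omega
  · rw [if_neg h]; simp only [h, iff_false]; simp [Eo]; omega

lemma isB_inj (e e' : Fin m × Bool) (h : isB e) (h' : isB e')
    (hh : Eo e = 2 * m ↔ Eo e' = 2 * m) : e = e' := by
  obtain ⟨⟨a, ha⟩, b⟩ := e
  obtain ⟨⟨a', ha'⟩, b'⟩ := e'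
  unfold isB Eo at h h'
  unfold Eo at hh
  cases b <;> cases b' <;> simp at h h' hh ⊢ <;> omega

open Classical in
lemma term_eval (hm : 0 < m) (p : (Σ i, Fin (d i)) → Fin m × Bool) (π : Fin D ≃ (Σ i, Fin (d i)))
    (w : Fin D → ι) :
    ∏ j : Fin D, (tau m (w j) (vert p π j) + tau m (w j) (vert p π ((j : ℕ) + 1))) =
      if (∀ j, (π j).1 = w j) ∧ Mono π ∧ p = p0 hm then 1 else 0 := by
  have z2c : ∀ a : ZMod 2, a ≠ 0 → a = 1 := by decide
  split_ifs with h
  · obtain ⟨h1, h2, h3⟩ := h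
    apply Finset.prod_eq_one
    intro j _
    have := step_eval p π h2 (fun q => by rw [h3]; exact p0_isB hm q) (π j).1 (π j).2
    simp only [Sigma.eta, Equiv.symm_apply_apply] at this
    rw [← h1, this.1, this.2]
    subst h3
    simp only [Eo_p0]
    generalize π j = q
    obtain ⟨i, l⟩ := q
    have := l.2
    simp only
    by_cases hl : (l : ℕ) + 1 < d i
    · rw [dif_pos hl]
      have : Even (d i - 1 - l) ↔ ¬ Even (d i - 1 - (l + 1)) := by
        simp only [Nat.even_iff]; omega
      by_cases h : Even (d i - 1 - (l + 1)) <;> simp [h, this]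
    · rw [dif_neg hl, if_pos]
      · simp
      · rw [Nat.even_iff]; omega
  · by_contra hne
    apply h
    have hne' := Finset.prod_ne_zero_iff.mp hne
    obtain ⟨h1, h2, h3⟩ := step_needed p π w (fun j => hne' j (Finset.mem_univ _))
    refine ⟨h1, h2, ?_⟩
    have key : ∀ (i : ι) (l : Fin (d i)), (if Eo (p ⟨i, l⟩) = 2 * m then (1 : ZMod 2) else 0) +
      (if h : (l : ℕ) + 1 < d i then
      (if Eo (p ⟨i, ⟨l + 1, h⟩⟩) = 2 * m then 1 else 0) else 0) ≠ 0 := by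
      intro i l
      have := step_eval p π h2 h3 i l
      rw [← this.1, ← this.2]
      have := hne' (π.symm ⟨i, l⟩) (Finset.mem_univ _)
      rw [← h1] at this
      simpa using this
    have key2 : ∀ (i : ι) (e : ℕ) (l : Fin (d i)), d i - 1 - l = e →
        (Eo (p ⟨i, l⟩) = 2 * m ↔ Even e) := by
      intro i e
      induction e with
      | zero =>
        intro l hl
        have := key i l
        rw [dif_neg (by omega)] at this
        simpa using this
      | succ e ih =>
        intro l hl
        have h5 : (l : ℕ) + 1 < d i := by omega
        have := key i l
        rw [dif_pos h5] at this
        have h6 := ih ⟨l + 1, h5⟩ (by simp; omega)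
        simp only [h6] at this
        by_cases he : Even e
        · simp only [he, if_true] at this
          have h7 : ¬ Even (e + 1) := by simpa [Nat.even_add_one] using he
          simp only [h7, iff_false]
          intro h8
          rw [if_pos h8] at this
          exact this (z2 1)
        · simp only [he, if_false] at this
          have h7 : Even (e + 1) := by simpa [Nat.even_add_one] using he
          simp only [h7, iff_true]
          by_contra h8
          rw [if_neg h8] at this
          simp at this
    funext q
    apply isB_inj _ _ (h3 q) (p0_isB hm q)
    rw [Eo_p0]
    exact key2 q.1 _ q.2 rfl

/-- a word with the right multiplicities -/
def IsWord {J : Type*} [Fintype J] (d : ι → ℕ) (w : J → ι) : Prop :=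
  ∀ i, (Finset.univ.filter (fun j => w j = i)).card = d i

lemma mono_unique (w : Fin D → ι) (π π' : Fin D ≃ (Σ i, Fin (d i))) (h : Mono π) (h' : Mono π')
    (hw : ∀ j, (π j).1 = w j) (hw' : ∀ j, (π' j).1 = w j) (hW : IsWord d w) : π = π' := by
  have key : ∀ (π : Fin D ≃ (Σ i, Fin (d i))), Mono π → (∀ j, (π j).1 = w j) →
      ∀ q : (Σ i, Fin (d i)), π.symm q =
        Finset.orderEmbOfFin (Finset.univ.filter (fun j => w j = q.1)) (hW q.1) q.2 := by
    rintro π h hw ⟨i, l⟩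
    have := Finset.orderEmbOfFin_unique (hW i) (f := fun l => π.symm ⟨i, l⟩)
      (by intro x; simp [← hw]) (fun a b hab => h i a b hab)
    exact congrFun this l
  have : π.symm = π'.symm := by
    ext q
    rw [key π h hw, key π' h' hw']
  rw [← Equiv.symm_symm π, this, Equiv.symm_symm]

lemma mono_exists (w : Fin D → ι) (hW : IsWord d w) :
    ∃ π : Fin D ≃ (Σ i, Fin (d i)), Mono π ∧ ∀ j, (π j).1 = w j := by
  let g : (Σ i, Fin (d i)) → Fin D := fun q =>
    Finset.orderEmbOfFin (Finset.univ.filter (fun j => w j = q.1)) (hW q.1) q.2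
  have hg : ∀ q, w (g q) = q.1 := by
    intro q
    have := Finset.orderEmbOfFin_mem (Finset.univ.filter (fun j => w j = q.1)) (hW q.1) q.2
    exact (Finset.mem_filter.mp this).2
  have hinj : Function.Injective g := by
    rintro ⟨i, l⟩ ⟨i', l'⟩ h
    have h1 := hg ⟨i, l⟩
    rw [h, hg] at h1
    simp only at h1
    subst h1
    simp only [g] at h
    have := (Finset.orderEmbOfFin _ (hW i')).injective h
    rw [this]
  have hsurj : Function.Surjective g := by
    intro j
    have : j ∈ Set.range (Finset.orderEmbOfFin (Finset.univ.filter (fun j' => w j' = w j)) (hW (w j))) := by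
      rw [Finset.range_orderEmbOfFin]; simp
    obtain ⟨l, hl⟩ := this
    exact ⟨⟨w j, l⟩, hl⟩
  refine ⟨(Equiv.ofBijective g ⟨hinj, hsurj⟩).symm, ?_, ?_⟩
  · intro i l l' hl
    simp only [Equiv.symm_symm, g]
    exact (Finset.orderEmbOfFin _ (hW i)).strictMono hl
  · intro j
    rw [← hg]
    congr 1
    exact (Equiv.ofBijective g ⟨hinj, hsurj⟩).apply_symm_apply j

lemma word_of_equiv (w : Fin D → ι) (π : Fin D ≃ (Σ i, Fin (d i))) (hw : ∀ j, (π j).1 = w j) :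
    IsWord d w := by
  intro i
  have hinj : Function.Injective (fun l : Fin (d i) => π.symm ⟨i, l⟩) := by
    intro a b h
    have := π.symm.injective h
    simpa using this
  have : Finset.univ.filter (fun j => w j = i) =
      (Finset.univ : Finset (Fin (d i))).map ⟨fun l => π.symm ⟨i, l⟩, hinj⟩ := by
    ext j
    simp only [Finset.mem_filter, Finset.mem_univ, true_and, Finset.mem_map,
      Function.Embedding.coeFn_mk]
    constructor
    · intro h
      rw [← hw] at h
      subst h
      exact ⟨(π j).2, by simp⟩
    · rintro ⟨l, rfl⟩
      rw [← hw]; simp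
  rw [this, Finset.card_map]; simp

open Classical in
theorem total_ref (hm : 0 < m) (ε : ℕ → ι → ZMod 2) :
    total (d := d) m D (fun j y => ∑ i, ε j i * tau m i y) =
      ∑ w : Fin D → ι, if IsWord d w then ∏ j : Fin D, ε j (w j) else 0 := by
  unfold total pre
  have h1 : ∀ x : ((Σ i, Fin (d i)) → Fin m × Bool) × (Fin D ≃ (Σ i, Fin (d i))),
      ∏ j ∈ Finset.range D, (∑ i, ε j i * tau m i (vert x.1 x.2 j) +
        ∑ i, ε j i * tau m i (vert x.1 x.2 (j + 1))) =
      ∑ w : Fin D → ι, (∏ j : Fin D, ε j (w j)) *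
        if (∀ j, (x.2 j).1 = w j) ∧ Mono x.2 ∧ x.1 = p0 hm then 1 else 0 := by
    intro x
    rw [Finset.prod_range]
    simp only [← Finset.sum_add_distrib, ← mul_add]
    rw [Finset.prod_univ_sum]
    simp only [Fintype.piFinset_univ, Finset.prod_mul_distrib, term_eval hm]
  simp only [h1]
  rw [Finset.sum_comm]
  refine Finset.sum_congr rfl fun w _ => ?_
  rw [← Finset.mul_sum]
  split_ifs with hW
  · obtain ⟨π, hπ, hπw⟩ := mono_exists w hW
    rw [Finset.sum_eq_single (p0 hm, π)]
    · rw [if_pos ⟨hπw, hπ, rfl⟩, mul_one]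
    · rintro ⟨p, π'⟩ - hne
      rw [if_neg]
      rintro ⟨h1, h2, h3⟩
      apply hne
      simp only at h1 h2 h3
      rw [h3, mono_unique w π' π h2 hπ h1 hπw hW]
    · simp
  · rw [Finset.sum_eq_zero, mul_zero]
    rintro ⟨p, π⟩ -
    rw [if_neg]
    rintro ⟨h1, -, -⟩
    exact hW (word_of_equiv w π h1)

end eval

end BUP

namespace BUP

section sphere

noncomputable def ext0 {n : ℕ} (θ : Fin n → ℝ) (l : ℕ) : ℝ := if h : l < n then θ ⟨l, h⟩ else 0

noncomputable def sph {n : ℕ} (θ : Fin n → ℝ) : Fin (n + 1) → ℝ := fun k =>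
  (∏ l ∈ Finset.range k, Real.sin (ext0 θ l)) * (if (k : ℕ) < n then Real.cos (ext0 θ k) else 1)

lemma sph_aux (a : ℕ → ℝ) (K : ℕ) :
    ∑ k ∈ Finset.range K, ((∏ l ∈ Finset.range k, Real.sin (a l)) * Real.cos (a k)) ^ 2 =
      1 - (∏ l ∈ Finset.range K, Real.sin (a l)) ^ 2 := by
  induction K with
  | zero => simp
  | succ K ih =>
    rw [Finset.sum_range_succ, ih, Finset.prod_range_succ]
    have := Real.sin_sq_add_cos_sq (a K)
    linear_combination (∏ l ∈ Finset.range K, Real.sin (a l)) ^ 2 * this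

lemma sph_norm {n : ℕ} (θ : Fin n → ℝ) : ∑ k, sph θ k ^ 2 = 1 := by
  have h := sph_aux (ext0 θ) n
  rw [Fin.sum_univ_castSucc]
  have h1 : ∑ i : Fin n, sph θ i.castSucc ^ 2 =
    ∑ k ∈ Finset.range n, ((∏ l ∈ Finset.range k, Real.sin (ext0 θ l)) * Real.cos (ext0 θ k)) ^ 2 := by
    rw [Finset.sum_range]
    refine Finset.sum_congr rfl fun i _ => ?_
    unfold sph
    rw [if_pos (by simp)]
    simp
  rw [h1, h]
  simp [sph]

lemma sph_cont (n : ℕ) : Continuous (sph : (Fin n → ℝ) → Fin (n + 1) → ℝ) := by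
  have he : ∀ l, Continuous (fun θ : Fin n → ℝ => ext0 θ l) := by
    intro l
    unfold ext0
    split_ifs
    · fun_prop
    · fun_prop
  apply continuous_pi
  intro k
  unfold sph
  apply Continuous.mul
  · apply continuous_finsetProd
    intro l _
    exact Real.continuous_sin.comp (he l)
  · split_ifs
    · exact Real.continuous_cos.comp (he k)
    · fun_prop

lemma sph_neg {n : ℕ} (θ : Fin n → ℝ) (l : Fin n) (hl : (l : ℕ) + 1 = n)
    (hs : Real.sin (θ l) = 0) : sph (fun k => Real.pi - θ k) = - sph θ := by
  funext k
  have he : ∀ a < n, ext0 (fun k => Real.pi - θ k) a = Real.pi - ext0 θ a := by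
    intro a ha
    simp [ext0, ha]
  have hk := k.2
  have hp : ∏ a ∈ Finset.range k, Real.sin (ext0 (fun k => Real.pi - θ k) a) =
      ∏ a ∈ Finset.range k, Real.sin (ext0 θ a) := by
    refine Finset.prod_congr rfl fun a ha => ?_
    rw [Finset.mem_range] at ha
    rw [he a (by omega), Real.sin_pi_sub]
  simp only [sph, Pi.neg_apply, hp]
  split_ifs with h
  · rw [he _ h, Real.cos_pi_sub]; ring
  · have : ∏ a ∈ Finset.range k, Real.sin (ext0 θ a) = 0 := by
      apply Finset.prod_eq_zero (i := (l : ℕ))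
      · rw [Finset.mem_range]; omega
      · simp [ext0, hs]
    rw [this]; simp

lemma sph_deg {n : ℕ} (θ θ' : Fin n → ℝ) (l l' : Fin n) (hl : (l' : ℕ) + 1 = n) (hne : l ≠ l')
    (hq : ∀ q, q ≠ l' → θ q = θ' q) (hs : Real.sin (θ l) = 0) : sph θ = sph θ' := by
  funext k
  have hll : (l : ℕ) ≠ l' := fun h => hne (Fin.ext h)
  have hl2 := l.2
  have he : ∀ a, a ≠ (l' : ℕ) → ext0 θ a = ext0 θ' a := by
    intro a ha
    unfold ext0
    split_ifs with h
    · exact hq _ (fun h' => ha (by rw [← h']))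
    · rfl
  have hz : ext0 θ l = θ l := by simp [ext0]
  unfold sph
  by_cases hk : (k : ℕ) < l'
  · rw [he k (by omega)]
    congr 1
    refine Finset.prod_congr rfl fun a ha => ?_
    rw [Finset.mem_range] at ha
    rw [he a (by omega)]
  · have h1 : (l : ℕ) ∈ Finset.range k := by rw [Finset.mem_range]; omega
    rw [Finset.prod_eq_zero h1 (by rw [hz, hs]),
      Finset.prod_eq_zero h1 (by rw [← he l hll, hz, hs])]
    simp

end sphere

section main
variable {ι : Type*} [Fintype ι] [DecidableEq ι] {d : ι → ℕ} {m D : ℕ}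

noncomputable def ang (m : ℕ) (y : (Σ i, Fin (d i)) → ℕ) : (Σ i, Fin (d i)) → ℝ :=
  fun q => Real.pi * (y q / (2 * m))

noncomputable def psi (θ : (Σ i, Fin (d i)) → ℝ) : ∀ i, Fin (d i + 1) → ℝ :=
  fun i => sph (fun l => θ ⟨i, l⟩)

lemma psi_cont : Continuous (psi (d := d)) := by
  apply continuous_pi
  intro i
  exact (sph_cont _).comp (by fun_prop)

lemma sin_bd (hm : 0 < m) (y : (Σ i, Fin (d i)) → ℕ) (q) (h : y q = 0 ∨ y q = 2 * m) :
    Real.sin (ang m y q) = 0 := by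
  have hm' : (m : ℝ) ≠ 0 := by positivity
  unfold ang
  rcases h with h | h
  · simp [h]
  · rw [h]; push_cast
    rw [div_self (by positivity)]; simp

lemma psi_refl (hm : 0 < m) (i : ι) (l : Fin (d i)) (y : (Σ i, Fin (d i)) → ℕ) (hl : (l : ℕ) + 1 = d i)
    (hle : ∀ q, y q ≤ 2 * m) (hb : y ⟨i, l⟩ = 0 ∨ y ⟨i, l⟩ = 2 * m) :
    psi (ang m (refl m i y)) = Function.update (psi (ang m y)) i (-(psi (ang m y) i)) := by
  have hm' : (m : ℝ) ≠ 0 := by positivity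
  funext i'
  by_cases hi : i' = i
  · subst hi
    rw [Function.update_self]
    unfold psi
    have hs := sin_bd hm y ⟨i', l⟩ hb
    rw [← sph_neg (fun l => ang m y ⟨i', l⟩) l hl hs]
    congr 1
    funext k
    simp only [ang, refl, if_true]
    rw [Nat.cast_sub (hle _)]
    push_cast
    field_simp
  · rw [Function.update_of_ne hi]
    unfold psi
    congr 1
    funext k
    simp [ang, refl, hi]

lemma psi_deg (hm : 0 < m) (i : ι) (l l' : Fin (d i)) (y y' : (Σ i, Fin (d i)) → ℕ)
    (hl : (l' : ℕ) + 1 = d i) (hne : l ≠ l')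
    (hq : ∀ q, q ≠ ⟨i, l'⟩ → y q = y' q) (hb : y ⟨i, l⟩ = 0 ∨ y ⟨i, l⟩ = 2 * m) :
    psi (ang m y) = psi (ang m y') := by
  funext i'
  by_cases hi : i' = i
  · subst hi
    unfold psi
    have hs := sin_bd hm y ⟨i', l⟩ hb
    refine sph_deg (fun l => ang m y ⟨i', l⟩) (fun l => ang m y' ⟨i', l⟩) l l' hl hne ?_ hs
    intro q hq'
    simp only [ang]
    rw [hq _ (by simpa using hq')]
  · unfold psi
    congr 1
    funext k
    simp only [ang]
    rw [hq]
    intro h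
    exact hi (congrArg Sigma.fst h)

open Classical in
noncomputable def sg (m : ℕ) (ε : ι → ZMod 2) (F : (∀ i, Fin (d i + 1) → ℝ) → ℝ)
    (y : (Σ i, Fin (d i)) → ℕ) : ZMod 2 :=
  if 0 < F (psi (ang m y)) then 0 else if F (psi (ang m y)) < 0 then 1 else
    ∑ i, ε i * tau m i y

lemma sg_good (hm : 0 < m) (ε : ι → ZMod 2) (F : (∀ i, Fin (d i + 1) → ℝ) → ℝ)
    (hF : ∀ i z, F (Function.update z i (-(z i))) = if ε i = 0 then F z else - F z) :
    Good m ε (sg m ε F) where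
  refl i l y hl hle hb := by
    have z2c : ∀ a : ZMod 2, a ≠ 0 → a = 1 := by decide
    have h1 := psi_refl hm i l y hl hle hb
    have h2 := (ref_good (d := d) hm ε).refl i l y hl hle hb
    unfold sg
    rw [h1, hF, h2]
    by_cases he : ε i = 0
    · simp [he]
    · have he' := z2c _ he
      simp only [he, if_false, Left.neg_pos_iff, Left.neg_neg_iff]
      rcases lt_trichotomy (F (psi (ang m y))) 0 with h | h | h
      · rw [if_pos h, if_neg (by linarith), if_pos h, he']; exact (z2 1).symm
      · simp [h]
      · rw [if_neg (by linarith), if_pos h, if_pos h, he']; simp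
  deg i l l' y y' hl hne hq hb := by
    have h2 := (ref_good (d := d) hm ε).deg i l l' y y' hl hne hq hb
    unfold sg
    rw [psi_deg hm i l l' y y' hl hne hq hb, h2]

theorem bup_fin (ε : Fin D → ι → ZMod 2) (F : Fin D → (∀ i, Fin (d i + 1) → ℝ) → ℝ)
    (hcount : ∑ w : Fin D → ι, (open Classical in if IsWord d w then ∏ j : Fin D, ε j (w j) else 0) ≠ 0)
    (hFc : ∀ j, Continuous (F j))
    (hF : ∀ j i z, F j (Function.update z i (-(z i))) = if ε j i = 0 then F j z else - F j z) :
    ∃ z : ∀ i, Fin (d i + 1) → ℝ, (∀ i, ∑ k, z i k ^ 2 = 1) ∧ ∀ j, F j z = 0 := by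
  by_contra hcon
  push Not at hcon
  let c : Fin D × Bool → Set ((Σ i, Fin (d i)) → ℝ) := fun jb =>
    if jb.2 then {θ | 0 < F jb.1 (psi θ)} else {θ | F jb.1 (psi θ) < 0}
  have hco : ∀ jb, IsOpen (c jb) := by
    rintro ⟨j, b⟩
    cases b
    · exact isOpen_lt ((hFc j).comp psi_cont) continuous_const
    · exact isOpen_lt continuous_const ((hFc j).comp psi_cont)
  have hcov : Set.Icc (0 : (Σ i, Fin (d i)) → ℝ) (fun _ => Real.pi) ⊆ ⋃ jb, c jb := by
    intro θ _
    obtain ⟨j, hj⟩ := hcon (psi θ) (fun i => sph_norm _)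
    rw [Set.mem_iUnion]
    rcases lt_or_gt_of_ne hj with h | h
    · exact ⟨(j, false), h⟩
    · exact ⟨(j, true), h⟩
  obtain ⟨δ, hδ, hleb⟩ := lebesgue_number_lemma_of_metric isCompact_Icc hco hcov
  obtain ⟨m', hm'⟩ := exists_nat_gt (Real.pi / δ)
  have hm0 : (0 : ℝ) < m' := lt_of_le_of_lt (div_nonneg Real.pi_pos.le hδ.le) hm'
  have hm : 0 < m' := by exact_mod_cast hm0
  let ε' : ℕ → ι → ZMod 2 := fun j => if h : j < D then ε ⟨j, h⟩ else 0
  let sgm : ℕ → ((Σ i, Fin (d i)) → ℕ) → ZMod 2 := fun j => if h : j < D then sg m' (ε ⟨j, h⟩) (F ⟨j, h⟩)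
    else fun y => ∑ i, (0 : ι → ZMod 2) i * tau m' i y
  have hsgm : ∀ j, Good m' (ε' j) (sgm j) := by
    intro j
    by_cases h : j < D
    · simp only [ε', sgm, dif_pos h]
      exact sg_good hm _ _ (hF _)
    · simp only [ε', sgm, dif_neg h]
      exact ref_good hm 0
  have htot := total_eq (m := m') (D := D) ε' sgm _ hsgm (fun j => ref_good hm (ε' j))
  rw [total_ref hm] at htot
  have hz : total m' D sgm = 0 := by
    apply Finset.sum_eq_zero
    rintro ⟨p, π⟩ -
    have hbox : ∀ k, ang m' (vert p π k) ∈ Set.Icc (0 : (Σ i, Fin (d i)) → ℝ) (fun _ => Real.pi) := by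
      intro k
      rw [Set.mem_Icc, Pi.le_def, Pi.le_def]
      have : ∀ q, 0 ≤ ((vert p π k q : ℕ) : ℝ) / (2 * m') ∧ ((vert p π k q : ℕ) : ℝ) / (2 * m') ≤ 1 := by
        intro q
        refine ⟨by positivity, ?_⟩
        rw [div_le_one (by positivity)]
        exact_mod_cast vert_le p π k q
      refine ⟨fun q => mul_nonneg Real.pi_pos.le (this q).1, fun q => ?_⟩
      have := mul_le_mul_of_nonneg_left (this q).2 Real.pi_pos.le
      rw [mul_one] at this
      exact this
    obtain ⟨⟨j, b⟩, hjb⟩ := hleb _ (hbox 0)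
    have hin : ∀ k, ang m' (vert p π k) ∈ c (j, b) := by
      intro k
      apply hjb
      rw [Metric.mem_ball, dist_pi_lt_iff hδ]
      intro q
      have h1 : |((vert p π k q : ℕ) : ℝ) - (vert p π 0 q : ℕ)| ≤ 1 := by
        have : (vert p π k q) ≤ vert p π 0 q + 1 ∧ vert p π 0 q ≤ vert p π k q + 1 := by
          unfold vert Oo Eo
          simp only [Nat.not_lt_zero, if_false]
          split_ifs <;> omega
        rw [abs_le]
        have h1 : ((vert p π k q : ℕ) : ℝ) ≤ (vert p π 0 q : ℕ) + 1 := by exact_mod_cast this.1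
        have h2 : ((vert p π 0 q : ℕ) : ℝ) ≤ (vert p π k q : ℕ) + 1 := by exact_mod_cast this.2
        constructor <;> linarith
      rw [Real.dist_eq]
      unfold ang
      rw [← mul_sub, ← sub_div, abs_mul, abs_div, abs_of_pos Real.pi_pos,
        abs_of_pos (by positivity : (0 : ℝ) < 2 * m')]
      have h2 : Real.pi < δ * m' := by
        rw [div_lt_iff₀ hδ] at hm'
        linarith
      have h3 : |((vert p π k q : ℕ) : ℝ) - (vert p π 0 q : ℕ)| / (2 * m') ≤ 1 / (2 * m') := by
        gcongr
      calc Real.pi * (|((vert p π k q : ℕ) : ℝ) - (vert p π 0 q : ℕ)| / (2 * m'))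
          ≤ Real.pi * (1 / (2 * m')) := mul_le_mul_of_nonneg_left h3 Real.pi_pos.le
        _ < δ := by
          rw [mul_one_div, div_lt_iff₀ (by positivity)]
          nlinarith
    apply Finset.prod_eq_zero (i := (j : ℕ)) (by simp)
    have : ∀ k, sgm j (vert p π k) = if b then 0 else 1 := by
      intro k
      simp only [sgm, dif_pos j.2, Fin.eta]
      have := hin k
      unfold sg
      cases b
      · have h0 : F j (psi (ang m' (vert p π k))) < 0 := this
        rw [if_neg (not_lt.mpr h0.le), if_pos h0]; simp
      · have h0 : 0 < F j (psi (ang m' (vert p π k))) := this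
        rw [if_pos h0]; simp
    rw [this, this]
    exact z2 _
  rw [hz] at htot
  apply hcount
  refine Eq.trans ?_ htot.symm
  refine Finset.sum_congr rfl fun w _ => ?_
  simp [ε']

theorem bup {J : Type*} [Fintype J] [DecidableEq J] (ε : J → ι → ZMod 2) (F : J → (∀ i, Fin (d i + 1) → ℝ) → ℝ)
    (hcount : ∑ w : J → ι, (open Classical in if IsWord d w then ∏ j, ε j (w j) else 0) ≠ 0)
    (hFc : ∀ j, Continuous (F j))
    (hF : ∀ j i z, F j (Function.update z i (-(z i))) = if ε j i = 0 then F j z else - F j z) :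
    ∃ z : ∀ i, Fin (d i + 1) → ℝ, (∀ i, ∑ k, z i k ^ 2 = 1) ∧ ∀ j, F j z = 0 := by
  let e := (Fintype.equivFin J).symm
  have := bup_fin (d := d) (fun j => ε (e j)) (fun j => F (e j)) ?_ (fun j => hFc _) (fun j => hF _)
  · obtain ⟨z, h1, h2⟩ := this
    exact ⟨z, h1, fun j => by simpa using h2 (e.symm j)⟩
  · intro h0
    apply hcount
    refine Eq.trans ?_ h0
    refine Fintype.sum_equiv (Equiv.arrowCongr e.symm (Equiv.refl ι)) _ _ fun w => ?_
    have h1 : IsWord d (Equiv.arrowCongr e.symm (Equiv.refl ι) w) ↔ IsWord d w := by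
      unfold IsWord
      refine forall_congr' fun i => ?_
      have : (Finset.univ.filter (fun j => (Equiv.arrowCongr e.symm (Equiv.refl ι) w) j = i)).card =
          (Finset.univ.filter (fun j => w j = i)).card := by
        apply Finset.card_equiv e
        intro j
        simp
      rw [this]
    by_cases h : IsWord d w
    · rw [if_pos h, if_pos (h1.mpr h), ← Equiv.prod_comp e]
      simp
    · rw [if_neg h, if_neg (fun h' => h (h1.mp h'))]

end main

end BUP

namespace BUP

section count
variable {n : ℕ}

/-- number of characters attached to `i` -/
def Mf (b c : Fin n) (B : ℕ) (i : Fin n) : ℕ := if i = b then 0 else if i = c then 2 * B - 1 else B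

def Hset (b c : Fin n) (B : ℕ) : Finset ((Σ i : Fin n, Fin (Mf b c B i)) → Fin n) :=
  Finset.univ.filter (fun h => (∀ x, h x = x.1 ∨ h x = b) ∧
    ∀ i, (Finset.univ.filter (fun x => h x = i)).card = if i = b then B - 1 else B)

lemma fib_card (b c : Fin n) (B : ℕ) (h : (Σ i : Fin n, Fin (Mf b c B i)) → Fin n)
    (hadm : ∀ x, h x = x.1 ∨ h x = b) (i : Fin n) (hi : i ≠ b) :
    (Finset.univ.filter (fun x => h x = i)).card =
      (Finset.univ.filter (fun a : Fin (Mf b c B i) => h ⟨i, a⟩ = i)).card := by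
  symm
  apply Finset.card_bij (fun a _ => (⟨i, a⟩ : Σ i : Fin n, Fin (Mf b c B i)))
  · intro a ha
    simpa using ha
  · intro a _ a' _ haa
    simpa using haa
  · rintro ⟨i', a⟩ hx
    simp only [Finset.mem_filter, Finset.mem_univ, true_and] at hx
    have : i' = i := by
      rcases hadm ⟨i', a⟩ with h1 | h1
      · rw [← hx, h1]
      · exact absurd (hx.symm.trans h1) hi
    subst this
    exact ⟨a, by simpa using hx, rfl⟩

lemma sum_Mf (b c : Fin n) (hbc : b ≠ c) (B : ℕ) (hB : 0 < B) : ∑ i, Mf b c B i + 1 = n * B := by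
  have h1 : ∀ i, (Mf b c B i : ℤ) = B + (if i = b then -(B : ℤ) else 0) + (if i = c then (B : ℤ) - 1 else 0) := by
    intro i
    unfold Mf
    by_cases h1 : i = b
    · subst h1; simp [hbc]
    · by_cases h2 : i = c
      · subst h2; simp only [if_neg h1, if_true]; omega
      · simp [h1, h2]
  have : ((∑ i, Mf b c B i + 1 : ℕ) : ℤ) = (n * B : ℕ) := by
    push_cast
    simp only [h1, Finset.sum_add_distrib]
    simp
    ring
  exact_mod_cast this

lemma mem_Hset_iff (b c : Fin n) (hbc : b ≠ c) (B : ℕ) (hB : 0 < B)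
    (h : (Σ i : Fin n, Fin (Mf b c B i)) → Fin n) :
    h ∈ Hset b c B ↔ (∀ x, h x = x.1 ∨ h x = b) ∧
      ∀ i, i ≠ b → (Finset.univ.filter (fun x => h x = i)).card = B := by
  unfold Hset
  simp only [Finset.mem_filter, Finset.mem_univ, true_and]
  constructor
  · rintro ⟨h1, h2⟩
    exact ⟨h1, fun i hi => by rw [h2 i, if_neg hi]⟩
  · rintro ⟨h1, h2⟩
    refine ⟨h1, fun i => ?_⟩
    by_cases hi : i = b
    · rw [if_pos hi, hi]
      have htot : ∑ i, (Finset.univ.filter (fun x => h x = i)).card = ∑ i, Mf b c B i := by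
        rw [← Finset.card_eq_sum_card_fiberwise (fun x _ => Finset.mem_univ (h x))]
        simp
      have h3 := sum_Mf b c hbc B hB
      rw [← htot, ← Finset.add_sum_erase _ _ (Finset.mem_univ b),
        Finset.sum_congr rfl (fun i hi => h2 i (Finset.ne_of_mem_erase hi))] at h3
      simp only [Finset.sum_const, Finset.card_erase_of_mem (Finset.mem_univ b), Finset.card_univ,
        Fintype.card_fin, smul_eq_mul] at h3
      have hn : 0 < n := lt_of_le_of_lt (Nat.zero_le _) b.2
      obtain ⟨n', rfl⟩ : ∃ n', n = n' + 1 := ⟨n - 1, by omega⟩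
      simp only [Nat.add_sub_cancel] at h3
      rw [add_mul] at h3
      omega
    · rw [if_neg hi, h2 i hi]

lemma Hset_card (b c : Fin n) (hbc : b ≠ c) (B : ℕ) (hB : 0 < B) :
    (Hset b c B).card = (2 * B - 1).choose B := by
  have hMc : Mf b c B c = 2 * B - 1 := by simp [Mf, hbc.symm]
  rw [← hMc]
  have : ((Finset.univ : Finset (Fin (Mf b c B c))).powersetCard B).card = (Mf b c B c).choose B := by
    rw [Finset.card_powersetCard]; simp
  rw [← this]
  apply Finset.card_bij (fun h _ => Finset.univ.filter (fun a : Fin (Mf b c B c) => h ⟨c, a⟩ = c))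
  · intro h hh
    rw [mem_Hset_iff b c hbc B hB] at hh
    rw [Finset.mem_powersetCard]
    refine ⟨Finset.subset_univ _, ?_⟩
    rw [← fib_card b c B h hh.1 c hbc.symm, hh.2 c hbc.symm]
  · intro h hh h' hh' heq
    rw [mem_Hset_iff b c hbc B hB] at hh hh'
    have key : ∀ h : (Σ i : Fin n, Fin (Mf b c B i)) → Fin n, (∀ x, h x = x.1 ∨ h x = b) →
      (∀ i, i ≠ b → (Finset.univ.filter (fun x => h x = i)).card = B) →
        ∀ x : (Σ i : Fin n, Fin (Mf b c B i)), x.1 ≠ c → h x = x.1 := by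
      intro h h1 h2 x hx
      by_cases hxb : x.1 = b
      · rcases h1 x with h3 | h3
        · exact h3
        · rw [h3, hxb]
      · have h3 := h2 x.1 hxb
        rw [fib_card b c B h h1 x.1 hxb] at h3
        have h4 : Finset.univ.filter (fun a : Fin (Mf b c B x.1) => h ⟨x.1, a⟩ = x.1) = Finset.univ := by
          apply Finset.eq_univ_of_card
          rw [h3]; simp [Mf, hxb, hx]
        have h5 : x.2 ∈ Finset.univ.filter (fun a : Fin (Mf b c B x.1) => h ⟨x.1, a⟩ = x.1) := by
          rw [h4]; exact Finset.mem_univ _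
        exact (Finset.mem_filter.mp h5).2
    funext x
    by_cases hx : x.1 = c
    · obtain ⟨i, a⟩ := x
      simp only at hx
      subst hx
      have h6 : h ⟨i, a⟩ = i ↔ h' ⟨i, a⟩ = i := by
        have := congrArg (fun S => a ∈ S) heq
        simpa using this
      rcases hh.1 ⟨i, a⟩ with h7 | h7
      · rw [h7]; exact (h6.mp h7).symm
      · rcases hh'.1 ⟨i, a⟩ with h8 | h8
        · exact absurd (h7.symm.trans (h6.mpr h8)) hbc
        · rw [h7, h8]
    · rw [key h hh.1 hh.2 x hx, key h' hh'.1 hh'.2 x hx]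
  · intro S hS
    rw [Finset.mem_powersetCard] at hS
    let h : (Σ i : Fin n, Fin (Mf b c B i)) → Fin n := fun x =>
      if x.1 = c ∧ ∀ a ∈ S, (a : ℕ) ≠ x.2 then b else x.1
    have hadm : ∀ x, h x = x.1 ∨ h x = b := by
      intro x
      simp only [h]
      split_ifs
      · right; rfl
      · left; rfl
    have hc : ∀ a, h ⟨c, a⟩ = c ↔ a ∈ S := by
      intro a
      simp only [h, true_and]
      split_ifs with h1
      · refine iff_of_false hbc (fun h2 => h1 a h2 rfl)
      · push Not at h1
        obtain ⟨a', ha', hh⟩ := h1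
        have : a' = a := Fin.ext hh
        rw [this] at ha'
        simpa using ha'
    refine ⟨h, ?_, ?_⟩
    · rw [mem_Hset_iff b c hbc B hB]
      refine ⟨hadm, fun i hi => ?_⟩
      rw [fib_card b c B h hadm i hi]
      by_cases hic : i = c
      · subst hic
        simp only [hc]
        simpa using hS.2
      · have : ∀ a, h ⟨i, a⟩ = i := by
          intro a
          simp only [h, hic, false_and, if_false]
        rw [Finset.filter_true_of_mem (fun a _ => this a)]
        rw [Finset.card_univ, Fintype.card_fin]
        simp [Mf, hi, hic]
    · ext a
      simp [hc]

/-! the words for the Milnor manifold -/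

def dM (b : Fin n) (A B : ℕ) : Fin n ⊕ Fin n → ℕ :=
  Sum.elim (fun i => if i = b then B else B + 1) (fun i => if i = b then A - 1 else A)

abbrev JM (b c : Fin n) (A B : ℕ) : Type :=
  Fin n ⊕ ((Σ i : Fin n, Fin (Mf b c B i)) ⊕ (Σ i : Fin n, Fin (Mf b c A i)))

def epsM (b c : Fin n) (A B : ℕ) : JM b c A B → (Fin n ⊕ Fin n) → ZMod 2 :=
  Sum.elim (fun i q => if q = Sum.inl i ∨ q = Sum.inr i then 1 else 0)
    (Sum.elim (fun x q => if q = Sum.inl x.1 ∨ q = Sum.inl b then 1 else 0)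
      (fun x q => if q = Sum.inr x.1 ∨ q = Sum.inr b then 1 else 0))

def mkW (b c : Fin n) (A B : ℕ) (h : (Σ i : Fin n, Fin (Mf b c B i)) → Fin n)
    (h' : (Σ i : Fin n, Fin (Mf b c A i)) → Fin n) : JM b c A B → (Fin n ⊕ Fin n) :=
  Sum.elim Sum.inl (Sum.elim (fun x => Sum.inl (h x)) (fun x => Sum.inr (h' x)))

lemma word_iff (b c : Fin n) (hbc : b ≠ c) (A B : ℕ) (hA : 0 < A) (hB : 0 < B)
    (w : JM b c A B → (Fin n ⊕ Fin n)) :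
    (IsWord (dM b A B) w ∧ ∀ j, epsM b c A B j (w j) = 1) ↔
      ∃ h ∈ Hset b c B, ∃ h' ∈ Hset b c A, w = mkW b c A B h h' := by
  have hcnt : ∀ q, (Finset.univ.filter (fun j => w j = q)).card =
      (Finset.univ.filter (fun i => w (Sum.inl i) = q)).card +
      ((Finset.univ.filter (fun x => w (Sum.inr (Sum.inl x)) = q)).card +
      (Finset.univ.filter (fun x => w (Sum.inr (Sum.inr x)) = q)).card) := by
    intro q
    simp only [Finset.card_filter, Fintype.sum_sum_type]
  constructor
  · rintro ⟨hw, hadm⟩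
    have h1 : ∀ i, w (Sum.inl i) = Sum.inl i ∨ w (Sum.inl i) = Sum.inr i := by
      intro i
      have := hadm (Sum.inl i)
      simpa [epsM, or_iff_not_imp_left] using this
    have h2 : ∀ x, w (Sum.inr (Sum.inl x)) = Sum.inl x.1 ∨ w (Sum.inr (Sum.inl x)) = Sum.inl b := by
      intro i
      have := hadm (Sum.inr (Sum.inl i))
      simpa [epsM, or_iff_not_imp_left] using this
    have h3 : ∀ x, w (Sum.inr (Sum.inr x)) = Sum.inr x.1 ∨ w (Sum.inr (Sum.inr x)) = Sum.inr b := by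
      intro i
      have := hadm (Sum.inr (Sum.inr i))
      simpa [epsM, or_iff_not_imp_left] using this
    have h2' : ∀ x, ∃ k, w (Sum.inr (Sum.inl x)) = Sum.inl k ∧ (k = x.1 ∨ k = b) := by
      intro x
      rcases h2 x with h | h
      · exact ⟨_, h, Or.inl rfl⟩
      · exact ⟨_, h, Or.inr rfl⟩
    have h3' : ∀ x, ∃ k, w (Sum.inr (Sum.inr x)) = Sum.inr k ∧ (k = x.1 ∨ k = b) := by
      intro x
      rcases h3 x with h | h
      · exact ⟨_, h, Or.inl rfl⟩
      · exact ⟨_, h, Or.inr rfl⟩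
    choose h hh hh2 using h2'
    choose h' hh' hh2' using h3'
    have hall : ∀ i, w (Sum.inl i) = Sum.inl i := by
      have e1 : ∑ i : Fin n, dM b A B (Sum.inl i) + 1 = n * (B + 1) := by
        have : ∀ i, dM b A B (Sum.inl i) + (if i = b then 1 else 0) = B + 1 := by
          intro i
          simp only [dM, Sum.elim_inl]
          split_ifs <;> rfl
        have h5 : ∑ i : Fin n, (dM b A B (Sum.inl i) + (if i = b then 1 else 0)) = n * (B + 1) := by
          rw [Finset.sum_congr rfl (fun i _ => this i)]; simp
        rw [← h5, Finset.sum_add_distrib]; simp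
      have e2 : ∀ i, dM b A B (Sum.inl i) = (if w (Sum.inl i) = Sum.inl i then 1 else 0) +
          (Finset.univ.filter (fun x => h x = i)).card := by
        intro i
        rw [← hw (Sum.inl i), hcnt]
        simp only [hh, hh', Sum.inl.injEq, reduceCtorEq, Finset.filter_false, Finset.card_empty, add_zero]
        congr 1
        rw [Finset.card_filter, Finset.sum_eq_single i]
        · intro i' _ hi'
          rcases h1 i' with h6 | h6 <;> simp [h6, hi']
        · simp
      have e3 : ∑ i, (Finset.univ.filter (fun x => h x = i)).card = ∑ i, Mf b c B i := by
        rw [← Finset.card_eq_sum_card_fiberwise (fun x _ => Finset.mem_univ (h x))]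
        simp
      have e4 := sum_Mf b c hbc B hB
      simp only [e2] at e1
      rw [Finset.sum_add_distrib, e3, ← Finset.card_filter] at e1
      have e5 : (Finset.univ.filter (fun i => w (Sum.inl i) = Sum.inl i)).card = n := by
        rw [mul_add] at e1
        omega
      have e6 : Finset.univ.filter (fun i => w (Sum.inl i) = Sum.inl i) = Finset.univ := by
        apply Finset.eq_univ_of_card
        rw [e5]; simp
      intro i
      have : i ∈ Finset.univ.filter (fun i => w (Sum.inl i) = Sum.inl i) := by rw [e6]; simp
      exact (Finset.mem_filter.mp this).2
    refine ⟨h, ?_, h', ?_, ?_⟩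
    · rw [mem_Hset_iff b c hbc B hB]
      refine ⟨hh2, fun i hi => ?_⟩
      have := hw (Sum.inl i)
      rw [hcnt] at this
      simp only [hall, hh, hh', Sum.inl.injEq, reduceCtorEq, Finset.filter_false, Finset.card_empty, add_zero,
        dM, Sum.elim_inl, hi, if_false] at this
      rw [Finset.filter_eq' , if_pos (Finset.mem_univ _), Finset.card_singleton] at this
      omega
    · rw [mem_Hset_iff b c hbc A hA]
      refine ⟨hh2', fun i hi => ?_⟩
      have := hw (Sum.inr i)
      rw [hcnt] at this
      simpa only [hall, hh, hh', Sum.inr.injEq, reduceCtorEq, Finset.filter_false, Finset.card_empty, add_zero,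
        dM, Sum.elim_inr, hi, if_false, zero_add] using this
    · funext j
      rcases j with i | x | x
      · exact hall i
      · exact hh x
      · exact hh' x
  · rintro ⟨h, hh, h', hh', rfl⟩
    unfold Hset at hh hh'
    simp only [Finset.mem_filter, Finset.mem_univ, true_and] at hh hh'
    refine ⟨?_, ?_⟩
    · intro q
      rw [hcnt]
      rcases q with i | i
      · simp only [mkW, Sum.elim_inl, Sum.elim_inr, Sum.inl.injEq, reduceCtorEq, Finset.filter_false,
          Finset.card_empty, add_zero, dM, hh.2 i]
        rw [Finset.filter_eq' , if_pos (Finset.mem_univ _), Finset.card_singleton]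
        split_ifs <;> omega
      · simp only [mkW, Sum.elim_inl, Sum.elim_inr, Sum.inr.injEq, reduceCtorEq, Finset.filter_false,
          Finset.card_empty, zero_add, dM, hh'.2 i]
    · rintro (i | x | x)
      · simp [mkW, epsM]
      · simpa [mkW, epsM, or_iff_not_imp_left] using hh.1 x
      · simpa [mkW, epsM, or_iff_not_imp_left] using hh'.1 x

lemma choose_odd (a : ℕ) : Odd ((2 * 2 ^ a - 1).choose (2 ^ a)) := by
  have key : ∀ N k, k < 2 ^ N → Odd ((2 ^ N - 1).choose k) := by
    intro N k
    induction k with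
    | zero => intro _; simp
    | succ k ih =>
      intro hk
      have h1 := Nat.prime_two.dvd_choose_pow (n := N) (k := k + 1) (by omega) (by omega)
      have h2 := ih (by omega)
      obtain ⟨M, hM⟩ : ∃ M, 2 ^ N = M + 1 := ⟨2 ^ N - 1, by omega⟩
      rw [hM] at h1 h2 ⊢
      rw [Nat.choose_succ_succ] at h1
      simp only [Nat.add_sub_cancel] at h2 ⊢
      rw [← even_iff_two_dvd] at h1
      rw [Nat.odd_iff] at *
      rw [Nat.even_iff] at h1
      simp only [Nat.succ_eq_add_one] at h1
      omega
  have := key (a + 1) (2 ^ a) (Nat.pow_lt_pow_right (by norm_num) (by omega))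
  rwa [pow_succ, mul_comm] at this

open Classical in
theorem count_ne (b c : Fin n) (hbc : b ≠ c) (s t : ℕ) :
    ∑ w : JM b c (2 ^ s) (2 ^ t) → (Fin n ⊕ Fin n),
      (if IsWord (dM b (2 ^ s) (2 ^ t)) w then ∏ j, epsM b c (2 ^ s) (2 ^ t) j (w j) else 0) ≠ 0 := by
  have z2c : ∀ a : ZMod 2, a ≠ 0 → a = 1 := by decide
  have h1 : ∀ w : JM b c (2 ^ s) (2 ^ t) → (Fin n ⊕ Fin n),
      (if IsWord (dM b (2 ^ s) (2 ^ t)) w then ∏ j, epsM b c (2 ^ s) (2 ^ t) j (w j) else 0) =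
      if w ∈ (Hset b c (2 ^ t) ×ˢ Hset b c (2 ^ s)).image (fun x => mkW b c (2 ^ s) (2 ^ t) x.1 x.2) then 1 else 0 := by
    intro w
    have h2 := word_iff b c hbc (2 ^ s) (2 ^ t) (by positivity) (by positivity) w
    have h3 : w ∈ (Hset b c (2 ^ t) ×ˢ Hset b c (2 ^ s)).image (fun x => mkW b c (2 ^ s) (2 ^ t) x.1 x.2) ↔
        ∃ h ∈ Hset b c (2 ^ t), ∃ h' ∈ Hset b c (2 ^ s), w = mkW b c (2 ^ s) (2 ^ t) h h' := by
      simp only [Finset.mem_image, Finset.mem_product]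
      constructor
      · rintro ⟨⟨h, h'⟩, ⟨ha, hb⟩, rfl⟩
        exact ⟨h, ha, h', hb, rfl⟩
      · rintro ⟨h, ha, h', hb, rfl⟩
        exact ⟨(h, h'), ⟨ha, hb⟩, rfl⟩
    rw [← h2] at h3
    by_cases h4 : IsWord (dM b (2 ^ s) (2 ^ t)) w
    · rw [if_pos h4]
      by_cases h5 : ∀ j, epsM b c (2 ^ s) (2 ^ t) j (w j) = 1
      · rw [if_pos (h3.mpr ⟨h4, h5⟩)]
        exact Finset.prod_eq_one fun j _ => h5 j
      · rw [if_neg (fun h => h5 (h3.mp h).2)]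
        push Not at h5
        obtain ⟨j, hj⟩ := h5
        apply Finset.prod_eq_zero (Finset.mem_univ j)
        by_contra h6
        exact hj (z2c _ h6)
    · rw [if_neg h4, if_neg (fun h => h4 (h3.mp h).1)]
  rw [Finset.sum_congr rfl (fun w _ => h1 w), Finset.sum_ite_mem, Finset.univ_inter, Finset.sum_const,
    nsmul_one, Finset.card_image_of_injective, Finset.card_product, Hset_card b c hbc _ (by positivity),
    Hset_card b c hbc _ (by positivity)]
  · have := (choose_odd t).mul (choose_odd s)
    rw [Ne, ZMod.natCast_eq_zero_iff_even]
    exact Nat.not_even_iff_odd.mpr this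
  · rintro ⟨h, h'⟩ ⟨k, k'⟩ he
    simp only [Prod.mk.injEq]
    constructor
    · funext x
      have := congrFun he (Sum.inr (Sum.inl x))
      simpa [mkW] using this
    · funext x
      have := congrFun he (Sum.inr (Sum.inr x))
      simpa [mkW] using this

end count
end BUP

namespace UB

/-- open star of the lattice point `v` in the Freudenthal triangulation scaled by `ε` -/
def star {D : ℕ} (ε : ℝ) (v : Fin D → ℤ) : Set (Fin D → ℝ) :=
  {x | (∀ i, |x i / ε - v i| < 1) ∧ ∀ i j, (x i / ε - v i) - (x j / ε - v j) < 1}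

lemma star_open {D : ℕ} (ε : ℝ) (v : Fin D → ℤ) : IsOpen (star ε v) := by
  have : star ε v = (⋂ i, {x | |x i / ε - v i| < 1}) ∩
      ⋂ i, ⋂ j, {x : Fin D → ℝ | (x i / ε - v i) - (x j / ε - v j) < 1} := by
    ext x; simp [star]
  rw [this]
  refine IsOpen.inter (isOpen_iInter_of_finite fun i => ?_)
    (isOpen_iInter_of_finite fun i => isOpen_iInter_of_finite fun j => ?_)
  · exact isOpen_lt (by fun_prop) continuous_const
  · exact isOpen_lt (by fun_prop) continuous_const

lemma star_cover {D : ℕ} (ε : ℝ) (x : Fin D → ℝ) : x ∈ star ε (fun i => ⌊x i / ε⌋) := by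
  have h0 : ∀ i, 0 ≤ x i / ε - (⌊x i / ε⌋ : ℝ) := fun i => by linarith [Int.floor_le (x i / ε)]
  have h1 : ∀ i, x i / ε - (⌊x i / ε⌋ : ℝ) < 1 := fun i => by linarith [Int.lt_floor_add_one (x i / ε)]
  refine ⟨fun i => ?_, fun i j => ?_⟩
  · rw [abs_lt]; constructor <;> linarith [h0 i, h1 i]
  · linarith [h1 i, h0 j]

lemma star_dist {D : ℕ} {ε : ℝ} (hε : 0 < ε) (v : Fin D → ℤ) {x y : Fin D → ℝ}
    (hx : x ∈ star ε v) (hy : y ∈ star ε v) : dist x y < 2 * ε := by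
  rw [dist_pi_lt_iff (by linarith)]
  intro i
  have h1 := hx.1 i
  have h2 := hy.1 i
  rw [Real.dist_eq]
  have : x i - y i = ε * ((x i / ε - v i) - (y i / ε - v i)) := by field_simp; ring
  rw [this, abs_mul, abs_of_pos hε, mul_comm]
  apply mul_lt_mul_of_pos_right _ hε
  rw [abs_lt] at *
  constructor <;> linarith

lemma star_sum_inj {D : ℕ} (ε : ℝ) (x : Fin D → ℝ) {v w : Fin D → ℤ}
    (hv : x ∈ star ε v) (hw : x ∈ star ε w) (h : ∑ i, v i = ∑ i, w i) : v = w := by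
  by_contra hne
  obtain ⟨i, hi⟩ : ∃ i, w i < v i := by
    by_contra hcon
    push Not at hcon
    exact hne (funext fun i => (Finset.sum_eq_sum_iff_of_le (fun i _ => hcon i)).1 h i (Finset.mem_univ i))
  obtain ⟨j, hj⟩ : ∃ i, v i < w i := by
    by_contra hcon
    push Not at hcon
    exact hne (funext fun i => ((Finset.sum_eq_sum_iff_of_le (fun i _ => hcon i)).1 h.symm i (Finset.mem_univ i)).symm)
  have h1 := hv.2 j i
  have h2 := hw.2 i j
  have h3 : (w i : ℝ) + 1 ≤ v i := by exact_mod_cast hi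
  have h4 : (v j : ℝ) + 1 ≤ w j := by exact_mod_cast hj
  linarith

lemma star_range {D : ℕ} (ε : ℝ) (x : Fin D → ℝ) {v : Fin D → ℤ} (hv : x ∈ star ε v) (i : Fin D) :
    ⌊x i / ε⌋ ≤ v i ∧ v i ≤ ⌊x i / ε⌋ + 1 := by
  have h := abs_lt.1 (hv.1 i)
  have h0 := Int.floor_le (x i / ε)
  have h1 := Int.lt_floor_add_one (x i / ε)
  constructor
  · by_contra hc
    push Not at hc
    have : (v i : ℝ) + 1 ≤ ⌊x i / ε⌋ := by exact_mod_cast hc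
    linarith [h.2]
  · by_contra hc
    push Not at hc
    have : (⌊x i / ε⌋ : ℝ) + 1 + 1 ≤ v i := by exact_mod_cast hc
    linarith [h.1]

/-- a point lies in at most `D+1` stars -/
lemma star_mult {D : ℕ} (ε : ℝ) (x : Fin D → ℝ) (T : Finset (Fin D → ℤ))
    (hT : ∀ v ∈ T, x ∈ star ε v) : T.card ≤ D + 1 := by
  set m : ℤ := ∑ i, ⌊x i / ε⌋
  have : T.card ≤ (Finset.Icc m (m + D)).card := by
    apply Finset.card_le_card_of_injOn (fun v => ∑ i, v i)
    · intro v hv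
      have hr := star_range ε x (hT v hv)
      simp only [Finset.coe_Icc, Set.mem_Icc]
      constructor
      · exact Finset.sum_le_sum fun i _ => (hr i).1
      · calc ∑ i, v i ≤ ∑ i : Fin D, (⌊x i / ε⌋ + 1) := Finset.sum_le_sum fun i _ => (hr i).2
          _ = m + D := by simp [Finset.sum_add_distrib, m]
    · intro v hv w hw h
      exact star_sum_inj ε x (hT v hv) (hT w hw) h
  rw [Int.card_Icc] at this
  omega

variable {Z : Type*} [TopologicalSpace Z] [CompactSpace Z] [T2Space Z]
variable {α : Type*} [Fintype α] [DecidableEq α]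

open Classical in
lemma refineK {D : ℕ} (K : Set Z) (hK : IsClosed K) (φ : Z → Fin D → ℝ) (hφ : ContinuousOn φ K)
    (hinj : Set.InjOn φ K) (V : α → Set Z) (hV : ∀ a, IsOpen (V a)) (hcov : ∀ z, ∃ a, z ∈ V a) :
    ∃ F : α → Set Z, (∀ a, IsClosed (F a)) ∧ (∀ a, F a ⊆ K) ∧
      (∀ z ∈ K, ∃ a, z ∈ V a ∧ z ∉ F a) ∧
      ∀ z ∈ K, (Finset.univ.filter (fun a => z ∈ V a ∧ z ∉ F a)).card ≤ D + 1 := by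
  have hKc : IsCompact K := hK.isCompact
  have : CompactSpace K := isCompact_iff_compactSpace.1 hKc
  have hemb : Topology.IsClosedEmbedding (K.domRestrict φ) :=
    Continuous.isClosedEmbedding (continuousOn_iff_continuous_domRestrict.1 hφ)
      (Set.injOn_iff_injective.1 hinj)
  have hG : ∀ a, ∃ G : Set (Fin D → ℝ), IsOpen G ∧ ∀ z ∈ K, φ z ∈ G ↔ z ∈ V a := by
    intro a
    obtain ⟨G, hG, hGe⟩ := hemb.isInducing.isOpen_iff.1 ((hV a).preimage (continuous_subtype_val (p := (· ∈ K))))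
    refine ⟨G, hG, fun z hz => ?_⟩
    have := Set.ext_iff.1 hGe ⟨z, hz⟩
    exact this
  choose G hGo hGm using hG
  obtain ⟨δ, hδ, hleb⟩ := lebesgue_number_lemma_of_metric (hKc.image_of_continuousOn hφ) hGo (by
    rintro _ ⟨z, hz, rfl⟩
    obtain ⟨a, ha⟩ := hcov z
    exact Set.mem_iUnion.2 ⟨a, (hGm a z hz).2 ha⟩)
  set ε := δ / 2 with hε
  have hεp : 0 < ε := by positivity
  have hch : ∀ v : Fin D → ℤ, (∃ z ∈ K, φ z ∈ star ε v) → ∃ a, ∀ z ∈ K, φ z ∈ star ε v → z ∈ V a := by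
    rintro v ⟨z, hz, hzv⟩
    obtain ⟨a, ha⟩ := hleb (φ z) ⟨z, hz, rfl⟩
    refine ⟨a, fun z' hz' hzv' => (hGm a z' hz').1 (ha ?_)⟩
    rw [Metric.mem_ball]
    have := star_dist hεp v hzv' hzv
    rw [hε] at this
    linarith
  by_cases hne : Nonempty α
  swap
  · refine ⟨fun _ => ∅, fun _ => isClosed_empty, fun _ => Set.empty_subset _, fun z _ => ?_, fun z _ => ?_⟩
    · obtain ⟨a, _⟩ := hcov z
      exact absurd ⟨a⟩ hne
    · obtain ⟨a, _⟩ := hcov z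
      exact absurd ⟨a⟩ hne
  have hch' : ∀ v : Fin D → ℤ, ∃ a, (∃ z ∈ K, φ z ∈ star ε v) → ∀ z ∈ K, φ z ∈ star ε v → z ∈ V a := by
    intro v
    by_cases h : ∃ z ∈ K, φ z ∈ star ε v
    · obtain ⟨a, ha⟩ := hch v h
      exact ⟨a, fun _ => ha⟩
    · exact ⟨Classical.arbitrary α, fun h' => absurd h' h⟩
  choose c hc using hch'
  obtain ⟨Fs, hFs⟩ : ∃ Fs : α → Set Z, Fs = fun a => {z | z ∈ K ∧ φ z ∈ (⋃ v, ⋃ _ : c v = a, star ε v)ᶜ} := ⟨_, rfl⟩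
  have hout : ∀ a z, z ∈ K → (z ∈ Fs a ↔
      ¬ ∃ v, c v = a ∧ φ z ∈ star ε v) := by
    intro a z hz
    simp [hz, hFs]
  refine ⟨Fs, fun a => ?_, fun a z hz => by rw [hFs] at hz; exact hz.1, ?_, ?_⟩
  · rw [hFs]
    exact hφ.preimage_isClosed_of_isClosed hK
      (isOpen_iUnion fun v => isOpen_iUnion fun _ => star_open ε v).isClosed_compl
  · intro z hz
    refine ⟨c (fun i => ⌊φ z i / ε⌋), hc _ ⟨z, hz, star_cover ε _⟩ z hz (star_cover ε _), ?_⟩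
    rw [hout _ _ hz, not_not]
    exact ⟨_, rfl, star_cover ε _⟩
  · intro z hz
    have : ∀ a ∈ (Finset.univ.filter (fun a => z ∈ V a ∧ z ∉ Fs a)),
        ∃ v, c v = a ∧ φ z ∈ star ε v := by
      intro a ha
      rw [Finset.mem_filter, hout a z hz, not_not] at ha
      exact ha.2.2
    choose! w hw1 hw2 using this
    refine le_trans (Finset.card_le_card_of_injOn w (t := Finset.image w _) (fun a ha => Finset.mem_coe.2 (Finset.mem_image_of_mem w ha)) ?_)
      (star_mult ε (φ z) _ ?_)
    · intro a ha b hb hab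
      rw [← hw1 a ha, ← hw1 b hb, hab]
    · intro v hv
      obtain ⟨a, ha, rfl⟩ := Finset.mem_image.1 hv
      exact hw2 a ha

open Classical in
/-- the inductive refinement -/
lemma refineAll {D : ℕ} (g : Z → Z) (hg : Continuous g) (hgg : ∀ z, g (g z) = z)
    {β : Type*} (K : β → Set Z) (hK : ∀ b, IsClosed (K b)) (φ : β → Z → Fin D → ℝ)
    (hφ : ∀ b, ContinuousOn (φ b) (K b))
    (hinj : ∀ b, Set.InjOn (φ b) (K b)) (hdis : ∀ b z, z ∈ K b → g z ∉ K b)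
    (V : α → Set Z) (hV : ∀ a, IsOpen (V a)) (hcov : ∀ z, ∃ a, z ∈ V a)
    (hinv : ∀ a z, z ∈ V a → g z ∈ V a) (T : Finset β) :
    ∃ V' : α → Set Z, (∀ a, IsOpen (V' a)) ∧ (∀ z, ∃ a, z ∈ V' a) ∧
      (∀ a z, z ∈ V' a → g z ∈ V' a) ∧ (∀ a, V' a ⊆ V a) ∧
      ∀ b ∈ T, ∀ z, z ∈ K b ∨ g z ∈ K b → (Finset.univ.filter (fun a => z ∈ V' a)).card ≤ D + 1 := by
  induction T using Finset.induction_on with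
  | empty => exact ⟨V, hV, hcov, hinv, fun a => subset_rfl, by simp⟩
  | insert b T hb ih =>
    obtain ⟨V', h1, h2, h3, h4, h5⟩ := ih
    obtain ⟨F, f1, f2, f3, f4⟩ := refineK (K b) (hK b) (φ b) (hφ b) (hinj b) V' h1 h2
    have hKF : ∀ z ∈ K b, ∀ a, z ∈ V' a \ (F a ∪ g ⁻¹' (F a)) ↔ z ∈ V' a ∧ z ∉ F a := by
      intro z hz a
      constructor
      · rintro ⟨h, h'⟩
        exact ⟨h, fun hh => h' (Or.inl hh)⟩
      · rintro ⟨h, h'⟩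
        refine ⟨h, ?_⟩
        rintro (hh | hh)
        · exact h' hh
        · exact hdis b z hz (f2 a hh)
    have hinv' : ∀ a z, z ∈ V' a \ (F a ∪ g ⁻¹' (F a)) → g z ∈ V' a \ (F a ∪ g ⁻¹' (F a)) := by
      rintro a z ⟨h, h'⟩
      refine ⟨h3 a z h, ?_⟩
      rintro (hh | hh)
      · exact h' (Or.inr hh)
      · rw [Set.mem_preimage, hgg] at hh
        exact h' (Or.inl hh)
    have hinv'' : ∀ a z, z ∈ V' a \ (F a ∪ g ⁻¹' (F a)) ↔ g z ∈ V' a \ (F a ∪ g ⁻¹' (F a)) := by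
      intro a z
      refine ⟨hinv' a z, fun h => ?_⟩
      have := hinv' a _ h
      rwa [hgg] at this
    refine ⟨fun a => V' a \ (F a ∪ g ⁻¹' (F a)), fun a => (h1 a).sdiff ((f1 a).union ((f1 a).preimage hg)),
      ?_, hinv', fun a => Set.sdiff_subset.trans (h4 a), ?_⟩
    · intro z
      by_cases hz : z ∈ K b
      · obtain ⟨a, ha⟩ := f3 z hz
        exact ⟨a, (hKF z hz a).2 ha⟩
      by_cases hz' : g z ∈ K b
      · obtain ⟨a, ha⟩ := f3 _ hz'
        exact ⟨a, (hinv'' a z).2 ((hKF _ hz' a).2 ha)⟩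
      obtain ⟨a, ha⟩ := h2 z
      refine ⟨a, ha, ?_⟩
      rintro (hh | hh)
      · exact hz (f2 a hh)
      · exact hz' (f2 a hh)
    · intro b' hb' z hz
      rw [Finset.mem_insert] at hb'
      rcases hb' with rfl | hb'
      · rcases hz with hz | hz
        · refine le_trans (Finset.card_le_card ?_) (f4 z hz)
          intro a
          simp only [Finset.mem_filter, Finset.mem_univ, true_and]
          exact (hKF z hz a).1
        · refine le_trans (Finset.card_le_card ?_) (f4 _ hz)
          intro a
          simp only [Finset.mem_filter, Finset.mem_univ, true_and]
          exact fun h => (hKF _ hz a).1 (hinv' a z h)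
      · refine le_trans (Finset.card_le_card ?_) (h5 b' hb' z hz)
        intro a
        simp only [Finset.mem_filter, Finset.mem_univ, true_and]
        exact fun h => h.1

open Classical in
theorem cover_thm {D : ℕ} (g : Z → Z) (hg : Continuous g) (hgg : ∀ z, g (g z) = z)
    (O K : α → Set Z) (hO : ∀ a, IsOpen (O a)) (hK : ∀ b, IsClosed (K b)) (hOK : ∀ a, O a ⊆ K a)
    (hcov : ∀ z, ∃ a, z ∈ O a) (φ : α → Z → Fin D → ℝ)
    (hφ : ∀ b, ContinuousOn (φ b) (K b))
    (hinj : ∀ b, Set.InjOn (φ b) (K b)) (hdis : ∀ b z, z ∈ K b → g z ∉ K b) [Nonempty α] :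
    ∃ (P : Fin (D + 1) → Finset α → Set Z) (c : Finset α → α),
      (∀ k S, IsOpen (P k S)) ∧ (∀ k S, P k S ⊆ O (c S)) ∧
      (∀ k S S' z, z ∈ P k S → z ∈ P k S' → S = S') ∧
      (∀ k S S' z, z ∈ P k S → g z ∉ P k S') ∧
      ∀ z, ∃ k S, z ∈ P k S ∨ g z ∈ P k S := by
  obtain ⟨V, h1, h2, h3, h4, h5⟩ := refineAll g hg hgg K hK φ hφ hinj hdis
    (fun a => O a ∪ g ⁻¹' (O a)) (fun a => (hO a).union ((hO a).preimage hg))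
    (fun z => (hcov z).imp fun a ha => Or.inl ha)
    (by
      rintro a z (h | h)
      · right; rwa [Set.mem_preimage, hgg]
      · left; exact h) (Finset.univ : Finset α)
  obtain ⟨f, hf⟩ := PartitionOfUnity.exists_isSubordinate (X := Z) isClosed_univ V h1
    (fun z _ => Set.mem_iUnion.2 (h2 z))
  set ψ : α → Z → ℝ := fun a z => f a z + f a (g z) with hψ
  have hψc : ∀ a, Continuous (ψ a) := fun a => by
    exact (f a).continuous.add ((f a).continuous.comp hg)
  have hψinv : ∀ a z, ψ a (g z) = ψ a z := fun a z => by simp [hψ, hgg, add_comm]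
  have hsupp : ∀ a z, f a z ≠ 0 → z ∈ V a := fun a z h =>
    hf a (subset_tsupport _ h)
  have hψV : ∀ a z, 0 < ψ a z → z ∈ V a := by
    intro a z h
    by_contra hz
    have e1 : f a z = 0 := by
      by_contra h0; exact hz (hsupp a z h0)
    have e2 : f a (g z) = 0 := by
      by_contra h0
      have := h3 a _ (hsupp a _ h0)
      rw [hgg] at this
      exact hz this
    simp [hψ, e1, e2] at h
  have hψ0 : ∀ a z, 0 ≤ ψ a z := fun a z => add_nonneg (f.nonneg a z) (f.nonneg a _)
  have hex : ∀ z, ∃ a, 0 < ψ a z := by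
    intro z
    obtain ⟨a, ha⟩ := f.exists_pos (Set.mem_univ z)
    exact ⟨a, add_pos_of_pos_of_nonneg ha (f.nonneg a _)⟩
  set c : Finset α → α := fun S => if h : S.Nonempty then h.choose else Classical.arbitrary α with hc
  have hcm : ∀ S : Finset α, S.Nonempty → c S ∈ S := fun S h => by
    simp only [hc, h, dif_pos]; exact h.choose_spec
  set W : Finset α → Set Z := fun S => {z | ∀ a ∈ S, 0 < ψ a z ∧ ∀ b ∉ S, ψ b z < ψ a z} with hW
  have hWo : ∀ S, IsOpen (W S) := by
    intro S
    have : W S = ⋂ a ∈ S, ({z | 0 < ψ a z} ∩ ⋂ b ∈ (Finset.univ.filter (· ∉ S)), {z | ψ b z < ψ a z}) := by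
      ext z; simp [hW]
    rw [this]
    refine isOpen_biInter_finset fun a _ => IsOpen.inter (isOpen_lt continuous_const (hψc a))
      (isOpen_biInter_finset fun b _ => isOpen_lt (hψc b) (hψc a))
  have hWinv : ∀ S z, z ∈ W S → g z ∈ W S := by
    intro S z h
    simpa [hW, hψinv] using h
  have hWdis : ∀ S S' z, S.card = S'.card → z ∈ W S → z ∈ W S' → S = S' := by
    intro S S' z hcard hz hz'
    by_contra hne
    have n1 : ¬ S ⊆ S' := fun h => hne (Finset.eq_of_subset_of_card_le h hcard.ge)
    have n2 : ¬ S' ⊆ S := fun h => hne (Finset.eq_of_subset_of_card_le h hcard.le).symm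
    obtain ⟨a, ha, ha'⟩ := Finset.not_subset.1 n1
    obtain ⟨b, hb, hb'⟩ := Finset.not_subset.1 n2
    have q1 := (hz a ha).2 b hb'
    have q2 := (hz' b hb).2 a ha'
    exact lt_asymm q1 q2
  refine ⟨fun k S => {z | S.card = k + 1 ∧ z ∈ W S ∧ z ∈ O (c S)}, c, ?_, ?_, ?_, ?_, ?_⟩
  · intro k S
    by_cases h : S.card = k + 1
    · simpa [h] using (hWo S).inter (hO (c S))
    · simp [h]
  · exact fun k S z h => h.2.2
  · exact fun k S S' z h h' => hWdis S S' z (h.1.trans h'.1.symm) h.2.1 h'.2.1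
  · rintro k S S' z ⟨q1, q2, q3⟩ ⟨p1, p2, p3⟩
    have := hWdis S S' (g z) (q1.trans p1.symm) (hWinv S z q2) p2
    subst this
    exact hdis _ z (hOK _ q3) (hOK _ p3)
  · intro z
    set S : Finset α := Finset.univ.filter (fun a => 0 < ψ a z) with hS
    have hSne : S.Nonempty := by
      obtain ⟨a, ha⟩ := hex z
      exact ⟨a, by simp [hS, ha]⟩
    have hScard : S.card ≤ D + 1 := by
      obtain ⟨b, hb⟩ := hcov z
      refine le_trans (Finset.card_le_card ?_) (h5 b (Finset.mem_univ b) z (Or.inl (hOK b hb)))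
      intro a
      simp only [hS, Finset.mem_filter, Finset.mem_univ, true_and]
      exact hψV a z
    have hzW : z ∈ W S := by
      intro a ha
      have ha' : 0 < ψ a z := by simpa [hS] using ha
      refine ⟨ha', fun b hb => ?_⟩
      have : ψ b z ≤ 0 := by simpa [hS] using hb
      linarith
    have hpos : 0 < S.card := hSne.card_pos
    have hcard : S.card = ((⟨S.card - 1, by omega⟩ : Fin (D + 1)) : ℕ) + 1 := by simp; omega
    have hzV := h4 _ (hψV (c S) z ((hzW _ (hcm S hSne)).1))
    refine ⟨⟨S.card - 1, by omega⟩, S, ?_⟩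
    rcases hzV with h | h
    · exact Or.inl ⟨hcard, hzW, h⟩
    · exact Or.inr ⟨hcard, hWinv S z hzW, h⟩

end UB

open scoped unitInterval

namespace MG

section proj
variable {m : ℕ}

lemma mk_cont {Y : Type*} [TopologicalSpace Y] (f : Y → Fin m → ℝ) (hf : Continuous f)
    (h0 : ∀ y, f y ≠ 0) : Continuous (fun y => Projectivization.mk ℝ (f y) (h0 y)) :=
  continuous_quot_mk.comp (hf.subtype_mk h0)

noncomputable def E (i k : Fin m) (p : Projectivization ℝ (Fin m → ℝ)) : ℝ :=
  p.rep i * p.rep k / ∑ l, p.rep l ^ 2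

lemma sq_pos {v : Fin m → ℝ} (hv : v ≠ 0) : 0 < ∑ l, v l ^ 2 := by
  obtain ⟨i, hi⟩ := Function.ne_iff.1 hv
  refine Finset.sum_pos' (fun _ _ => sq_nonneg _) ⟨i, Finset.mem_univ i, ?_⟩
  have : v i ≠ 0 := hi
  positivity

lemma E_mk (i k : Fin m) (v : Fin m → ℝ) (hv : v ≠ 0) :
    E i k (Projectivization.mk ℝ v hv) = v i * v k / ∑ l, v l ^ 2 := by
  obtain ⟨a, ha⟩ := Projectivization.exists_smul_eq_mk_rep ℝ v hv
  unfold E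
  rw [← ha]
  have h1 := (sq_pos hv).ne'
  have h2 : (a : ℝ) ≠ 0 := a.ne_zero
  simp only [Units.smul_def, Pi.smul_apply, smul_eq_mul, mul_pow, ← Finset.mul_sum]
  field_simp

lemma E_cont (i k : Fin m) : Continuous (E i k) := by
  refine (isQuotientMap_quot_mk (X := {v : Fin m → ℝ // v ≠ 0})).continuous_iff.2 ?_
  have : (E i k ∘ Quot.mk _ : {v : Fin m → ℝ // v ≠ 0} → ℝ) = fun v => v.1 i * v.1 k / ∑ l, v.1 l ^ 2 := by
    funext v
    exact E_mk i k v.1 v.2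
  have h2 : Continuous (fun v : {v : Fin m → ℝ // v ≠ 0} => v.1 i * v.1 k / ∑ l, v.1 l ^ 2) :=
    Continuous.div ((show Continuous (fun v : Fin m → ℝ => v i * v k) by fun_prop).comp continuous_subtype_val)
      ((show Continuous (fun v : Fin m → ℝ => ∑ l, v l ^ 2) by fun_prop).comp continuous_subtype_val)
      fun v => (sq_pos v.2).ne'
  exact this ▸ h2

/-- normalised representative -/
noncomputable def nv (k : Fin m) (p : Projectivization ℝ (Fin m → ℝ)) : Fin m → ℝ :=
  fun i => E i k p / E k k p

lemma nv_mk (k : Fin m) (v : Fin m → ℝ) (hv : v ≠ 0) :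
    nv k (Projectivization.mk ℝ v hv) = (v k)⁻¹ • v := by
  funext i
  simp only [nv, E_mk, Pi.smul_apply, smul_eq_mul]
  have h1 := (sq_pos hv).ne'
  by_cases h : v k = 0
  · simp [h]
  · field_simp

lemma E_ne (k : Fin m) (v : Fin m → ℝ) (hv : v ≠ 0) :
    E k k (Projectivization.mk ℝ v hv) ≠ 0 ↔ v k ≠ 0 := by
  rw [E_mk]
  have h1 := (sq_pos hv).ne'
  simp [h1]

lemma nv_k {k : Fin m} {p : Projectivization ℝ (Fin m → ℝ)} (h : E k k p ≠ 0) : nv k p k = 1 := by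
  simp [nv, h]

lemma nv_ne {k : Fin m} {p : Projectivization ℝ (Fin m → ℝ)} (h : E k k p ≠ 0) : nv k p ≠ 0 := by
  intro h0
  have := nv_k h
  rw [h0] at this
  simp at this

lemma mk_nv {k : Fin m} {p : Projectivization ℝ (Fin m → ℝ)} (h : E k k p ≠ 0) :
    Projectivization.mk ℝ (nv k p) (nv_ne h) = p := by
  induction p using Projectivization.ind with
  | h v hv =>
    rw [Projectivization.mk_eq_mk_iff']
    refine ⟨(v k)⁻¹, ?_⟩
    rw [nv_mk]

lemma exists_E_ne (p : Projectivization ℝ (Fin m → ℝ)) : ∃ k, E k k p ≠ 0 := by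
  induction p using Projectivization.ind with
  | h v hv =>
    obtain ⟨i, hi⟩ := Function.ne_iff.1 hv
    exact ⟨i, (E_ne i v hv).2 hi⟩

lemma E_inj {p q : Projectivization ℝ (Fin m → ℝ)} (h : ∀ i k, E i k p = E i k q) : p = q := by
  obtain ⟨k, hk⟩ := exists_E_ne p
  have hk' : E k k q ≠ 0 := by rwa [← h]
  have : nv k p = nv k q := by funext i; simp [nv, h]
  rw [← mk_nv hk, ← mk_nv hk']
  simp only [this]

instance : T2Space (Projectivization ℝ (Fin m → ℝ)) :=
  T2Space.of_injective_continuous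
    (f := fun (p : Projectivization ℝ (Fin m → ℝ)) (q : Fin m × Fin m) => E q.1 q.2 p)
    (fun _ _ h => E_inj fun i k => congrFun h (i, k))
    (continuous_pi fun q => E_cont q.1 q.2)

lemma nv_contOn (k : Fin m) : ContinuousOn (nv k) {p | E k k p ≠ 0} := by
  refine continuousOn_pi.2 fun i => ?_
  exact (E_cont i k).continuousOn.div (E_cont k k).continuousOn fun p hp => hp

lemma exists_unit (q : Projectivization ℝ (Fin m → ℝ)) : ∃ v, ∃ hv : v ≠ 0,
    q = Projectivization.mk ℝ v hv ∧ ∑ l, v l ^ 2 = 1 := by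
  induction q using Projectivization.ind with
  | h v hv =>
    have hp := sq_pos hv
    set c := Real.sqrt (∑ l, v l ^ 2) with hc
    have hcp : 0 < c := Real.sqrt_pos.2 hp
    refine ⟨c⁻¹ • v, smul_ne_zero (inv_ne_zero hcp.ne') hv, ?_, ?_⟩
    · rw [Projectivization.mk_eq_mk_iff']
      exact ⟨c, by rw [smul_smul, mul_inv_cancel₀ hcp.ne', one_smul]⟩
    · simp only [Pi.smul_apply, smul_eq_mul, mul_pow, ← Finset.mul_sum]
      rw [← Real.sq_sqrt hp.le, ← hc]
      field_simp

end proj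

section milnor
variable {r s : ℕ}

lemma mem_iff (hs : s ≤ r) {x : Fin (r + 1) → ℝ} {y : Fin (s + 1) → ℝ} (hx : x ≠ 0) (hy : y ≠ 0) :
    (Projectivization.mk ℝ x hx, Projectivization.mk ℝ y hy) ∈ RealMilnor r s ↔
      ∑ i : Fin (s + 1), x (Fin.castLE (by omega) i) * y i = 0 := by
  obtain ⟨a, ha⟩ := Projectivization.exists_smul_eq_mk_rep ℝ x hx
  obtain ⟨b, hb⟩ := Projectivization.exists_smul_eq_mk_rep ℝ y hy
  unfold RealMilnor
  simp only [Set.mem_ofPred_eq]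
  rw [← ha, ← hb]
  have hmin : min (s + 1) (r + 1) = s + 1 := by omega
  have : ∑ i : Fin (min (s + 1) (r + 1)),
      (a • x) (Fin.castLE (min_le_right _ _) i) * (b • y) (Fin.castLE (min_le_left _ _) i) =
      (a * b : ℝ) * ∑ i : Fin (s + 1), x (Fin.castLE (by omega) i) * y i := by
    rw [Finset.mul_sum]
    refine Fintype.sum_equiv (finCongr hmin) _ _ fun i => ?_
    simp only [Units.smul_def, Pi.smul_apply, smul_eq_mul]
    have e1 : Fin.castLE (by omega : s + 1 ≤ r + 1) (finCongr hmin i) =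
      Fin.castLE (min_le_right _ _) i := by ext; simp
    have e2 : finCongr hmin i = Fin.castLE (min_le_left _ _) i := by ext; simp
    rw [e1, e2]; ring
  rw [this]
  have h1 : (a : ℝ) ≠ 0 := a.ne_zero
  have h2 : (b : ℝ) ≠ 0 := b.ne_zero
  simp [h1, h2]

noncomputable def mkX (hs : s ≤ r) (x : Fin (r + 1) → ℝ) (y : Fin (s + 1) → ℝ) (hx : x ≠ 0) (hy : y ≠ 0)
    (h : ∑ i : Fin (s + 1), x (Fin.castLE (by omega) i) * y i = 0) : RealMilnor r s :=
  ⟨(Projectivization.mk ℝ x hx, Projectivization.mk ℝ y hy), (mem_iff hs hx hy).2 h⟩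

lemma mkX_cont (hs : s ≤ r) {Y : Type*} [TopologicalSpace Y] (x : Y → Fin (r + 1) → ℝ)
    (y : Y → Fin (s + 1) → ℝ) (hxc : Continuous x) (hyc : Continuous y) (hx : ∀ a, x a ≠ 0) (hy : ∀ a, y a ≠ 0)
    (h : ∀ a, ∑ i : Fin (s + 1), x a (Fin.castLE (by omega) i) * y a i = 0) :
    Continuous (fun a => mkX hs (x a) (y a) (hx a) (hy a) (h a)) :=
  Continuous.subtype_mk ((mk_cont x hxc hx).prodMk (mk_cont y hyc hy)) _

lemma mkX_surj (hs : s ≤ r) (p : RealMilnor r s) : ∃ x y hx hy h,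
    p = mkX hs x y hx hy h ∧ ∑ l, x l ^ 2 = 1 ∧ ∑ l, y l ^ 2 = 1 := by
  obtain ⟨⟨p1, p2⟩, hp⟩ := p
  obtain ⟨x, hx, rfl, hx1⟩ := exists_unit p1
  obtain ⟨y, hy, rfl, hy1⟩ := exists_unit p2
  exact ⟨x, y, hx, hy, (mem_iff hs hx hy).1 hp, rfl, hx1, hy1⟩

def sphPairs (hs : s ≤ r) : Set ((Fin (r + 1) → ℝ) × (Fin (s + 1) → ℝ)) :=
  {q | ∑ l, q.1 l ^ 2 = 1 ∧ ∑ l, q.2 l ^ 2 = 1 ∧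
    ∑ i : Fin (s + 1), q.1 (Fin.castLE (by omega) i) * q.2 i = 0}

lemma ne_of_sq {m : ℕ} {v : Fin m → ℝ} (h : ∑ l, v l ^ 2 = 1) : v ≠ 0 := by
  rintro rfl
  simp at h

lemma abs_le_of_sq {m : ℕ} {v : Fin m → ℝ} (h : ∑ l, v l ^ 2 = 1) (i : Fin m) : v i ∈ Set.Icc (-1 : ℝ) 1 := by
  have : v i ^ 2 ≤ ∑ l, v l ^ 2 := Finset.single_le_sum (f := fun l => v l ^ 2) (fun _ _ => sq_nonneg _) (Finset.mem_univ i)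
  rw [h] at this
  exact abs_le.1 ((sq_le_one_iff_abs_le_one _).1 this)

lemma sphPairs_compact (hs : s ≤ r) : IsCompact (sphPairs (r := r) (s := s) hs) := by
  have hc : IsClosed (sphPairs (r := r) (s := s) hs) := by
    refine IsClosed.inter (isClosed_eq (by fun_prop) continuous_const)
      (IsClosed.inter (isClosed_eq (by fun_prop) continuous_const) (isClosed_eq (by fun_prop) continuous_const))
  refine IsCompact.of_isClosed_subset ((isCompact_univ_pi fun _ => isCompact_Icc (a := (-1 : ℝ)) (b := 1)).prod
    (isCompact_univ_pi fun _ => isCompact_Icc (a := (-1 : ℝ)) (b := 1))) hc ?_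
  rintro ⟨x, y⟩ ⟨h1, h2, -⟩
  exact ⟨fun i _ => abs_le_of_sq h1 i, fun i _ => abs_le_of_sq h2 i⟩

lemma compactX (hs : s ≤ r) : CompactSpace (RealMilnor r s) := by
  have := isCompact_iff_compactSpace.1 (sphPairs_compact (r := r) (s := s) hs)
  have hcont := mkX_cont hs (fun q : sphPairs (r := r) (s := s) hs => q.1.1) (fun q => q.1.2) (by fun_prop) (by fun_prop)
    (fun q => ne_of_sq q.2.1) (fun q => ne_of_sq q.2.2.1) (fun q => q.2.2.2)
  refine Function.Surjective.compactSpace (f := fun q : sphPairs (r := r) (s := s) hs =>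
    mkX hs q.1.1 q.1.2 (ne_of_sq q.2.1) (ne_of_sq q.2.2.1) q.2.2.2) hcont ?_
  intro p
  obtain ⟨x, y, hx, hy, h, rfl, h1, h2⟩ := mkX_surj hs p
  exact ⟨⟨(x, y), h1, h2, h⟩, rfl⟩

end milnor

end MG

open scoped unitInterval

namespace MG

section charts
variable {r s : ℕ}

def Yv (j : Fin (s + 1)) (a : Fin (s + 1) → ℝ) : Fin (s + 1) → ℝ := Function.update a j 1

def Xv (hs : s ≤ r) (j : Fin (s + 1)) (k : Fin (r + 1)) (a : Fin (s + 1) → ℝ) (b : Fin (r + 1) → ℝ) :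
    Fin (r + 1) → ℝ :=
  Function.update (Function.update b k 1) (Fin.castLE (by omega) j)
    (-∑ i ∈ Finset.univ.erase j, (Function.update b k 1) (Fin.castLE (by omega) i) * a i)

lemma Yv_ne (j : Fin (s + 1)) (a : Fin (s + 1) → ℝ) : Yv j a ≠ 0 := by
  intro h
  have := congrFun h j
  simp [Yv] at this

lemma Xv_ne (hs : s ≤ r) (j : Fin (s + 1)) (k : Fin (r + 1)) (hk : k ≠ Fin.castLE (by omega) j)
    (a : Fin (s + 1) → ℝ) (b : Fin (r + 1) → ℝ) : Xv hs j k a b ≠ 0 := by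
  intro h
  have := congrFun h k
  simp [Xv, Function.update_of_ne hk] at this

lemma castLE_ne {hs : s + 1 ≤ r + 1} {i j : Fin (s + 1)} (h : i ≠ j) : Fin.castLE hs i ≠ Fin.castLE hs j :=
  fun h' => h (Fin.castLE_injective hs h')

lemma XY_dot (hs : s ≤ r) (j : Fin (s + 1)) (k : Fin (r + 1)) 
    (a : Fin (s + 1) → ℝ) (b : Fin (r + 1) → ℝ) :
    ∑ i : Fin (s + 1), Xv hs j k a b (Fin.castLE (by omega) i) * Yv j a i = 0 := by
  rw [← Finset.add_sum_erase _ _ (Finset.mem_univ j)]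
  have : ∑ i ∈ Finset.univ.erase j, Xv hs j k a b (Fin.castLE (by omega) i) * Yv j a i =
      ∑ i ∈ Finset.univ.erase j, (Function.update b k 1) (Fin.castLE (by omega) i) * a i := by
    refine Finset.sum_congr rfl fun i hi => ?_
    have hij : i ≠ j := Finset.ne_of_mem_erase hi
    rw [Xv, Yv, Function.update_of_ne (castLE_ne hij), Function.update_of_ne hij]
  rw [this]
  simp [Xv, Yv]

noncomputable def pt (hs : s ≤ r) (j : Fin (s + 1)) (k : Fin (r + 1)) (hk : k ≠ Fin.castLE (by omega) j)
    (a : Fin (s + 1) → ℝ) (b : Fin (r + 1) → ℝ) : RealMilnor r s :=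
  mkX hs (Xv hs j k a b) (Yv j a) (Xv_ne hs j k hk a b) (Yv_ne j a) (XY_dot hs j k a b)

lemma pt_cont (hs : s ≤ r) (j : Fin (s + 1)) (k : Fin (r + 1)) (hk : k ≠ Fin.castLE (by omega) j)
    {Y : Type*} [TopologicalSpace Y] (a : Y → Fin (s + 1) → ℝ) (b : Y → Fin (r + 1) → ℝ)
    (ha : Continuous a) (hb : Continuous b) : Continuous (fun q => pt hs j k hk (a q) (b q)) := by
  refine mkX_cont hs _ _ ?_ ?_ _ _ _
  · unfold Xv
    refine Continuous.update (hb.update k continuous_const) _ ?_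
    refine Continuous.neg (continuous_finsetSum _ fun i _ => Continuous.mul ?_ ((continuous_apply i).comp ha))
    exact continuous_pi_iff.1 (hb.update k continuous_const) _
  · exact ha.update j continuous_const

/-- chart domain -/
def Uc (j : Fin (s + 1)) (k : Fin (r + 1)) : Set (RealMilnor r s) :=
  {p | E k k p.1.1 ≠ 0 ∧ E j j p.1.2 ≠ 0}

lemma Uc_open (j : Fin (s + 1)) (k : Fin (r + 1)) : IsOpen (Uc j k : Set (RealMilnor r s)) := by
  refine IsOpen.inter ?_ ?_
  · exact isOpen_ne_fun ((E_cont k k).comp (continuous_fst.comp continuous_subtype_val)) continuous_const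
  · exact isOpen_ne_fun ((E_cont j j).comp (continuous_snd.comp continuous_subtype_val)) continuous_const

lemma pt_eq (hs : s ≤ r) (j : Fin (s + 1)) (k : Fin (r + 1)) (hk : k ≠ Fin.castLE (by omega) j)
    (p : RealMilnor r s) (hp : p ∈ Uc j k) (a : Fin (s + 1) → ℝ) (b : Fin (r + 1) → ℝ)
    (ha : ∀ i, i ≠ j → a i = nv j p.1.2 i)
    (hb : ∀ i, i ≠ k → i ≠ Fin.castLE (by omega) j → b i = nv k p.1.1 i) :
    pt hs j k hk a b = p := by
  have hY : Yv j a = nv j p.1.2 := by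
    funext i
    by_cases hi : i = j
    · subst hi; simp [Yv, nv_k hp.2]
    · rw [Yv, Function.update_of_ne hi, ha i hi]
  have hdot : ∑ i : Fin (s + 1), nv k p.1.1 (Fin.castLE (by omega) i) * nv j p.1.2 i = 0 := by
    rw [← mem_iff hs (nv_ne hp.1) (nv_ne hp.2), mk_nv hp.1, mk_nv hp.2]
    exact p.2
  have hX1 : ∀ i, i ≠ Fin.castLE (by omega) j → Function.update b k 1 i = nv k p.1.1 i := by
    intro i hi
    by_cases hik : i = k
    · subst hik; simp [nv_k hp.1]
    · rw [Function.update_of_ne hik, hb i hik hi]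
  have hX : Xv hs j k a b = nv k p.1.1 := by
    funext i
    by_cases hi : i = Fin.castLE (by omega) j
    · subst hi
      rw [Xv, Function.update_self]
      rw [← Finset.add_sum_erase _ _ (Finset.mem_univ j), nv_k hp.2, mul_one] at hdot
      rw [neg_eq_iff_add_eq_zero, add_comm, ← hdot]
      congr 1
      refine Finset.sum_congr rfl fun i hi => ?_
      have hij : i ≠ j := Finset.ne_of_mem_erase hi
      rw [hX1 _ (castLE_ne hij), ha i hij]
    · rw [Xv, Function.update_of_ne hi, hX1 i hi]
  apply Subtype.ext
  apply Prod.ext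
  · change Projectivization.mk ℝ (Xv hs j k a b) _ = _
    simp only [hX]
    exact mk_nv hp.1
  · change Projectivization.mk ℝ (Yv j a) _ = _
    simp only [hY]
    exact mk_nv hp.2

abbrev Idx (hs : s ≤ r) (j : Fin (s + 1)) (k : Fin (r + 1)) :=
  {i : Fin (s + 1) // i ≠ j} ⊕ {i : Fin (r + 1) // i ≠ k ∧ i ≠ Fin.castLE (by omega) j}

lemma Idx_card (hs : s ≤ r) (j : Fin (s + 1)) (k : Fin (r + 1)) (hk : k ≠ Fin.castLE (by omega) j) :
    Fintype.card (Idx hs j k) = r + s - 1 := by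
  rw [Fintype.card_sum, Fintype.card_subtype, Fintype.card_subtype]
  have e1 : Finset.univ.filter (fun i => i ≠ j) = Finset.univ.erase j := by ext; simp
  have e2 : Finset.univ.filter (fun i => i ≠ k ∧ i ≠ Fin.castLE (by omega) j) =
      (Finset.univ.erase k).erase (Fin.castLE (by omega) j) := by ext; simp [and_comm]
  rw [e1, e2, Finset.card_erase_of_mem (Finset.mem_univ _), Finset.card_erase_of_mem, Finset.card_erase_of_mem (Finset.mem_univ _)]
  · simp only [Finset.card_univ, Fintype.card_fin]
    have : 1 ≤ r := by
      have := k.2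
      by_contra h
      apply hk
      ext
      have := j.2
      simp; omega
    omega
  · simp [hk.symm]

noncomputable def phi (hs : s ≤ r) (j : Fin (s + 1)) (k : Fin (r + 1)) (p : RealMilnor r s) : Idx hs j k → ℝ :=
  Sum.elim (fun i => nv j p.1.2 i.1) (fun i => nv k p.1.1 i.1)

lemma nv1_contOn (j : Fin (s + 1)) (k : Fin (r + 1)) :
    ContinuousOn (fun p : RealMilnor r s => nv k p.1.1) (Uc j k) :=
  (nv_contOn k).comp (continuous_fst.comp continuous_subtype_val).continuousOn fun _ hp => hp.1

lemma nv2_contOn (j : Fin (s + 1)) (k : Fin (r + 1)) :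
    ContinuousOn (fun p : RealMilnor r s => nv j p.1.2) (Uc j k) :=
  (nv_contOn j).comp (continuous_snd.comp continuous_subtype_val).continuousOn fun _ hp => hp.2

lemma phi_contOn (hs : s ≤ r) (j : Fin (s + 1)) (k : Fin (r + 1)) : ContinuousOn (phi hs j k) (Uc j k) := by
  refine continuousOn_pi.2 ?_
  rintro (i | i)
  · exact continuousOn_pi.1 (nv2_contOn j k) i.1
  · exact continuousOn_pi.1 (nv1_contOn j k) i.1

lemma phi_injOn (hs : s ≤ r) (j : Fin (s + 1)) (k : Fin (r + 1)) (hk : k ≠ Fin.castLE (by omega) j) :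
    Set.InjOn (phi hs j k) (Uc j k) := by
  intro p hp q hq h
  rw [← pt_eq hs j k hk p hp (nv j p.1.2) (nv k p.1.1) (fun _ _ => rfl) (fun _ _ _ => rfl)]
  refine pt_eq hs j k hk q hq _ _ (fun i hi => ?_) (fun i hi hi' => ?_)
  · exact congrFun h (Sum.inl ⟨i, hi⟩)
  · exact congrFun h (Sum.inr ⟨i, hi, hi'⟩)

lemma exists_chart (hs : s < r) (p : RealMilnor r s) : ∃ (j : Fin (s + 1)) (k : Fin (r + 1)),
    k ≠ Fin.castLE (by omega) j ∧ p ∈ Uc j k := by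
  obtain ⟨x, y, hx, hy, h, rfl, h1, h2⟩ := mkX_surj hs.le p
  obtain ⟨j, hj⟩ := Function.ne_iff.1 hy
  by_cases hcase : ∃ k, k ≠ Fin.castLE (by omega) j ∧ x k ≠ 0
  · obtain ⟨k, hk, hxk⟩ := hcase
    exact ⟨j, k, hk, (E_ne k x hx).2 hxk, (E_ne j y hy).2 hj⟩
  · exfalso
    push Not at hcase
    rw [Finset.sum_eq_single j] at h
    · have hj' : y j ≠ 0 := hj
      have : x (Fin.castLE (by omega) j) = 0 := by
        rcases mul_eq_zero.1 h with h | h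
        · exact h
        · exact absurd h hj'
      apply hx
      funext k
      by_cases hk : k = Fin.castLE (by omega) j
      · rw [hk]; exact this
      · exact hcase k hk
    · intro b _ hb
      rw [hcase _ (castLE_ne hb), zero_mul]
    · simp

/-- affine segment -/
lemma joined_aux (hs : s ≤ r) (x x' : Fin (r + 1) → ℝ) (y y' : Fin (s + 1) → ℝ)
    (hx : ∀ t : I, (1 - (t : ℝ)) • x + (t : ℝ) • x' ≠ 0) (hy : ∀ t : I, (1 - (t : ℝ)) • y + (t : ℝ) • y' ≠ 0)
    (h : ∀ t : I, ∑ i : Fin (s + 1), ((1 - (t : ℝ)) • x + (t : ℝ) • x') (Fin.castLE (by omega) i) *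
       ((1 - (t : ℝ)) • y + (t : ℝ) • y') i = 0) (p q : RealMilnor r s)
    (hp : ∃ h1 h2 h3, p = mkX hs x y h1 h2 h3) (hq : ∃ h1 h2 h3, q = mkX hs x' y' h1 h2 h3) : Joined p q := by
  obtain ⟨h1, h2, h3, rfl⟩ := hp
  obtain ⟨h1', h2', h3', rfl⟩ := hq
  refine ⟨⟨⟨fun t => mkX hs _ _ (hx t) (hy t) (h t), mkX_cont hs _ _ (by fun_prop) (by fun_prop) _ _ _⟩, ?_, ?_⟩⟩
  · simp
  · simp

lemma sum_seg {m : ℕ} (i j : Fin m) (t : I) :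
    (1 - (t : ℝ)) • (Pi.single i 1 : Fin m → ℝ) + (t : ℝ) • (Pi.single j 1 : Fin m → ℝ) ≠ 0 := by
  intro h
  have : ∑ l, ((1 - (t : ℝ)) • (Pi.single i 1 : Fin m → ℝ) + (t : ℝ) • (Pi.single j 1 : Fin m → ℝ)) l = 1 := by
    simp [Finset.sum_add_distrib, ← Finset.mul_sum]
  rw [h] at this
  simp at this

lemma pt_zero (hs : s ≤ r) (j : Fin (s + 1)) (k : Fin (r + 1)) (hk : k ≠ Fin.castLE (by omega) j) :
    ∃ h1 h2 h3, pt hs j k hk 0 0 = mkX hs (Pi.single k 1) (Pi.single j 1) h1 h2 h3 := by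
  have e1 : Xv hs j k 0 0 = Pi.single k 1 := by
    unfold Xv
    funext i
    by_cases hi : i = Fin.castLE (by omega) j
    · subst hi; simp [hk.symm]
    · rw [Function.update_of_ne hi]; rfl
  have e2 : Yv j 0 = Pi.single j 1 := rfl
  refine ⟨by rw [← e1]; exact Xv_ne hs j k hk 0 0, by rw [← e2]; exact Yv_ne j 0, by rw [← e1, ← e2]; exact XY_dot hs j k 0 0, ?_⟩
  unfold pt
  simp only [e1, e2]

lemma last_ne (hs : s < r) (j : Fin (s + 1)) : Fin.last r ≠ Fin.castLE (by omega) j := by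
  intro h
  have := congrArg Fin.val h
  have h2 := j.2
  simp at this; omega

lemma joined_base (hs : s < r) (j : Fin (s + 1)) (k : Fin (r + 1)) (hk : k ≠ Fin.castLE (by omega) j) :
    Joined (pt hs.le 0 (Fin.last r) (last_ne hs 0) 0 0) (pt hs.le j k hk 0 0) := by
  refine Joined.trans (y := pt hs.le j (Fin.last r) (last_ne hs j) 0 0) ?_ ?_
  · refine joined_aux hs.le (Pi.single (Fin.last r) 1) (Pi.single (Fin.last r) 1) (Pi.single 0 1) (Pi.single j 1)
      (fun t => sum_seg _ _ t) (fun t => sum_seg _ _ t) (fun t => ?_) _ _ (pt_zero _ _ _ _) (pt_zero _ _ _ _)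
    refine Finset.sum_eq_zero fun i _ => ?_
    simp [Pi.single_apply, (last_ne hs i).symm]
  · refine joined_aux hs.le (Pi.single (Fin.last r) 1) (Pi.single k 1) (Pi.single j 1) (Pi.single j 1)
      (fun t => sum_seg _ _ t) (fun t => sum_seg _ _ t) (fun t => ?_) _ _ (pt_zero _ _ _ _) (pt_zero _ _ _ _)
    refine Finset.sum_eq_zero fun i _ => ?_
    by_cases hi : i = j
    · subst hi; simp [(last_ne hs i).symm, hk.symm]
    · simp [Pi.single_apply, hi]

/-- chart lemma -/
lemma chartX (hs : s < r) : ∃ c₀ : RealMilnor r s, ∀ p : RealMilnor r s, ∃ U : Set (RealMilnor r s), IsOpen U ∧ p ∈ U ∧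
    (∃ φ : RealMilnor r s → Fin (r + s - 1) → ℝ, ContinuousOn φ U ∧ Set.InjOn φ U) ∧
    ∃ H : C(U × I, RealMilnor r s), (∀ u, H (u, 0) = c₀) ∧ ∀ u : U, H (u, 1) = u := by
  refine ⟨pt hs.le 0 (Fin.last r) (last_ne hs 0) 0 0, fun p => ?_⟩
  obtain ⟨j, k, hk, hp⟩ := exists_chart hs p
  refine ⟨Uc j k, Uc_open j k, hp, ?_, ?_⟩
  · let e := Fintype.equivFinOfCardEq (Idx_card hs.le j k hk)
    refine ⟨fun q i => phi hs.le j k q (e.symm i), ?_, ?_⟩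
    · exact continuousOn_pi.2 fun i => continuousOn_pi.1 (phi_contOn hs.le j k) _
    · intro q hq q' hq' h
      refine phi_injOn hs.le j k hk hq hq' (funext fun i => ?_)
      simpa using congrFun h (e i)
  · obtain ⟨γ⟩ := joined_base hs j k hk
    let F0 : C(Uc j k, RealMilnor r s) := ContinuousMap.const _ (pt hs.le 0 (Fin.last r) (last_ne hs 0) 0 0)
    let F1 : C(Uc j k, RealMilnor r s) := ContinuousMap.const _ (pt hs.le j k hk 0 0)
    let F2 : C(Uc j k, RealMilnor r s) := ⟨Subtype.val, continuous_subtype_val⟩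
    let H1 : ContinuousMap.Homotopy F0 F1 := 
      { toFun := fun q => γ q.1
        continuous_toFun := by fun_prop
        map_zero_left := by intro x; simp [F0]
        map_one_left := by intro x; simp [F1] }
    have c1 := continuousOn_iff_continuous_domRestrict.1 (nv1_contOn j k)
    have c2 := continuousOn_iff_continuous_domRestrict.1 (nv2_contOn j k)
    let H2 : ContinuousMap.Homotopy F1 F2 := 
      { toFun := fun q => pt hs.le j k hk ((q.1 : ℝ) • nv j q.2.1.1.2) ((q.1 : ℝ) • nv k q.2.1.1.1)
        continuous_toFun := by
          refine pt_cont hs.le j k hk _ _ ?_ ?_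
          · exact (continuous_subtype_val.comp continuous_fst).smul (c2.comp continuous_snd)
          · exact (continuous_subtype_val.comp continuous_fst).smul (c1.comp continuous_snd)
        map_zero_left := by intro x; simp [F1]
        map_one_left := by
          intro x
          simp only [F2, ContinuousMap.coe_mk]
          exact pt_eq hs.le j k hk x.1 x.2 _ _ (fun i _ => by simp) (fun i _ _ => by simp) }
    let H := H1.trans H2
    refine ⟨⟨fun q => H (q.2, q.1), by fun_prop⟩, fun u => ?_, fun u => ?_⟩
    · exact H.map_zero_left u
    · exact H.map_one_left u

end charts
end MG

open scoped unitInterval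

namespace UB

/-- the set of admissible sizes -/
def TCset (G : Type*) [Group G] (X : Type*) [TopologicalSpace X] [MulAction G X] (n : ℕ) : Set ℕ :=
  {k | 0 < k ∧ ∃ U : Fin k → Set (Fin n → X),
    (∀ i, IsOpen (U i)) ∧ (⋃ i, U i) = Set.univ ∧
    (∀ i (g : G), ∀ v ∈ U i, g • v ∈ U i) ∧
    ∀ i, ∃ sec : C(U i, C(I, X)),
      (∀ (g : G) (v : U i) (hgv : g • (v : Fin n → X) ∈ U i) (t : I),
        (sec ⟨g • (v : Fin n → X), hgv⟩) t = g • (sec v) t) ∧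
      ∃ H : C(U i × I, Fin n → X),
        (∀ v : U i, H (v, 0) = tcPi X n (sec v)) ∧
        (∀ v : U i, H (v, 1) = (v : Fin n → X)) ∧
        (∀ (g : G) (v : U i) (hgv : g • (v : Fin n → X) ∈ U i) (t : I),
          H (⟨g • (v : Fin n → X), hgv⟩, t) = g • H (v, t))}

lemma eqHigherTC_eq (G : Type*) [Group G] (X : Type*) [TopologicalSpace X] [MulAction G X] (n : ℕ) :
    eqHigherTC G X n = sInf (TCset G X n) := rfl

abbrev g0 : Multiplicative (ZMod 2) := Multiplicative.ofAdd 1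

lemma g_cases (g : Multiplicative (ZMod 2)) : g = 1 ∨ g = g0 := by
  revert g; decide

lemma g0_mul : g0 * g0 = 1 := by decide

lemma g0_ne : g0 ≠ 1 := by decide

section
variable {X : Type*} [TopologicalSpace X]

/-- chart property with total functions -/
def Charted (X : Type*) [TopologicalSpace X] (D : ℕ) (c₀ : X) : Prop :=
  ∀ p : X, ∃ U : Set X, IsOpen U ∧ p ∈ U ∧
    (∃ φ : X → Fin D → ℝ, ContinuousOn φ U ∧ Set.InjOn φ U) ∧
    ∃ h : X → I → X, ContinuousOn (fun q : X × I => h q.1 q.2) (U ×ˢ Set.univ) ∧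
      (∀ u ∈ U, h u 0 = c₀) ∧ ∀ u ∈ U, h u 1 = u

open Classical in
lemma charted_milnor {r s : ℕ} (hs : s < r) : ∃ c₀, Charted (RealMilnor r s) (r + s - 1) c₀ := by
  obtain ⟨c₀, hc⟩ := MG.chartX hs
  refine ⟨c₀, fun p => ?_⟩
  obtain ⟨U, hU, hp, hφ, H, H0, H1⟩ := hc p
  refine ⟨U, hU, hp, hφ, fun q t => if hq : q ∈ U then H (⟨q, hq⟩, t) else q, ?_, ?_, ?_⟩
  · rw [continuousOn_iff_continuous_domRestrict]
    have : Continuous (fun q : (U ×ˢ (Set.univ : Set I) : Set (RealMilnor r s × I)) =>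
        H (⟨q.1.1, q.2.1⟩, q.1.2)) := by fun_prop
    refine this.congr fun q => ?_
    have : q.1.1 ∈ U := q.2.1
    simp [Set.domRestrict, this]
  · intro u hu
    simp [hu, H0]
  · intro u hu
    simp [hu, H1]

lemma charted_pi {D : ℕ} {c₀ : X} (h : Charted X D c₀) (n : ℕ) :
    Charted (Fin n → X) (n * D) (fun _ => c₀) := by
  intro z
  choose U hU hz hφ0 η hη1 hη2 hη3 using fun i => h (z i)
  choose φ hφi using hφ0
  refine ⟨Set.univ.pi U, isOpen_set_pi Set.finite_univ fun i _ => hU i, fun i _ => hz i, ?_, ?_⟩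
  · refine ⟨fun w q => φ (finProdFinEquiv.symm q).1 (w (finProdFinEquiv.symm q).1) (finProdFinEquiv.symm q).2, ?_, ?_⟩
    · refine continuousOn_pi.2 fun q => ?_
      refine ContinuousOn.comp (t := U (finProdFinEquiv.symm q).1) (continuousOn_pi.1 (hφi (finProdFinEquiv.symm q).1).1 _) (continuous_apply _).continuousOn ?_
      exact fun w hw => hw _ (Set.mem_univ _)
    · intro w hw w' hw' he
      funext i
      refine (hφi i).2 (hw i (Set.mem_univ i)) (hw' i (Set.mem_univ i)) (funext fun d => ?_)
      simpa using congrFun he (finProdFinEquiv (i, d))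
  · refine ⟨fun w t i => η i (w i) t, ?_, ?_, ?_⟩
    · refine continuousOn_pi.2 fun i => ?_
      refine ContinuousOn.comp (t := U i ×ˢ Set.univ) (hη1 i) (f := fun q : (Fin n → X) × I => (q.1 i, q.2)) (by fun_prop) ?_
      exact fun q hq => ⟨hq.1 i (Set.mem_univ i), Set.mem_univ _⟩
    · intro u hu
      funext i
      exact hη2 i _ (hu i (Set.mem_univ i))
    · intro u hu
      funext i
      exact hη3 i _ (hu i (Set.mem_univ i))

open Classical in
theorem upper [CompactSpace X] [T2Space X] [MulAction (Multiplicative (ZMod 2)) X]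
    [ContinuousSMul (Multiplicative (ZMod 2)) X]
    (hfree : ∀ (g : Multiplicative (ZMod 2)) (x : X), g • x = x → g = 1)
    {D : ℕ} {c₀ : X} (hch : Charted X D c₀) (n : ℕ) (hn : 0 < n) :
    n * D + 1 ∈ TCset (Multiplicative (ZMod 2)) X n := by
  have hgc : Continuous (fun z : Fin n → X => g0 • z) := continuous_const_smul g0
  have hgg : ∀ z : Fin n → X, g0 • g0 • z = z := fun z => by rw [smul_smul, g0_mul, one_smul]
  have hfree' : ∀ z : Fin n → X, g0 • z ≠ z := fun z h =>
    g0_ne (hfree g0 (z ⟨0, hn⟩) (congrFun h ⟨0, hn⟩))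
  have loc : ∀ z : Fin n → X, ∃ K : Set (Fin n → X), K ∈ nhds z ∧ IsClosed K ∧ (∀ w ∈ K, g0 • w ∉ K) ∧
    (∃ φ : (Fin n → X) → Fin (n * D) → ℝ, ContinuousOn φ K ∧ Set.InjOn φ K) ∧
    ∃ h : (Fin n → X) → I → (Fin n → X), ContinuousOn (fun q : (Fin n → X) × I => h q.1 q.2) (K ×ˢ Set.univ) ∧
      (∀ u ∈ K, h u 0 = fun _ => c₀) ∧ ∀ u ∈ K, h u 1 = u := by
    intro z
    obtain ⟨U, hU, hz, ⟨φ, hφ1, hφ2⟩, h, h1, h2, h3⟩ := charted_pi hch n z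
    obtain ⟨A, B, hA, hB, hzA, hzB, hAB⟩ := t2_separation (hfree' z).symm
    have hN : U ∩ (A ∩ (fun z : Fin n → X => g0 • z) ⁻¹' B) ∈ nhds z :=
      (hU.inter (hA.inter (hB.preimage hgc))).mem_nhds ⟨hz, hzA, hzB⟩
    obtain ⟨K, hK, hKc, hKU⟩ := exists_mem_nhds_isClosed_subset hN
    have hKU' : K ⊆ U := fun w hw => (hKU hw).1
    refine ⟨K, hK, hKc, fun w hw hw' => ?_, ⟨φ, hφ1.mono hKU', hφ2.mono hKU'⟩, h,
      h1.mono (Set.prod_mono hKU' subset_rfl), fun u hu => h2 u (hKU' hu), fun u hu => h3 u (hKU' hu)⟩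
    exact Set.disjoint_left.1 hAB (hKU hw').2.1 (hKU hw).2.2
  choose K hKn hKc hKd hφ0 h hh1 hh2 hh3 using loc
  choose φ hφ using hφ0
  obtain ⟨T, -, hT⟩ := isCompact_univ.elim_nhds_subcover (fun z => interior (K z)) (fun z _ => interior_mem_nhds.2 (hKn z))
  have hcov : ∀ z, ∃ a : T, z ∈ interior (K a.1) := by
    intro z
    obtain ⟨a, ha, hz⟩ := Set.mem_iUnion₂.1 (hT (Set.mem_univ z))
    exact ⟨⟨a, ha⟩, hz⟩
  have hne : Nonempty T := by
    obtain ⟨a, -⟩ := hcov (fun _ => c₀)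
    exact ⟨a⟩
  obtain ⟨P, c, hPo, hPO, hPd, hPg, hPc⟩ := cover_thm (D := n * D) (fun z : Fin n → X => g0 • z) hgc hgg
    (fun a : T => interior (K a.1)) (fun a => K a.1) (fun a => isOpen_interior) (fun a => hKc _)
    (fun a => interior_subset) hcov (fun a => φ a.1) (fun a => (hφ a.1).1) (fun a => (hφ a.1).2)
    (fun a => hKd a.1)
  refine ⟨Nat.succ_pos _, fun k => {z | ∃ S, z ∈ P k S ∨ g0 • z ∈ P k S}, ?_, ?_, ?_, ?_⟩
  · intro k
    have : {z | ∃ S, z ∈ P k S ∨ g0 • z ∈ P k S} = ⋃ S, (P k S ∪ (fun z : Fin n → X => g0 • z) ⁻¹' (P k S)) := by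
      ext z; simp
    beta_reduce
    rw [this]
    exact isOpen_iUnion fun S => (hPo k S).union ((hPo k S).preimage hgc)
  · rw [Set.eq_univ_iff_forall]
    intro z
    obtain ⟨k, hk⟩ := hPc z
    exact Set.mem_iUnion.2 ⟨k, hk⟩
  · rintro k g v ⟨S, hv⟩
    rcases g_cases g with rfl | rfl
    · rw [one_smul]; exact ⟨S, hv⟩
    · refine ⟨S, ?_⟩
      rw [hgg]; exact hv.symm
  intro k
  set A : Set (Fin n → X) := {z | ∃ S, z ∈ P k S} with hA
  have hAo : IsOpen A := by
    have : A = ⋃ S, P k S := by ext z; simp [hA]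
    rw [this]; exact isOpen_iUnion fun S => hPo k S
  have hAg : ∀ z, z ∈ A → g0 • z ∉ A := by
    rintro z ⟨S, hS⟩ ⟨S', hS'⟩
    exact hPg k S S' z hS hS'
  have hUA : ∀ z, (∃ S, z ∈ P k S ∨ g0 • z ∈ P k S) → z ∈ A ∨ g0 • z ∈ A := by
    rintro z ⟨S, hS | hS⟩
    · exact Or.inl ⟨S, hS⟩
    · exact Or.inr ⟨S, hS⟩
  -- section
  let f : (Fin n → X) → X := fun z => if z ∈ A then c₀ else g0 • c₀
  have hf1 : ∀ z ∈ A, f z = c₀ := fun z hz => if_pos hz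
  have hf2 : ∀ z, g0 • z ∈ A → f z = g0 • c₀ := fun z hz => if_neg fun h => hAg z h hz
  have hfc : ∀ z, z ∈ A ∨ g0 • z ∈ A → ContinuousAt f z := by
    rintro z (hz | hz)
    · refine continuousAt_const.congr (f := fun _ => c₀) ?_
      filter_upwards [hAo.mem_nhds hz] with w hw
      exact (hf1 w hw).symm
    · refine continuousAt_const.congr (f := fun _ => g0 • c₀) ?_
      filter_upwards [(hAo.preimage hgc).mem_nhds hz] with w hw
      exact (hf2 w hw).symm
  -- homotopy
  let Sof : (Fin n → X) → Finset T := fun z => if h : ∃ S, z ∈ P k S then h.choose else ∅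
  have hSof : ∀ z S, z ∈ P k S → Sof z = S := by
    intro z S hz
    have hex : ∃ S, z ∈ P k S := ⟨S, hz⟩
    simp only [Sof, dif_pos hex]
    exact hPd k _ _ z hex.choose_spec hz
  let HH : (Fin n → X) → I → (Fin n → X) := fun z t => h (c (Sof z)).1 z t
  have hHHc : ∀ z t, z ∈ A → ContinuousAt (fun q : (Fin n → X) × I => HH q.1 q.2) (z, t) := by
    rintro z t ⟨S, hS⟩
    have : ContinuousAt (fun q : (Fin n → X) × I => h (c S).1 q.1 q.2) (z, t) := by
      refine (hh1 (c S).1).continuousAt ?_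
      rw [nhds_prod_eq]
      exact Filter.prod_mem_prod (Filter.mem_of_superset (isOpen_interior.mem_nhds (hPO k S hS)) interior_subset) Filter.univ_mem
    refine this.congr ?_
    have hmem : {q : (Fin n → X) × I | q.1 ∈ P k S} ∈ nhds (z, t) :=
      ((hPo k S).preimage continuous_fst).mem_nhds hS
    filter_upwards [hmem] with q hq
    simp only [HH]
    rw [hSof q.1 S hq]
  have hHH0 : ∀ z ∈ A, HH z 0 = fun _ => c₀ := by
    rintro z ⟨S, hS⟩
    simp only [HH, hSof z S hS]
    exact hh2 _ _ (interior_subset (hPO k S hS))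
  have hHH1 : ∀ z ∈ A, HH z 1 = z := by
    rintro z ⟨S, hS⟩
    simp only [HH, hSof z S hS]
    exact hh3 _ _ (interior_subset (hPO k S hS))
  let H : (Fin n → X) → I → (Fin n → X) := fun z t => if z ∈ A then HH z t else g0 • HH (g0 • z) t
  have hH1 : ∀ z ∈ A, ∀ t, H z t = HH z t := fun z hz t => if_pos hz
  have hH2 : ∀ z, g0 • z ∈ A → ∀ t, H z t = g0 • HH (g0 • z) t := fun z hz t => if_neg fun h => hAg z h hz
  have hHc : ∀ z t, z ∈ A ∨ g0 • z ∈ A → ContinuousAt (fun q : (Fin n → X) × I => H q.1 q.2) (z, t) := by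
    rintro z t (hz | hz)
    · refine (hHHc z t hz).congr ?_
      have hmem : {q : (Fin n → X) × I | q.1 ∈ A} ∈ nhds (z, t) :=
        (hAo.preimage continuous_fst).mem_nhds hz
      filter_upwards [hmem] with q hq
      exact (hH1 _ hq _).symm
    · have h1 : ContinuousAt (fun q : (Fin n → X) × I => g0 • HH (g0 • q.1) q.2) (z, t) := by
        refine hgc.continuousAt.comp ?_
        exact ContinuousAt.comp (g := fun q : (Fin n → X) × I => HH q.1 q.2)
          (f := fun q : (Fin n → X) × I => (g0 • q.1, q.2)) (hHHc _ t hz)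
          ((hgc.comp continuous_fst).prodMk continuous_snd).continuousAt
      refine h1.congr ?_
      have hmem : {q : (Fin n → X) × I | g0 • q.1 ∈ A} ∈ nhds (z, t) :=
        (hAo.preimage (hgc.comp continuous_fst)).mem_nhds hz
      filter_upwards [hmem] with q hq
      exact (hH2 _ hq _).symm
  refine ⟨⟨fun u => ContinuousMap.const I (f u.1), ?_⟩, ?_, ⟨fun q => H q.1.1 q.2, ?_⟩, ?_, ?_, ?_⟩
  · refine ContinuousMap.continuous_const'.comp ?_
    exact continuous_iff_continuousAt.2 fun u => (hfc u.1 (hUA _ u.2)).comp continuous_subtype_val.continuousAt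
  · intro g v hgv t
    rcases g_cases g with rfl | rfl
    · simp
    · simp only [ContinuousMap.coe_mk, ContinuousMap.const_apply]
      rcases hUA _ v.2 with hz | hz
      · rw [hf1 _ hz, hf2 _ (by rwa [hgg])]
      · rw [hf1 _ hz, hf2 _ hz, smul_smul, g0_mul, one_smul]
  · refine continuous_iff_continuousAt.2 fun u => ?_
    exact ContinuousAt.comp (g := fun q : (Fin n → X) × I => H q.1 q.2)
      (f := fun u : {z | ∃ S, z ∈ P k S ∨ g0 • z ∈ P k S} × I => (u.1.1, u.2)) (hHc u.1.1 u.2 (hUA _ u.1.2))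
      (by fun_prop)
  · intro v
    simp only [ContinuousMap.coe_mk]
    rcases hUA _ v.2 with hz | hz
    · rw [hH1 _ hz, hHH0 _ hz]
      funext i
      simp [tcPi, hf1 _ hz]
    · rw [hH2 _ hz, hHH0 _ hz]
      funext i
      simp [tcPi, hf2 _ hz]
  · intro v
    simp only [ContinuousMap.coe_mk]
    rcases hUA _ v.2 with hz | hz
    · rw [hH1 _ hz, hHH1 _ hz]
    · rw [hH2 _ hz, hHH1 _ hz, hgg]
  · intro g v hgv t
    rcases g_cases g with rfl | rfl
    · simp
    · simp only [ContinuousMap.coe_mk]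
      rcases hUA _ v.2 with hz | hz
      · rw [hH1 _ hz, hH2 _ (by rwa [hgg]), hgg]
      · rw [hH1 _ hz, hH2 _ hz, hgg]

end
end UB

open scoped unitInterval

namespace LB
open MG

section sign
variable {m : ℕ}

noncomputable def cc (p q : Projectivization ℝ (Fin m → ℝ)) : ℝ := ∑ i, ∑ j, E i j p * E i j q

lemma cc_cont : Continuous (fun q : Projectivization ℝ (Fin m → ℝ) × Projectivization ℝ (Fin m → ℝ) => cc q.1 q.2) := by
  unfold cc
  refine continuous_finsetSum _ fun i _ => continuous_finsetSum _ fun j _ => ?_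
  exact ((E_cont i j).comp continuous_fst).mul ((E_cont i j).comp continuous_snd)

lemma cc_mk {v w : Fin m → ℝ} (hv : v ≠ 0) (hw : w ≠ 0) (hv1 : ∑ l, v l ^ 2 = 1) (hw1 : ∑ l, w l ^ 2 = 1) :
    cc (Projectivization.mk ℝ v hv) (Projectivization.mk ℝ w hw) = (∑ i, v i * w i) ^ 2 := by
  unfold cc
  simp only [E_mk, hv1, hw1, div_one]
  rw [sq, Finset.sum_mul_sum]
  refine Finset.sum_congr rfl fun i _ => Finset.sum_congr rfl fun j _ => ?_
  ring

lemma cc_self (p : Projectivization ℝ (Fin m → ℝ)) : 0 < cc p p := by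
  obtain ⟨v, hv, rfl, h1⟩ := exists_unit p
  rw [cc_mk hv hv h1 h1]
  have : ∑ i, v i * v i = 1 := by rw [← h1]; exact Finset.sum_congr rfl fun i _ => by ring
  rw [this]; norm_num

lemma unif_step {C : Type*} [TopologicalSpace C] [CompactSpace C] (G : C(I × C, Projectivization ℝ (Fin m → ℝ))) :
    ∃ δ > 0, ∀ t t' : I, dist t t' < δ → ∀ u, 0 < cc (G (t, u)) (G (t', u)) := by
  set B : Set (I × I × C) := {x | cc (G (x.1, x.2.2)) (G (x.2.1, x.2.2)) ≤ 0} with hB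
  have hBc : IsClosed B := by
    have hA : Continuous (fun x : I × I × C => G (x.1, x.2.2)) :=
      G.continuous.comp (continuous_fst.prodMk (continuous_snd.comp continuous_snd))
    have hA' : Continuous (fun x : I × I × C => G (x.2.1, x.2.2)) :=
      G.continuous.comp continuous_snd
    have hcc : Continuous (fun x : I × I × C => cc (G (x.1, x.2.2)) (G (x.2.1, x.2.2))) := by
      unfold cc
      refine continuous_finsetSum _ fun i _ => continuous_finsetSum _ fun j _ => ?_
      exact ((E_cont i j).comp hA).mul ((E_cont i j).comp hA')
    rw [hB]
    exact isClosed_le hcc continuous_const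
  rcases B.eq_empty_or_nonempty with h | h
  · refine ⟨1, one_pos, fun t t' _ u => ?_⟩
    by_contra hc
    have : (t, t', u) ∈ B := not_lt.1 hc
    rw [h] at this
    exact this
  · obtain ⟨x, hx, hmin⟩ := hBc.isCompact.exists_isMinOn h (f := fun x : I × I × C => dist x.1 x.2.1) (by fun_prop)
    refine ⟨dist x.1 x.2.1, ?_, fun t t' ht u => ?_⟩
    · rw [gt_iff_lt, dist_pos]
      intro he
      have h1 : cc (G (x.1, x.2.2)) (G (x.2.1, x.2.2)) ≤ 0 := hx
      rw [← he] at h1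
      exact absurd (cc_self (G (x.1, x.2.2))) (not_lt.2 h1)
    · by_contra hc
      have hmem : (t, t', u) ∈ B := not_lt.1 hc
      exact absurd ht (not_lt.2 (hmin hmem))

noncomputable def tau (N k : ℕ) : I := Set.projIcc (0 : ℝ) 1 zero_le_one ((k : ℝ) / N)

lemma tau_zero (N : ℕ) : tau N 0 = 0 := by
  simp [tau]

lemma tau_one (N : ℕ) (hN : 0 < N) : tau N N = 1 := by
  have : (N : ℝ) ≠ 0 := by positivity
  simp [tau, div_self this]

lemma tau_coe (N k : ℕ) (hN : 0 < N) (hk : k ≤ N) : (tau N k : ℝ) = k / N := by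
  unfold tau
  rw [Set.projIcc_of_mem]
  constructor
  · positivity
  · rw [div_le_one (by positivity)]; exact_mod_cast hk

lemma tau_dist (N k : ℕ) (hN : 0 < N) (hk : k + 1 ≤ N) : dist (tau N k) (tau N (k + 1)) = 1 / N := by
  rw [Subtype.dist_eq, Real.dist_eq, tau_coe N k hN (by omega), tau_coe N _ hN hk]
  have : (k : ℝ) / N - ((k + 1 : ℕ) : ℝ) / N = - (1 / N) := by push_cast; ring
  rw [this, abs_neg, abs_of_nonneg (by positivity)]

/-- iterated projection -/
noncomputable def wv (M : ℕ → Fin m → Fin m → ℝ) (x : Fin m → ℝ) : ℕ → Fin m → ℝ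
  | 0 => x
  | k + 1 => fun i => ∑ j, M (k + 1) i j * wv M x k j

lemma wv_smul (M : ℕ → Fin m → Fin m → ℝ) (e : ℝ) (x : Fin m → ℝ) (k : ℕ) :
    wv M (e • x) k = e • wv M x k := by
  induction k with
  | zero => rfl
  | succ k ih =>
    funext i
    simp only [wv, ih, Pi.smul_apply, smul_eq_mul, Finset.mul_sum]
    exact Finset.sum_congr rfl fun j _ => by ring

lemma wv_form (p : ℕ → Projectivization ℝ (Fin m → ℝ)) (N : ℕ) (hp : ∀ k, k + 1 ≤ N → 0 < cc (p k) (p (k + 1)))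
    (x : Fin m → ℝ) (hx : x ≠ 0) (hx1 : ∑ l, x l ^ 2 = 1) (hp0 : p 0 = Projectivization.mk ℝ x hx) (k : ℕ) (hk : k ≤ N) :
    ∃ v, ∃ hv : v ≠ 0, ∃ c : ℝ, c ≠ 0 ∧ ∑ l, v l ^ 2 = 1 ∧ p k = Projectivization.mk ℝ v hv ∧
      wv (fun k i j => E i j (p k)) x k = c • v := by
  induction k with
  | zero => exact ⟨x, hx, 1, one_ne_zero, hx1, hp0, by simp [wv]⟩
  | succ k ih =>
    obtain ⟨v, hv, c, hc, hv1, hpk, hw⟩ := ih (by omega)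
    obtain ⟨v', hv', hpk', hv1'⟩ := exists_unit (p (k + 1))
    have h1 := hp k hk
    rw [hpk, hpk', cc_mk hv hv' hv1 hv1'] at h1
    have h2 : ∑ i, v i * v' i ≠ 0 := fun h => by rw [h] at h1; simp at h1
    refine ⟨v', hv', c * ∑ i, v i * v' i, mul_ne_zero hc h2, hv1', hpk', ?_⟩
    funext i
    simp only [wv, hw, Pi.smul_apply, smul_eq_mul, hpk', E_mk, hv1', div_one]
    rw [Finset.mul_sum, Finset.sum_mul]
    exact Finset.sum_congr rfl fun j _ => by ring

open Classical in
theorem signfun {Y : Type*} [TopologicalSpace Y] [CompactSpace Y] (U : Set Y) (hU : IsOpen U)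
    (G : C(I × U, Projectivization ℝ (Fin m → ℝ))) (φ : Y → ℝ) (hφ : Continuous φ) (hφU : tsupport φ ⊆ U)
    {Zt : Type*} [TopologicalSpace Zt] (q : Zt → Y) (hq : Continuous q) (x0 x1 : Zt → Fin m → ℝ)
    (hx0c : Continuous x0) (hx1c : Continuous x1) (hx0 : ∀ z, ∑ l, x0 z l ^ 2 = 1) (hx1 : ∀ z, ∑ l, x1 z l ^ 2 = 1)
    (hG0 : ∀ z (h : q z ∈ U), G (0, ⟨q z, h⟩) = Projectivization.mk ℝ (x0 z) (ne_of_sq (hx0 z)))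
    (hG1 : ∀ z (h : q z ∈ U), G (1, ⟨q z, h⟩) = Projectivization.mk ℝ (x1 z) (ne_of_sq (hx1 z))) :
    ∃ f : Zt → ℝ, Continuous f ∧ (∀ z, f z = 0 → φ (q z) = 0) ∧
      ∀ z z' (e0 e1 : ℝ), q z' = q z → x0 z' = e0 • x0 z → x1 z' = e1 • x1 z → f z' = e0 * e1 * f z := by
  have : CompactSpace (tsupport φ) := isCompact_iff_compactSpace.1 (isClosed_tsupport φ).isCompact
  obtain ⟨δ, hδ, hstep⟩ := unif_step (G.comp ⟨fun x : I × tsupport φ => (x.1, (⟨x.2.1, hφU x.2.2⟩ : U)), by fun_prop⟩)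
  obtain ⟨N, hN⟩ := exists_nat_one_div_lt hδ
  let M : Y → ℕ → Fin m → Fin m → ℝ := fun y k i j => if h : y ∈ U then E i j (G (tau (N + 1) k, ⟨y, h⟩)) else 0
  have hMc : ∀ y ∈ U, ∀ k i j, ContinuousAt (fun y => M y k i j) y := by
    intro y hy k i j
    have : ContinuousOn (fun y => M y k i j) U := by
      rw [continuousOn_iff_continuous_domRestrict]
      have hc : Continuous (fun u : U => E i j (G (tau (N + 1) k, u))) := (E_cont i j).comp (by fun_prop)
      refine hc.congr fun u => ?_
      have := u.2
      simp [M, Set.domRestrict, this]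
    exact this.continuousAt (hU.mem_nhds hy)
  have hwc : ∀ k i z, q z ∈ U → ContinuousAt (fun z => wv (M (q z)) (x0 z) k i) z := by
    intro k
    induction k with
    | zero => exact fun i z _ => (continuous_pi_iff.1 hx0c i).continuousAt
    | succ k ih =>
      intro i z hz
      simp only [wv]
      refine tendsto_finsetSum _ fun j _ => ?_
      exact (((hMc _ hz (k + 1) i j).comp hq.continuousAt).mul (ih j z hz) : _)
  refine ⟨fun z => φ (q z) * ∑ i, wv (M (q z)) (x0 z) (N + 1) i * x1 z i, ?_, ?_, ?_⟩
  · refine continuous_of_tsupport fun z hz => ?_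
    have hzt : q z ∈ tsupport φ := by
      have h1 : tsupport (fun z => φ (q z) * ∑ i, wv (M (q z)) (x0 z) (N + 1) i * x1 z i) ⊆ tsupport (φ ∘ q) :=
        tsupport_mul_subset_left
      exact (tsupport_comp_subset_preimage φ hq) (h1 hz)
    refine (hφ.comp hq).continuousAt.mul ?_
    refine tendsto_finsetSum _ fun i _ => ?_
    exact ((hwc (N + 1) i z (hφU hzt)).mul (continuous_pi_iff.1 hx1c i).continuousAt : _)
  · intro z hz
    by_contra hne
    have hzt : q z ∈ tsupport φ := subset_tsupport _ hne
    have hzU := hφU hzt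
    have hsum := (mul_eq_zero.1 hz).resolve_left hne
    have hMe : M (q z) = fun k i j => E i j (G (tau (N + 1) k, ⟨q z, hzU⟩)) := by
      funext k i j
      simp [M, hzU]
    rw [hMe] at hsum
    obtain ⟨v, hv, c, hc, hv1, hpN, hw⟩ := wv_form (fun k => G (tau (N + 1) k, ⟨q z, hzU⟩)) (N + 1)
      (fun k hk => by
        have := hstep (tau (N + 1) k) (tau (N + 1) (k + 1)) (by
          rw [tau_dist _ _ (Nat.succ_pos N) hk]; push_cast; exact hN) ⟨q z, hzt⟩
        exact this) (x0 z) (ne_of_sq (hx0 z)) (hx0 z) (by rw [tau_zero, hG0]) (N + 1) le_rfl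
    rw [hw] at hsum
    rw [tau_one _ (Nat.succ_pos N), hG1, Projectivization.mk_eq_mk_iff'] at hpN
    obtain ⟨a, ha⟩ := hpN
    have : ∑ i, (c • v) i * x1 z i = c * a := by
      rw [← ha]
      simp only [Pi.smul_apply, smul_eq_mul]
      calc _ = ∑ i, c * a * v i ^ 2 := Finset.sum_congr rfl fun i _ => by ring
        _ = _ := by rw [← Finset.mul_sum, hv1, mul_one]
    rw [this] at hsum
    have ha0 : a = 0 := (mul_eq_zero.1 hsum).resolve_left hc
    rw [ha0, zero_smul] at ha
    exact ne_of_sq (hx1 z) ha.symm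
  · intro z z' e0 e1 h h0 h1
    beta_reduce
    rw [h, h0, h1, wv_smul]
    simp only [Pi.smul_apply, smul_eq_mul, Finset.mul_sum]
    exact Finset.sum_congr rfl fun i _ => by ring

end sign

section avg
variable {ι : Type*} [Fintype ι] [DecidableEq ι] {V : ι → Type*} [∀ i, AddCommGroup (V i)]
  [∀ i, TopologicalSpace (V i)] [∀ i, IsTopologicalAddGroup (V i)] [NormalSpace (∀ i, V i)]

def flip (i : ι) (z : ∀ i, V i) : ∀ i, V i := Function.update z i (-(z i))

lemma flip_cont (i : ι) : Continuous (flip i : (∀ i, V i) → ∀ i, V i) :=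
  continuous_id.update i ((continuous_apply i).neg)

lemma flip_flip (i : ι) (z : ∀ i, V i) : flip i (flip i z) = z := by
  simp [flip]

lemma flip_comm (i j : ι) (z : ∀ i, V i) : flip i (flip j z) = flip j (flip i z) := by
  by_cases h : i = j
  · rw [h]
  · simp only [flip]
    rw [Function.update_of_ne h, Function.update_of_ne (Ne.symm h), Function.update_comm h]

lemma avg (Zs : Set (∀ i, V i)) (hZ : IsClosed Zs) (hinv : ∀ i, ∀ z ∈ Zs, flip i z ∈ Zs)
    (sg : ι → ℝ) (hsg : ∀ i, sg i * sg i = 1) (f : Zs → ℝ) (hf : Continuous f)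
    (hff : ∀ i (z : Zs), f ⟨flip i z.1, hinv i z.1 z.2⟩ = sg i * f z) :
    ∃ F : (∀ i, V i) → ℝ, Continuous F ∧ (∀ z : Zs, F z.1 = f z) ∧ ∀ i z, F (flip i z) = sg i * F z := by
  have key : ∀ T : Finset ι, ∃ F : (∀ i, V i) → ℝ, Continuous F ∧ (∀ z : Zs, F z.1 = f z) ∧
      ∀ i ∈ T, ∀ z, F (flip i z) = sg i * F z := by
    intro T
    induction T using Finset.induction_on with
    | empty =>
      obtain ⟨F, hF⟩ := ContinuousMap.exists_restrict_eq hZ (⟨f, hf⟩ : C(Zs, ℝ))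
      refine ⟨F, F.continuous, fun z => ?_, by simp⟩
      have := congrArg (fun g : C(Zs, ℝ) => g z) hF
      simpa using this
    | insert i T hi ih =>
      obtain ⟨F, h1, h2, h3⟩ := ih
      refine ⟨fun z => (F z + sg i * F (flip i z)) / 2, ?_, ?_, ?_⟩
      · have := h1.comp (flip_cont i)
        exact (h1.add (continuous_const.mul this)).div_const 2
      · intro z
        have e := h2 ⟨flip i z.1, hinv i z.1 z.2⟩
        simp only at e
        beta_reduce
        rw [h2 z, e, hff, ← mul_assoc, hsg]
        ring
      · intro j hj z
        rw [Finset.mem_insert] at hj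
        rcases hj with rfl | hj
        · simp only [flip_flip]
          linear_combination (- F (flip j z)) / 2 * hsg j
        · simp only [flip_comm i j, h3 j hj]
          ring
  obtain ⟨F, h1, h2, h3⟩ := key Finset.univ
  exact ⟨F, h1, h2, fun i => h3 i (Finset.mem_univ i)⟩

end avg

section homot
variable {X : Type*} [TopologicalSpace X] {n : ℕ}

def evU (U : Set (Fin n → X)) (i : Fin n) : C(U, X) := ⟨fun u => u.1 i, (continuous_apply i).comp continuous_subtype_val⟩

lemma ev_homotopic (U : Set (Fin n → X)) (sec : C(U, C(I, X))) (H : C(U × I, Fin n → X))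
    (h0 : ∀ v : U, H (v, 0) = tcPi X n (sec v)) (h1 : ∀ v : U, H (v, 1) = (v : Fin n → X)) (i b : Fin n) :
    ContinuousMap.Homotopic (evU U i) (evU U b) := by
  let tt : Fin n → I := fun i => Set.projIcc (0 : ℝ) 1 zero_le_one ((i : ℝ) / ((n : ℝ) - 1))
  let T : Fin n → C(U, X) := fun i => ⟨fun u => sec u (tt i), by fun_prop⟩
  have a1 : ∀ i, ContinuousMap.Homotopic (T i) (evU U i) := fun i =>
    ⟨{ toFun := fun q => H (q.2, q.1) i
       continuous_toFun := by fun_prop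
       map_zero_left := fun u => by simp only [h0]; rfl
       map_one_left := fun u => by simp only [h1]; rfl }⟩
  have z2 : ∀ i, ContinuousMap.Homotopic (⟨fun u => sec u 0, by fun_prop⟩ : C(U, X)) (T i) := fun i =>
    ⟨{ toFun := fun q => sec q.2 (q.1 * tt i)
       continuous_toFun := by fun_prop
       map_zero_left := fun u => by simp
       map_one_left := fun u => by simp [T] }⟩
  exact (a1 i).symm.trans ((z2 i).symm.trans ((z2 b).trans (a1 b)))

end homot

end LB

open scoped unitInterval

namespace LB
open MG BUP

section ext

def extv {a m : ℕ} (v : Fin a → ℝ) : Fin m → ℝ := fun l => if h : l.1 < a then v ⟨l.1, h⟩ else 0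

lemma extv_sq {a m : ℕ} (h : a ≤ m) (v : Fin a → ℝ) : ∑ l, (extv v : Fin m → ℝ) l ^ 2 = ∑ l, v l ^ 2 := by
  obtain ⟨k, rfl⟩ := Nat.exists_eq_add_of_le h
  rw [Fin.sum_univ_add]
  simp [extv]

lemma extv_cont {a m : ℕ} : Continuous (extv : (Fin a → ℝ) → Fin m → ℝ) := by
  refine continuous_pi fun l => ?_
  unfold extv
  by_cases h : l.1 < a
  · simp only [h, dif_pos]; exact continuous_apply _
  · simp only [h]; exact continuous_const

lemma extv_neg {a m : ℕ} (v : Fin a → ℝ) : (extv (-v) : Fin m → ℝ) = - extv v := by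
  funext l
  unfold extv
  by_cases h : l.1 < a <;> simp [h]

end ext

section main
variable {n : ℕ} (b : Fin n) (A B r s : ℕ)

abbrev Om := ∀ q : Fin n ⊕ Fin n, Fin (dM b A B q + 1) → ℝ

noncomputable def cv (m : ℕ) (q : Fin n ⊕ Fin n) (z : Om b A B) : Fin m → ℝ := extv (z q)

lemma cv_cont (m : ℕ) (q : Fin n ⊕ Fin n) : Continuous (cv b A B m q) :=
  extv_cont.comp (continuous_apply q)

lemma cv_flip (m : ℕ) (q q' : Fin n ⊕ Fin n) (z : Om b A B) :
    cv b A B m q (flip q' z) = (if q' = q then (-1 : ℝ) else 1) • cv b A B m q z := by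
  unfold cv flip
  by_cases h : q' = q
  · subst h
    simp [extv_neg]
  · simp [h, Function.update_of_ne (Ne.symm h)]

lemma cv_sq (m : ℕ) (q : Fin n ⊕ Fin n) (h : dM b A B q + 1 ≤ m) (z : Om b A B) :
    ∑ l, cv b A B m q z l ^ 2 = ∑ l, z q l ^ 2 := extv_sq h _

lemma sq_flip (q q' : Fin n ⊕ Fin n) (z : Om b A B) :
    ∑ l, (flip q' z) q l ^ 2 = ∑ l, z q l ^ 2 := by
  unfold flip
  by_cases h : q' = q
  · subst h
    simp
  · simp [Function.update_of_ne (Ne.symm h)]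

variable {r s}

noncomputable def bet (hs : s ≤ r) (i : Fin n) (z : Om b A B) : ℝ :=
  ∑ l : Fin (s + 1), cv b A B (r + 1) (Sum.inl i) z (Fin.castLE (by omega) l) * cv b A B (s + 1) (Sum.inr i) z l

lemma bet_cont (hs : s ≤ r) (i : Fin n) : Continuous (bet b A B hs i) := by
  unfold bet
  refine continuous_finsetSum _ fun l _ => ?_
  exact ((continuous_apply _).comp (cv_cont b A B _ _)).mul ((continuous_apply _).comp (cv_cont b A B _ _))

lemma bet_flip (hs : s ≤ r) (i : Fin n) (q : Fin n ⊕ Fin n) (z : Om b A B) :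
    bet b A B hs i (flip q z) = (if q = Sum.inl i ∨ q = Sum.inr i then (-1 : ℝ) else 1) * bet b A B hs i z := by
  unfold bet
  rw [Finset.mul_sum]
  refine Finset.sum_congr rfl fun l _ => ?_
  rw [cv_flip, cv_flip]
  rcases q with q | q <;> by_cases h : q = i <;> simp [h]

def ZZ (hs : s ≤ r) : Set (Om b A B) := {z | (∀ q, ∑ l, z q l ^ 2 = 1) ∧ ∀ i, bet b A B hs i z = 0}

lemma ZZ_closed (hs : s ≤ r) : IsClosed (ZZ b A B hs) := by
  unfold ZZ
  rw [Set.ofPred_and]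
  refine IsClosed.inter ?_ ?_
  · rw [Set.ofPred_forall]
    refine isClosed_iInter fun q => isClosed_eq ?_ continuous_const
    refine continuous_finsetSum _ fun l _ => ?_
    exact ((continuous_apply l).comp (continuous_apply q)).pow 2
  · rw [Set.ofPred_forall]
    exact isClosed_iInter fun i => isClosed_eq (bet_cont b A B hs i) continuous_const

lemma ZZ_inv (hs : s ≤ r) : ∀ q, ∀ z ∈ ZZ b A B hs, flip q z ∈ ZZ b A B hs := by
  rintro q z ⟨h1, h2⟩
  exact ⟨fun q' => by rw [sq_flip, h1], fun i => by rw [bet_flip, h2, mul_zero]⟩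

lemma cvx_sq (hs : s ≤ r) (hB : B + 1 ≤ r) (i : Fin n) (z : ZZ b A B hs) :
    ∑ l, cv b A B (r + 1) (Sum.inl i) z.1 l ^ 2 = 1 := by
  rw [cv_sq _ _ _ _ _ ?_, z.2.1]
  simp only [dM, Sum.elim_inl]
  split_ifs <;> omega

lemma cvy_sq (hs : s ≤ r) (hA : A ≤ s) (i : Fin n) (z : ZZ b A B hs) :
    ∑ l, cv b A B (s + 1) (Sum.inr i) z.1 l ^ 2 = 1 := by
  rw [cv_sq _ _ _ _ _ ?_, z.2.1]
  simp only [dM, Sum.elim_inr]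
  split_ifs <;> omega

noncomputable def qq (hs : s ≤ r) (hB : B + 1 ≤ r) (hA : A ≤ s) (z : ZZ b A B hs) : Fin n → RealMilnor r s :=
  fun i => mkX hs (cv b A B (r + 1) (Sum.inl i) z.1) (cv b A B (s + 1) (Sum.inr i) z.1)
    (ne_of_sq (cvx_sq b A B hs hB i z)) (ne_of_sq (cvy_sq b A B hs hA i z)) (z.2.2 i)

lemma qq_cont (hs : s ≤ r) (hB : B + 1 ≤ r) (hA : A ≤ s) : Continuous (qq b A B hs hB hA) := by
  refine continuous_pi fun i => ?_
  exact mkX_cont hs (fun z : ZZ b A B hs => cv b A B (r + 1) (Sum.inl i) z.1)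
    (fun z => cv b A B (s + 1) (Sum.inr i) z.1)
    ((cv_cont b A B _ _).comp continuous_subtype_val) ((cv_cont b A B _ _).comp continuous_subtype_val) _ _ _

lemma mk_sign {m : ℕ} (v w : Fin m → ℝ) (hv : v ≠ 0) (hw : w ≠ 0) (P : Prop) [Decidable P]
    (h : v = (if P then (-1 : ℝ) else 1) • w) : Projectivization.mk ℝ v hv = Projectivization.mk ℝ w hw := by
  rw [Projectivization.mk_eq_mk_iff']
  exact ⟨_, h.symm⟩

lemma qq_flip (hs : s ≤ r) (hB : B + 1 ≤ r) (hA : A ≤ s) (q : Fin n ⊕ Fin n) (z : ZZ b A B hs) :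
    qq b A B hs hB hA ⟨flip q z.1, ZZ_inv b A B hs q z.1 z.2⟩ = qq b A B hs hB hA z := by
  funext i
  apply Subtype.ext
  exact Prod.ext (mk_sign _ _ _ _ _ (cv_flip b A B _ _ q z.1)) (mk_sign _ _ _ _ _ (cv_flip b A B _ _ q z.1))

/-- the function attached to one index -/
lemma onefun {m : ℕ} (hs : s ≤ r) (hB : B + 1 ≤ r) (hA : A ≤ s) (q0 q1 : Fin n ⊕ Fin n) (hq : q0 ≠ q1)
    (U : Set (Fin n → RealMilnor r s)) (hU : IsOpen U) (φ : (Fin n → RealMilnor r s) → ℝ) (hφ : Continuous φ)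
    (hφU : tsupport φ ⊆ U) (G : C(I × U, Projectivization ℝ (Fin m → ℝ)))
    (hx0 : ∀ z : ZZ b A B hs, ∑ l, cv b A B m q0 z.1 l ^ 2 = 1)
    (hx1 : ∀ z : ZZ b A B hs, ∑ l, cv b A B m q1 z.1 l ^ 2 = 1)
    (hG0 : ∀ z (h : qq b A B hs hB hA z ∈ U), G (0, ⟨_, h⟩) = Projectivization.mk ℝ _ (ne_of_sq (hx0 z)))
    (hG1 : ∀ z (h : qq b A B hs hB hA z ∈ U), G (1, ⟨_, h⟩) = Projectivization.mk ℝ _ (ne_of_sq (hx1 z))) :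
    ∃ F : Om b A B → ℝ, Continuous F ∧ (∀ z : ZZ b A B hs, F z.1 = 0 → φ (qq b A B hs hB hA z) = 0) ∧
      ∀ q z, F (Function.update z q (-(z q))) = if q = q0 ∨ q = q1 then - F z else F z := by
  have := compactX hs
  obtain ⟨f, hfc, hf0, hfe⟩ := signfun U hU G φ hφ hφU (qq b A B hs hB hA) (qq_cont b A B hs hB hA)
    (fun z => cv b A B m q0 z.1) (fun z => cv b A B m q1 z.1)
    ((cv_cont b A B _ _).comp continuous_subtype_val) ((cv_cont b A B _ _).comp continuous_subtype_val)
    hx0 hx1 hG0 hG1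
  obtain ⟨F, hFc, hFf, hFe⟩ := avg (ZZ b A B hs) (ZZ_closed b A B hs) (ZZ_inv b A B hs)
    (fun q => if q = q0 ∨ q = q1 then (-1 : ℝ) else 1) (fun q => by beta_reduce; split_ifs <;> norm_num) f hfc (by
      intro q z
      rw [hfe z _ (if q = q0 then (-1 : ℝ) else 1) (if q = q1 then (-1 : ℝ) else 1)
        (qq_flip b A B hs hB hA q z) (cv_flip b A B m q0 q z.1) (cv_flip b A B m q1 q z.1)]
      congr 1
      by_cases h0 : q = q0
      · have h1 : q ≠ q1 := fun h => hq (h0.symm.trans h)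
        simp [h0, h1, hq]
      · by_cases h1 : q = q1
        · have h2 : q1 ≠ q0 := Ne.symm hq
          simp [h1, h2]
        · simp [h0, h1])
  refine ⟨F, hFc, fun z hz => hf0 z (by rw [← hFf, hz]), fun q z => ?_⟩
  have := hFe q z
  beta_reduce at this
  unfold flip at this
  rw [this]
  split_ifs <;> simp

lemma ite_conv (P : Prop) [Decidable P] (x : ℝ) :
    (if P then -x else x) = if (if P then (1 : ZMod 2) else 0) = 0 then x else -x := by
  by_cases h : P <;> simp [h]

lemma ite_conv2 (P : Prop) [Decidable P] (x : ℝ) :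
    (if P then (-1 : ℝ) else 1) * x = if (if P then (1 : ZMod 2) else 0) = 0 then x else -x := by
  by_cases h : P <;> simp [h]

set_option maxHeartbeats 1000000 in
theorem lower {G : Type*} [Group G] [MulAction G (RealMilnor r s)] (b c : Fin n) (hbc : b ≠ c) (hs : s ≤ r)
    (a t : ℕ) (hB : 2 ^ t + 1 ≤ r) (hA : 2 ^ a ≤ s) (k : ℕ) (hk : k ∈ UB.TCset G (RealMilnor r s) n) :
    n * (2 ^ a + 2 ^ t) - 1 ≤ k := by
  by_contra hlt
  obtain ⟨hk0, U, hUo, hUc, -, hsec⟩ := hk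
  set A := 2 ^ a with hAdef
  set B := 2 ^ t with hBdef
  have hApos : 0 < A := by positivity
  have hBpos : 0 < B := by positivity
  have := compactX (r := r) (s := s) hs
  have hcard : Fintype.card (Fin k) ≤ Fintype.card ((Σ i, Fin (Mf b c B i)) ⊕ (Σ i, Fin (Mf b c A i))) := by
    simp only [Fintype.card_fin, Fintype.card_sum, Fintype.card_sigma]
    have h1 := sum_Mf b c hbc A hApos
    have h2 := sum_Mf b c hbc B hBpos
    rw [mul_add] at hlt
    omega
  have : Nonempty (Fin k) := ⟨⟨0, hk0⟩⟩
  obtain ⟨e⟩ := Function.Embedding.nonempty_of_card_le hcard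
  obtain ⟨jm, hjm⟩ : ∃ jm : (Σ i, Fin (Mf b c B i)) ⊕ (Σ i, Fin (Mf b c A i)) → Fin k, Function.Surjective jm :=
    ⟨_, Function.invFun_surjective e.injective⟩
  obtain ⟨p, hp⟩ := PartitionOfUnity.exists_isSubordinate (isClosed_univ (X := Fin n → RealMilnor r s)) U hUo
    (by rw [hUc])
  have hhom : ∀ j i, ContinuousMap.Homotopic (evU (U j) i) (evU (U j) b) := by
    intro j i
    obtain ⟨sec, -, H, h0, h1, -⟩ := hsec j
    exact ev_homotopic (U j) sec H h0 h1 i b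
  have hne : ∀ (C : ℕ) (x : Σ i, Fin (Mf b c C i)), x.1 ≠ b := by
    rintro C ⟨i, x⟩ hib
    have : Mf b c C i = 0 := by simp [Mf, show i = b from hib]
    rw [this] at x
    exact x.elim0
  have hF1 : ∀ x : (Σ i, Fin (Mf b c B i)), ∃ F : Om b A B → ℝ, Continuous F ∧
      (∀ z : ZZ b A B hs, F z.1 = 0 → p (jm (Sum.inl x)) (qq b A B hs hB hA z) = 0) ∧
      ∀ q z, F (Function.update z q (-(z q))) = if q = Sum.inl x.1 ∨ q = Sum.inl b then - F z else F z := by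
    intro x
    obtain ⟨H⟩ := hhom (jm (Sum.inl x)) x.1
    refine onefun b A B (m := r + 1) hs hB hA (Sum.inl x.1) (Sum.inl b) (by simpa using hne _ x) (U (jm (Sum.inl x))) (hUo _)
      (p (jm (Sum.inl x))) (p _).continuous (hp _)
      ⟨fun y => (H y).1.1, continuous_fst.comp (continuous_subtype_val.comp H.continuous)⟩
      (cvx_sq b A B hs hB _) (cvx_sq b A B hs hB _) ?_ ?_
    · intro z h
      change (H (0, _)).1.1 = _
      rw [H.apply_zero]
      rfl
    · intro z h
      change (H (1, _)).1.1 = _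
      rw [H.apply_one]
      rfl
  have hF2 : ∀ x : (Σ i, Fin (Mf b c A i)), ∃ F : Om b A B → ℝ, Continuous F ∧
      (∀ z : ZZ b A B hs, F z.1 = 0 → p (jm (Sum.inr x)) (qq b A B hs hB hA z) = 0) ∧
      ∀ q z, F (Function.update z q (-(z q))) = if q = Sum.inr x.1 ∨ q = Sum.inr b then - F z else F z := by
    intro x
    obtain ⟨H⟩ := hhom (jm (Sum.inr x)) x.1
    refine onefun b A B (m := s + 1) hs hB hA (Sum.inr x.1) (Sum.inr b) (by simpa using hne _ x) (U (jm (Sum.inr x))) (hUo _)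
      (p (jm (Sum.inr x))) (p _).continuous (hp _)
      ⟨fun y => (H y).1.2, continuous_snd.comp (continuous_subtype_val.comp H.continuous)⟩
      (cvy_sq b A B hs hA _) (cvy_sq b A B hs hA _) ?_ ?_
    · intro z h
      change (H (0, _)).1.2 = _
      rw [H.apply_zero]
      rfl
    · intro z h
      change (H (1, _)).1.2 = _
      rw [H.apply_one]
      rfl
  choose F1 hF1c hF1z hF1e using hF1
  choose F2 hF2c hF2z hF2e using hF2
  obtain ⟨z, hz1, hz0⟩ := BUP.bup (d := dM b A B) (epsM b c A B)
    (Sum.elim (fun i => bet b A B hs i) (Sum.elim F1 F2)) (count_ne b c hbc a t)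
    (by
      rintro (i | x | x)
      · exact bet_cont b A B hs i
      · exact hF1c x
      · exact hF2c x)
    (by
      rintro (i | x | x) q z
      · exact (bet_flip b A B hs i q z).trans (ite_conv2 _ _)
      · exact (hF1e x q z).trans (ite_conv _ _)
      · exact (hF2e x q z).trans (ite_conv _ _))
  have hzZ : z ∈ ZZ b A B hs := ⟨hz1, fun i => hz0 (Sum.inl i)⟩
  obtain ⟨j, hj⟩ := p.exists_pos (Set.mem_univ (qq b A B hs hB hA ⟨z, hzZ⟩))
  obtain ⟨x, rfl⟩ := hjm j
  rcases x with x | x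
  · exact hj.ne' (hF1z x ⟨z, hzZ⟩ (hz0 (Sum.inr (Sum.inl x))))
  · exact hj.ne' (hF2z x ⟨z, hzZ⟩ (hz0 (Sum.inr (Sum.inr x))))

end main

end LB

/-- For `1 < s < r` with `r ≢ 2 (mod 4)`, `r, s` odd, and
`s ≥ 2^{t₁}+1, r ≥ 2^{t₂}` (or `r ≥ 2^{t₁}+1, s ≥ 2^{t₂}`), any free (continuous)
`ℤ/2`-action on `ℝH_{r,s}` satisfies, for `n ≥ 2`:
`n(2^{t₁}+2^{t₂}) - 1 ≤ TC_{ℤ/2,n}(ℝH_{r,s}) ≤ n(s+r-1) + 1`. -/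
theorem eqHigherTC_Z2_milnor (r s n t₁ t₂ : ℕ) (h1s : 1 < s) (hsr : s < r)
    (hr4 : r % 4 ≠ 2) (hrodd : Odd r) (hsodd : Odd s) (ht₁ : 0 < t₁) (ht₂ : 0 < t₂)
    (hcase : (2 ^ t₁ + 1 ≤ s ∧ 2 ^ t₂ ≤ r) ∨ (2 ^ t₁ + 1 ≤ r ∧ 2 ^ t₂ ≤ s)) (hn : 2 ≤ n)
    [MulAction (Multiplicative (ZMod 2)) (↥(RealMilnor r s))]
    [ContinuousSMul (Multiplicative (ZMod 2)) (↥(RealMilnor r s))]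
    (hfree : ∀ (g : Multiplicative (ZMod 2)) (x : ↥(RealMilnor r s)), g • x = x → g = 1) :
    n * (2 ^ t₁ + 2 ^ t₂) - 1 ≤
        eqHigherTC (Multiplicative (ZMod 2)) (↥(RealMilnor r s)) n ∧
      eqHigherTC (Multiplicative (ZMod 2)) (↥(RealMilnor r s)) n ≤ n * (s + r - 1) + 1 := by
  have hn0 : 0 < n := by omega
  have : CompactSpace (RealMilnor r s) := MG.compactX hsr.le
  obtain ⟨c₀, hc⟩ := UB.charted_milnor hsr
  have hup : n * (r + s - 1) + 1 ∈ UB.TCset (Multiplicative (ZMod 2)) (RealMilnor r s) n :=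
    UB.upper hfree hc n hn0
  rw [UB.eqHigherTC_eq]
  constructor
  · have hmem := Nat.sInf_mem ⟨_, hup⟩
    have hbc : (⟨0, by omega⟩ : Fin n) ≠ ⟨1, by omega⟩ := by simp
    have he : ∀ t : ℕ, 0 < t → ∃ c, 2 ^ t = 2 * c := fun t ht => ⟨2 ^ (t - 1), by
      rw [← pow_succ']; congr 1; omega⟩
    obtain ⟨k, hk⟩ := hrodd
    rcases hcase with ⟨h1, h2⟩ | ⟨h1, h2⟩
    · obtain ⟨c, hc2⟩ := he t₂ ht₂
      exact LB.lower _ _ hbc hsr.le t₁ t₂ (by omega) (by omega) _ hmem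
    · rw [add_comm (2 ^ t₁)]
      exact LB.lower _ _ hbc hsr.le t₂ t₁ h1 h2 _ hmem
  · rw [add_comm s r]
    exact Nat.sInf_le hup
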